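/- arXiv:2209.03243 — 4 statements merged into one kernel-verified Lean document; each statement's English description precedes it below -/
import Mathlib

section
/- The monotone Euler–Maruyama scheme is L²-close to the standard Euler–Maruyama scheme: Let b : ℝ → ℝ and σ : ℝ → [0,∞) be Lipschitz functions and x₀ ∈ ℝ. There exists a constant C > 0 such that for every N ∈ ℕ, with h = 1/N, the standard Euler–Maruyama scheme X̃^h and the monotone Euler–Maruyama scheme X^h, both driven by the same Brownian motion W and started at x₀, satisfy E[ sup_{0 ≤ s ≤ 1} |X̃^h_s − X^h_s|² ] ≤ C h³. -/
open MeasureTheory ProbabilityTheory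
open scoped NNReal

/-- A standard one-dimensional Brownian motion (Wiener process) on a probability space:
a process `W` with `W 0 = 0`, a.s. continuous paths, Gaussian increments
`W t − W s ~ N(0, t − s)` for `0 ≤ s ≤ t`, each such increment being independent of
the past `σ(W r : 0 ≤ r ≤ s)`.  (Equivalently, a continuous centered Gaussian process
with `W 0 = 0` and covariance `Cov(W s, W t) = min s t`.) -/
structure IsBrownianMotion {Ω : Type*} [MeasurableSpace Ω] (P : Measure Ω)
    (W : ℝ → Ω → ℝ) : Prop where
  isProb : IsProbabilityMeasure P
  meas : ∀ t, Measurable (W t)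
  start : ∀ ω, W 0 ω = 0
  cont : ∀ᵐ ω ∂P, Continuous fun t => W t ω
  incr : ∀ s t : ℝ, 0 ≤ s → s ≤ t →
    P.map (fun ω => W t ω - W s ω) = gaussianReal 0 (Real.toNNReal (t - s))
  indep : ∀ s t : ℝ, 0 ≤ s → s ≤ t →
    Indep (MeasurableSpace.comap (fun ω => W t ω - W s ω) inferInstance)
      (⨆ r ∈ Set.Icc (0 : ℝ) s, MeasurableSpace.comap (W r) inferInstance) P
/-- The stopping time `τ_k`: the first time after `kh` at which the Brownian increment
`W_t − W_{kh}` leaves `(−A, A)`. -/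
noncomputable def truncStop {Ω : Type*} (W : ℝ → Ω → ℝ) (h A : ℝ) (k : ℕ) (ω : Ω) : ℝ :=
  sInf {s : ℝ | k * h ≤ s ∧ A ≤ |W s ω - W (k * h) ω|}

/-- The piecewise-truncated Wiener process `W^h` with `N` steps of size `h = 1/N` and
truncation level `A_h = 4√(h log(1/h))`: `W^h_0 = 0` and, for `t ∈ (kh, (k+1)h]`,
`W^h_t = W^h_{kh} + W_{t ∧ τ_k} − W_{kh}`. -/
noncomputable def truncWiener {Ω : Type*} (W : ℝ → Ω → ℝ) (N : ℕ) (t : ℝ) (ω : Ω) : ℝ :=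
  let h : ℝ := 1 / N
  let A : ℝ := 4 * Real.sqrt (h * Real.log (1 / h))
  ∑ k ∈ Finset.range N,
    (W (min (min (max t (k * h)) ((k + 1) * h)) (truncStop W h A k ω)) ω - W (k * h) ω)

/-- The discrete-time monotone Euler–Maruyama scheme:
`X^h_0 = x₀` and `X^h_{(k+1)h} = X^h_{kh} + h b(X^h_{kh}) + σ(X^h_{kh})(W^h_{(k+1)h} − W^h_{kh})`. -/
noncomputable def monEMdisc {Ω : Type*} (W : ℝ → Ω → ℝ) (N : ℕ) (b σ : ℝ → ℝ) (x₀ : ℝ) :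
    ℕ → Ω → ℝ
  | 0 => fun _ => x₀
  | k + 1 => fun ω =>
      monEMdisc W N b σ x₀ k ω + (1 / N) * b (monEMdisc W N b σ x₀ k ω) +
        σ (monEMdisc W N b σ x₀ k ω) *
          (truncWiener W N ((k + 1) * (1 / N : ℝ)) ω - truncWiener W N (k * (1 / N : ℝ)) ω)

/-- The (continuous-time) monotone Euler–Maruyama scheme: `X^h_0 = x₀` and, for
`t ∈ (kh, (k+1)h]`,
`X^h_t = X^h_{kh} + (t − kh) b(X^h_{kh}) + σ(X^h_{kh})(W^h_t − W^h_{kh})`. -/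
noncomputable def monEM {Ω : Type*} (W : ℝ → Ω → ℝ) (N : ℕ) (b σ : ℝ → ℝ) (x₀ : ℝ)
    (t : ℝ) (ω : Ω) : ℝ :=
  if t ≤ 0 then x₀
  else
    let h : ℝ := 1 / N
    let k : ℕ := ⌈t * N⌉₊ - 1
    monEMdisc W N b σ x₀ k ω + (t - k * h) * b (monEMdisc W N b σ x₀ k ω) +
      σ (monEMdisc W N b σ x₀ k ω) * (truncWiener W N t ω - truncWiener W N (k * h) ω)

/-- The discrete-time (standard) Euler–Maruyama scheme:
`X̃^h_0 = x₀` and `X̃^h_{(k+1)h} = X̃^h_{kh} + h b(X̃^h_{kh}) + σ(X̃^h_{kh})(W_{(k+1)h} − W_{kh})`. -/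
noncomputable def stdEMdisc {Ω : Type*} (W : ℝ → Ω → ℝ) (N : ℕ) (b σ : ℝ → ℝ) (x₀ : ℝ) :
    ℕ → Ω → ℝ
  | 0 => fun _ => x₀
  | k + 1 => fun ω =>
      stdEMdisc W N b σ x₀ k ω + (1 / N) * b (stdEMdisc W N b σ x₀ k ω) +
        σ (stdEMdisc W N b σ x₀ k ω) *
          (W ((k + 1) * (1 / N : ℝ)) ω - W (k * (1 / N : ℝ)) ω)

/-- The (continuous-time) standard Euler–Maruyama scheme: `X̃^h_0 = x₀` and, for
`t ∈ (kh, (k+1)h]`,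
`X̃^h_t = X̃^h_{kh} + (t − kh) b(X̃^h_{kh}) + σ(X̃^h_{kh})(W_t − W_{kh})`. -/
noncomputable def stdEM {Ω : Type*} (W : ℝ → Ω → ℝ) (N : ℕ) (b σ : ℝ → ℝ) (x₀ : ℝ)
    (t : ℝ) (ω : Ω) : ℝ :=
  if t ≤ 0 then x₀
  else
    let h : ℝ := 1 / N
    let k : ℕ := ⌈t * N⌉₊ - 1
    stdEMdisc W N b σ x₀ k ω + (t - k * h) * b (stdEMdisc W N b σ x₀ k ω) +
      σ (stdEMdisc W N b σ x₀ k ω) * (W t ω - W (k * h) ω)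

lemma meas_idx {Ω' : Type*} {m : MeasurableSpace Ω'} {f : ℕ → Ω' → ℝ} (hf : ∀ k, Measurable (f k))
    {j : Ω' → ℕ} (hj : Measurable j) : Measurable fun ω => f (j ω) ω := by
  have h1 : Measurable (fun q : Ω' × ℕ => f q.2 q.1) :=
    measurable_from_prod_countable_left fun k => hf k
  exact h1.comp (measurable_id.prodMk hj)

section PA
open scoped ENNReal
variable {Ω : Type*} [mΩ : MeasurableSpace Ω] {P : Measure Ω} {W : ℝ → Ω → ℝ}

def Fil (W : ℝ → Ω → ℝ) (s : ℝ) : MeasurableSpace Ω :=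
  ⨆ r ∈ Set.Icc (0 : ℝ) s, MeasurableSpace.comap (W r) inferInstance

lemma Fil_mono {s t : ℝ} (h : s ≤ t) : Fil W s ≤ Fil W t :=
  biSup_mono fun _ hr => ⟨hr.1, hr.2.trans h⟩

lemma Fil_le (hW : IsBrownianMotion P W) (s : ℝ) : Fil W s ≤ mΩ :=
  iSup₂_le fun r _ => (hW.meas r).comap_le

lemma Fil_meas {r s : ℝ} (h0 : 0 ≤ r) (h : r ≤ s) : Measurable[Fil W s] (W r) := by
  have : MeasurableSpace.comap (W r) inferInstance ≤ Fil W s :=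
    le_iSup₂_of_le (f := fun r (_ : r ∈ Set.Icc (0:ℝ) s) =>
      MeasurableSpace.comap (W r) inferInstance) r ⟨h0, h⟩ le_rfl
  exact Measurable.mono (comap_measurable (W r)) this le_rfl

lemma lint_indep (hW : IsBrownianMotion P W) {s t : ℝ} (h0 : 0 ≤ s) (hst : s ≤ t)
    {Y : Ω → ℝ≥0∞} (hY : Measurable[Fil W s] Y) {g : ℝ → ℝ≥0∞} (hg : Measurable g) :
    ∫⁻ ω, Y ω * g (W t ω - W s ω) ∂P
      = (∫⁻ ω, Y ω ∂P) * ∫⁻ x, g x ∂(gaussianReal 0 (Real.toNNReal (t - s))) := by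
  have hm : Measurable fun ω => W t ω - W s ω := (hW.meas t).sub (hW.meas s)
  rw [← hW.incr s t h0 hst, lintegral_map hg hm]
  exact lintegral_mul_eq_lintegral_mul_lintegral_of_independent_measurableSpace
    (Fil_le hW s) (hm.comap_le) (hW.indep s t h0 hst).symm hY
    (hg.comp (comap_measurable _))

lemma gauss_exp (v : ℝ≥0) (l : ℝ) :
    ∫⁻ x, ENNReal.ofReal (Real.exp (l * x)) ∂(gaussianReal 0 v)
      = ENNReal.ofReal (Real.exp (v * l ^ 2 / 2)) := by
  rw [← ofReal_integral_eq_lintegral_ofReal (integrable_exp_mul_gaussianReal l)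
    (Filter.Eventually.of_forall fun _ => (Real.exp_pos _).le)]
  have := congrFun (mgf_id_gaussianReal (μ := 0) (v := v)) l
  simp only [mgf, id] at this
  rw [this]; simp

lemma gauss_sq (v : ℝ≥0) (u w : ℝ) :
    ∫⁻ x, ENNReal.ofReal ((u + w * x) ^ 2) ∂(gaussianReal 0 v)
      = ENNReal.ofReal (u ^ 2 + v * w ^ 2) := by
  have h2 : MemLp id 2 (gaussianReal 0 v) := by
    have := memLp_id_gaussianReal (μ := 0) (v := v) 2
    simpa using this
  have hi : Integrable (fun x : ℝ => x) (gaussianReal 0 v) := h2.integrable (by norm_num)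
  have hi2 : Integrable (fun x : ℝ => x ^ 2) (gaussianReal 0 v) := h2.integrable_sq
  have hvar : ∫ x, x ^ 2 ∂(gaussianReal 0 v) = v := by
    have := variance_id_gaussianReal (μ := 0) (v := v)
    rw [variance_of_integral_eq_zero (by fun_prop) (by simp)] at this
    simpa using this
  have e : (fun x : ℝ => (u + w * x) ^ 2) = fun x => (u ^ 2 + 2 * u * w * x) + w ^ 2 * x ^ 2 := by
    ext x; ring
  have hA : Integrable (fun x : ℝ => u ^ 2 + 2 * u * w * x) (gaussianReal 0 v) :=
    (integrable_const _).add (hi.const_mul _)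
  rw [← ofReal_integral_eq_lintegral_ofReal _ (Filter.Eventually.of_forall fun _ => sq_nonneg _)]
  · rw [e, integral_add hA (hi2.const_mul _), integral_add (integrable_const _) (hi.const_mul _),
      integral_const_mul, integral_const_mul, hvar]
    simp [mul_comm]
  · rw [e]; exact hA.add (hi2.const_mul _)

lemma lint_exp (hW : IsBrownianMotion P W) {s t : ℝ} (h0 : 0 ≤ s) (hst : s ≤ t)
    {Y : Ω → ℝ≥0∞} (hY : Measurable[Fil W s] Y) (l : ℝ) :
    ∫⁻ ω, Y ω * ENNReal.ofReal (Real.exp (l * (W t ω - W s ω))) ∂P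
      = (∫⁻ ω, Y ω ∂P) * ENNReal.ofReal (Real.exp ((t - s) * l ^ 2 / 2)) := by
  rw [lint_indep hW h0 hst hY (g := fun x => ENNReal.ofReal (Real.exp (l * x))) (by fun_prop),
    gauss_exp, Real.coe_toNNReal _ (by linarith)]

lemma lint_sq (hW : IsBrownianMotion P W) {s t : ℝ} (h0 : 0 ≤ s) (hst : s ≤ t)
    {U V : Ω → ℝ} (hU : Measurable[Fil W s] U) (hV : Measurable[Fil W s] V) :
    ∫⁻ ω, ENNReal.ofReal ((U ω + V ω * (W t ω - W s ω)) ^ 2) ∂P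
      = ∫⁻ ω, ENNReal.ofReal (U ω ^ 2 + (t - s) * V ω ^ 2) ∂P := by
  haveI := hW.isProb
  have hm : Measurable fun ω => W t ω - W s ω := (hW.meas t).sub (hW.meas s)
  have hUV : Measurable[Fil W s] fun ω => (U ω, V ω) := hU.prodMk hV
  have hUV' : Measurable fun ω => (U ω, V ω) := hUV.mono (Fil_le hW s) le_rfl
  have hind : IndepFun (fun ω => (U ω, V ω)) (fun ω => W t ω - W s ω) P := by
    rw [IndepFun_iff_Indep]
    exact indep_of_indep_of_le_left (hW.indep s t h0 hst).symm hUV.comap_le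
  have hg : Measurable fun p : (ℝ × ℝ) × ℝ => ENNReal.ofReal ((p.1.1 + p.1.2 * p.2) ^ 2) := by
    fun_prop
  have h1 := lintegral_map hg (hUV'.prodMk hm) (μ := P)
  rw [hind.map_prod_eq_prod_map_map hUV'.aemeasurable hm.aemeasurable, hW.incr s t h0 hst,
    lintegral_prod _ hg.aemeasurable, lintegral_map hg.lintegral_prod_right' hUV'] at h1
  simp only [gauss_sq] at h1
  rw [← h1, Real.coe_toNNReal _ (by linarith)]

/-- weighted discrete maximal inequality -/
lemma bm_max_disc (hW : IsBrownianMotion P W) {t : ℕ → ℝ} (ht : Monotone t) (h0 : 0 ≤ t 0)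
    {Y : Ω → ℝ≥0∞} (hY : Measurable[Fil W (t 0)] Y) (l : ℝ) (c : ℝ≥0∞) (m : ℕ) :
    MeasurableSet[Fil W (t m)]
      {ω | ∃ i ≤ m, c ≤ ENNReal.ofReal (Real.exp (l * (W (t i) ω - W (t 0) ω)))} ∧
    c * ∫⁻ ω in {ω | ∃ i ≤ m, c ≤ ENNReal.ofReal (Real.exp (l * (W (t i) ω - W (t 0) ω)))}, Y ω ∂P
      ≤ ∫⁻ ω in {ω | ∃ i ≤ m, c ≤ ENNReal.ofReal (Real.exp (l * (W (t i) ω - W (t 0) ω)))},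
          Y ω * ENNReal.ofReal (Real.exp (l * (W (t m) ω - W (t 0) ω))) ∂P := by
  set M : ℕ → Ω → ℝ≥0∞ := fun i ω => ENNReal.ofReal (Real.exp (l * (W (t i) ω - W (t 0) ω)))
    with hM
  set B : ℕ → Set Ω := fun m => {ω | ∃ i ≤ m, c ≤ M i ω} with hB
  have hMm : ∀ i j, i ≤ j → Measurable[Fil W (t j)] (M i) := by
    intro i j hij
    have h1 : Measurable[Fil W (t j)] (W (t i)) :=
      Fil_meas (h0.trans (ht (Nat.zero_le _))) (ht hij)
    have h2 : Measurable[Fil W (t j)] (W (t 0)) := Fil_meas h0 (ht (Nat.zero_le _))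
    exact ENNReal.measurable_ofReal.comp (Real.measurable_exp.comp ((h1.sub h2).const_mul l))
  have hBm : ∀ m, MeasurableSet[Fil W (t m)] (B m) := by
    intro m
    have : B m = ⋃ i ∈ Finset.range (m+1), {ω | c ≤ M i ω} := by
      ext ω; simp [hB, Nat.lt_succ_iff]
    rw [this]
    refine @Finset.measurableSet_biUnion _ _ (Fil W (t m)) _ _ fun i hi => ?_
    exact @measurableSet_le _ _ _ _ _ (Fil W (t m)) _ _ _ _ _ (@measurable_const _ _ _ (Fil W (t m)) _)
      (hMm i m (by simpa [Nat.lt_succ_iff] using hi))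
  have hBm' : ∀ m, MeasurableSet (B m) := fun m => Fil_le hW _ _ (hBm m)
  have hYm : ∀ m, Measurable[Fil W (t m)] Y := fun m =>
    hY.mono (Fil_mono (ht (Nat.zero_le _))) le_rfl
  refine ⟨hBm m, ?_⟩
  change c * ∫⁻ ω in B m, Y ω ∂P ≤ ∫⁻ ω in B m, Y ω * M m ω ∂P
  induction m with
  | zero =>
    rw [← lintegral_const_mul _ ((hYm 0).mono (Fil_le hW _) le_rfl)]
    refine setLIntegral_mono' (hBm' 0) fun ω hω => ?_
    obtain ⟨i, hi, hc⟩ := hω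
    obtain rfl : i = 0 := by omega
    rw [mul_comm]; gcongr
  | succ m ih =>
    have hsub : B m ⊆ B (m+1) := fun ω ⟨i, hi, h⟩ => ⟨i, by omega, h⟩
    have hU : B (m+1) = B m ∪ (B (m+1) \ B m) := (Set.union_sdiff_cancel hsub).symm
    have hd : Disjoint (B m) (B (m+1) \ B m) := Set.disjoint_sdiff_right
    have hdm : MeasurableSet (B (m+1) \ B m) := (hBm' _).diff (hBm' _)
    rw [hU, lintegral_union hdm hd, lintegral_union hdm hd, mul_add]
    gcongr
    · refine ih.trans ?_
      rw [← lintegral_indicator (hBm' m), ← lintegral_indicator (hBm' m)]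
      have hZ : Measurable[Fil W (t m)] ((B m).indicator fun ω => Y ω * M m ω) :=
        Measurable.indicator ((hYm m).mul (hMm m m le_rfl)) (hBm m)
      have := lint_exp hW (h0.trans (ht (Nat.zero_le m))) (ht (Nat.le_succ m)) hZ l
      have h1 : (1:ℝ≥0∞) ≤ ENNReal.ofReal (Real.exp ((t (m+1) - t m) * l ^ 2 / 2)) := by
        rw [ENNReal.one_le_ofReal]
        apply Real.one_le_exp
        have := ht (Nat.le_succ m)
        have : 0 ≤ t (m+1) - t m := by simpa using this
        positivity
      calc _ = (∫⁻ ω, (B m).indicator (fun ω => Y ω * M m ω) ω ∂P) * 1 := by rw [mul_one]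
        _ ≤ _ := mul_le_mul_right h1 _
        _ = _ := this.symm
        _ = _ := by
          congr 1; ext ω
          by_cases h : ω ∈ B m
          · simp only [Set.indicator_of_mem h, hM]
            rw [mul_assoc, ← ENNReal.ofReal_mul (Real.exp_pos _).le, ← Real.exp_add]
            rw [← mul_add, Nat.succ_eq_add_one]
            congr 4; ring
          · simp [Set.indicator_of_notMem h]
    · rw [← lintegral_const_mul _ ((hYm 0).mono (Fil_le hW _) le_rfl)]
      refine setLIntegral_mono' hdm fun ω hω => ?_
      obtain ⟨⟨i, hi, hc⟩, hn⟩ := hω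
      obtain rfl : i = m+1 := by
        by_contra hne
        exact hn ⟨i, by omega, hc⟩
      rw [mul_comm]; gcongr

lemma bm_max_one (hW : IsBrownianMotion P W) {t : ℕ → ℝ} (ht : Monotone t) (h0 : 0 ≤ t 0)
    {Y : Ω → ℝ≥0∞} (hY : Measurable[Fil W (t 0)] Y) (l a : ℝ) (m : ℕ) :
    ∫⁻ ω in {ω | ∃ i ≤ m, l * a ≤ l * (W (t i) ω - W (t 0) ω)}, Y ω ∂P
      ≤ ENNReal.ofReal (Real.exp ((t m - t 0) * l ^ 2 / 2 - l * a)) * ∫⁻ ω, Y ω ∂P := by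
  have h := (bm_max_disc hW ht h0 hY l (ENNReal.ofReal (Real.exp (l * a))) m).2
  simp only [ENNReal.ofReal_le_ofReal_iff (Real.exp_pos _).le, Real.exp_le_exp] at h
  have h2 := h.trans (setLIntegral_le_lintegral _ _)
  rw [lint_exp hW h0 (ht (Nat.zero_le m)) hY l] at h2
  rw [Real.exp_sub, ENNReal.ofReal_div_of_pos (Real.exp_pos _), mul_comm (_ / _), ← mul_div_assoc,
    ENNReal.le_div_iff_mul_le (by simp [Real.exp_pos]) (by simp), mul_comm]
  exact h2

lemma bm_max_two (hW : IsBrownianMotion P W) {t : ℕ → ℝ} (ht : Monotone t) (h0 : 0 ≤ t 0)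
    {Y : Ω → ℝ≥0∞} (hY : Measurable[Fil W (t 0)] Y) {l : ℝ} (hl : 0 ≤ l) (a : ℝ) (m : ℕ) :
    ∫⁻ ω in {ω | ∃ i ≤ m, a < |W (t i) ω - W (t 0) ω|}, Y ω ∂P
      ≤ ENNReal.ofReal (2 * Real.exp ((t m - t 0) * l ^ 2 / 2 - l * a)) * ∫⁻ ω, Y ω ∂P := by
  have h1 := bm_max_one hW ht h0 hY l a m
  have h2 := bm_max_one hW ht h0 hY (-l) (-a) m
  rw [two_mul, ENNReal.ofReal_add (Real.exp_pos _).le (Real.exp_pos _).le, add_mul]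
  have h3 : (t m - t 0) * (-l) ^ 2 / 2 - -l * -a = (t m - t 0) * l ^ 2 / 2 - l * a := by ring
  rw [h3] at h2
  refine le_trans ?_ (add_le_add h1 h2)
  refine le_trans (lintegral_mono_set ?_) (lintegral_union_le _ _ _)
  rintro ω ⟨i, hi, h⟩
  rcases lt_abs.1 h with h | h
  · exact Or.inl ⟨i, hi, by gcongr⟩
  · exact Or.inr ⟨i, hi, by nlinarith⟩

end PA

section PB
open scoped ENNReal
variable {Ω : Type*} [mΩ : MeasurableSpace Ω] {P : Measure Ω} {W : ℝ → Ω → ℝ}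

noncomputable def bmS (W : ℝ → Ω → ℝ) (s h : ℝ) (ω : Ω) : ℝ≥0∞ :=
  ⨆ n : ℕ, ⨆ i : ℕ, ⨆ _ : i ≤ 2 ^ n, ENNReal.ofReal |W (s + i * (h / 2 ^ n)) ω - W s ω|

lemma dy_le {h : ℝ} (hh : 0 ≤ h) {n i : ℕ} (hi : i ≤ 2 ^ n) : (i : ℝ) * (h / 2 ^ n) ≤ h := by
  have : (i : ℝ) ≤ 2 ^ n := by exact_mod_cast hi
  rw [← mul_div_assoc, div_le_iff₀ (by positivity)]
  nlinarith

lemma bmS_meas {s h u : ℝ} (h0 : 0 ≤ s) (hh : 0 ≤ h) (hu : s + h ≤ u) :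
    Measurable[Fil W u] (bmS W s h) := by
  unfold bmS
  refine Measurable.iSup (mδ := Fil W u) fun n => ?_
  refine Measurable.iSup (mδ := Fil W u) fun i => ?_
  refine Measurable.iSup (mδ := Fil W u) fun hi => ?_
  have := dy_le hh hi
  have h1 : Measurable[Fil W u] (W (s + i * (h / 2 ^ n))) :=
    Fil_meas (by positivity) (by linarith)
  have h2 : Measurable[Fil W u] (W s) := Fil_meas h0 (by linarith)
  exact ENNReal.measurable_ofReal.comp (measurable_norm.comp (h1.sub h2))

lemma bm_tail (hW : IsBrownianMotion P W) {s h : ℝ} (h0 : 0 ≤ s) (hh : 0 ≤ h)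
    {Y : Ω → ℝ≥0∞} (hY : Measurable[Fil W s] Y) {l : ℝ} (hl : 0 ≤ l) (a : ℝ) :
    ∫⁻ ω in {ω | ENNReal.ofReal a < bmS W s h ω}, Y ω ∂P
      ≤ ENNReal.ofReal (2 * Real.exp (h * l ^ 2 / 2 - l * a)) * ∫⁻ ω, Y ω ∂P := by
  set G : ℕ → Set Ω := fun n => {ω | ∃ i : ℕ, i ≤ 2 ^ n ∧ a < |W (s + i * (h / 2 ^ n)) ω - W s ω|} with hG
  have hsub : {ω | ENNReal.ofReal a < bmS W s h ω} ⊆ ⋃ n, G n := by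
    intro ω hω
    simp only [bmS, Set.mem_ofPred_eq, lt_iSup_iff] at hω
    obtain ⟨n, i, hi, h⟩ := hω
    exact Set.mem_iUnion.2 ⟨n, i, hi, lt_of_not_ge fun hle => (not_le.2 h) (ENNReal.ofReal_le_ofReal hle)⟩
  have hmono : Monotone G := by
    refine monotone_nat_of_le_succ fun n => ?_
    rintro ω ⟨i, hi, h'⟩
    refine ⟨2 * i, by rw [pow_succ]; omega, ?_⟩
    convert h' using 5
    push_cast; rw [pow_succ]; field_simp
  refine (lintegral_mono_set hsub).trans ?_
  rw [setLIntegral_iUnion_of_directed _ (hmono.directed_le)]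
  refine iSup_le fun n => ?_
  have ht : Monotone fun i : ℕ => s + i * (h / 2 ^ n) := by
    intro i j hij
    have : (i : ℝ) ≤ j := by exact_mod_cast hij
    simp only; gcongr
  have := bm_max_two hW ht (by simpa using h0) (Y := Y) (hY.mono (Fil_mono (by simp)) le_rfl) hl a (2 ^ n)
  have e : (2:ℝ) ^ n * (h / 2 ^ n) = h := by field_simp
  simp only [Nat.cast_zero, zero_mul, add_zero, Nat.cast_pow, Nat.cast_ofNat, e,
    add_sub_cancel_left] at this
  exact this

noncomputable def K0 : ℝ≥0∞ :=
  ∑' n : ℕ, ENNReal.ofReal (((n : ℝ) + 1) ^ 8 * (2 * Real.exp (1 / 2 - n)))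

lemma K0_ne_top : K0 ≠ ∞ := by
  have h1 : Summable fun n : ℕ => ((n : ℝ) + 1) ^ 8 * (2 * Real.exp (1 / 2 - n)) := by
    have := Real.summable_pow_mul_exp_neg_nat_mul 8 (r := 1) one_pos
    have h2 := (summable_nat_add_iff 1).2 this
    have h3 := h2.mul_left (2 * Real.exp (3 / 2))
    refine h3.congr fun n => ?_
    push_cast
    have : Real.exp (1 / 2 - n) = Real.exp (3 / 2) * Real.exp (-1 * (n + 1)) := by
      rw [← Real.exp_add]; congr 1; ring
    rw [this]; ring
  exact h1.tsum_ofReal_ne_top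

lemma pow8_le {h : ℝ} (hh : 0 < h) (S : ℝ≥0∞) :
    S ^ 8 ≤ ∑' n : ℕ, ENNReal.ofReal (h ^ 4 * ((n : ℝ) + 1) ^ 8) *
      (if ENNReal.ofReal (n * √h) < S then 1 else 0) := by
  rcases eq_or_ne S ∞ with rfl | hS
  · have : ∑' n : ℕ, ENNReal.ofReal (h ^ 4) ≤ ∑' n : ℕ, ENNReal.ofReal (h ^ 4 * ((n : ℝ) + 1) ^ 8) *
      (if ENNReal.ofReal (n * √h) < ∞ then 1 else 0) := by
      refine ENNReal.tsum_le_tsum fun n => ?_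
      simp only [ENNReal.ofReal_lt_top, if_true, mul_one]
      apply ENNReal.ofReal_le_ofReal
      have : (1:ℝ) ≤ ((n:ℝ) + 1) ^ 8 := one_le_pow₀ (by linarith [Nat.cast_nonneg (α := ℝ) n])
      nlinarith [pow_pos hh 4]
    rw [ENNReal.tsum_const_eq_top_of_ne_zero (by simp; positivity)] at this
    exact le_top.trans this
  · lift S to ℝ≥0 using hS
    rcases eq_or_ne S 0 with rfl | hS0
    · simp
    have hpos : (0:ℝ) < S := by positivity
    have hq : 0 < √h := Real.sqrt_pos.2 hh
    set n := ⌈(S:ℝ) / √h⌉₊ - 1 with hn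
    have hc : 0 < ⌈(S:ℝ) / √h⌉₊ := Nat.ceil_pos.2 (by positivity)
    have h1 : ((n:ℝ)) < S / √h := by
      apply Nat.lt_ceil.1; omega
    have h2 : (S:ℝ) / √h ≤ n + 1 := by
      have := Nat.le_ceil ((S:ℝ) / √h)
      have e : ⌈(S:ℝ) / √h⌉₊ = n + 1 := by omega
      rw [e] at this; exact_mod_cast this
    rw [lt_div_iff₀ hq] at h1
    rw [div_le_iff₀ hq] at h2
    refine le_trans ?_ (ENNReal.le_tsum n)
    have h3 : ENNReal.ofReal (n * √h) < (S:ℝ≥0∞) := by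
      rw [← ENNReal.ofReal_coe_nnreal, ENNReal.ofReal_lt_ofReal_iff hpos]; exact h1
    rw [if_pos h3, mul_one, ← ENNReal.ofReal_coe_nnreal, ← ENNReal.ofReal_pow hpos.le]
    apply ENNReal.ofReal_le_ofReal
    calc (S:ℝ) ^ 8 ≤ ((n + 1) * √h) ^ 8 := by gcongr
      _ = (√h ^ 2) ^ 4 * ((n:ℝ) + 1) ^ 8 := by ring
      _ = _ := by rw [Real.sq_sqrt hh.le]

lemma bm_mom8 (hW : IsBrownianMotion P W) {s h : ℝ} (h0 : 0 ≤ s) (hh : 0 < h)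
    {Y : Ω → ℝ≥0∞} (hY : Measurable[Fil W s] Y) :
    ∫⁻ ω, Y ω * bmS W s h ω ^ 8 ∂P ≤ ENNReal.ofReal (h ^ 4) * K0 * ∫⁻ ω, Y ω ∂P := by
  have hSm : Measurable (bmS W s h) := (bmS_meas h0 hh.le le_rfl).mono (Fil_le hW _) le_rfl
  have hYm : Measurable Y := hY.mono (Fil_le hW _) le_rfl
  have hset : ∀ n : ℕ, MeasurableSet {ω | ENNReal.ofReal (n * √h) < bmS W s h ω} := fun n =>
    measurableSet_lt measurable_const hSm
  calc ∫⁻ ω, Y ω * bmS W s h ω ^ 8 ∂P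
      ≤ ∫⁻ ω, ∑' n : ℕ, ENNReal.ofReal (h ^ 4 * ((n : ℝ) + 1) ^ 8) *
          ({ω | ENNReal.ofReal (n * √h) < bmS W s h ω}.indicator Y ω) ∂P := by
        refine lintegral_mono fun ω => ?_
        refine (mul_le_mul_right (pow8_le hh _) _).trans (le_of_eq ?_)
        rw [← ENNReal.tsum_mul_left]
        congr 1; ext n
        by_cases hc : ENNReal.ofReal (n * √h) < bmS W s h ω
        · rw [if_pos hc, Set.indicator_of_mem (by exact hc)]; ring
        · rw [if_neg hc, Set.indicator_of_notMem (by exact hc)]; ring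
    _ = ∑' n : ℕ, ENNReal.ofReal (h ^ 4 * ((n : ℝ) + 1) ^ 8) *
          ∫⁻ ω in {ω | ENNReal.ofReal (n * √h) < bmS W s h ω}, Y ω ∂P := by
        rw [lintegral_tsum]
        · congr 1; ext n
          rw [lintegral_const_mul _ (hYm.indicator (hset n)), lintegral_indicator (hset n)]
        · intro n
          exact ((hYm.indicator (hset n)).const_mul _).aemeasurable
    _ ≤ ∑' n : ℕ, ENNReal.ofReal (h ^ 4) *
          ENNReal.ofReal (((n : ℝ) + 1) ^ 8 * (2 * Real.exp (1 / 2 - n))) * ∫⁻ ω, Y ω ∂P := by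
        refine ENNReal.tsum_le_tsum fun n => ?_
        have := bm_tail hW h0 hh.le hY (l := 1 / √h) (by positivity) (n * √h)
        have hq : 0 < √h := Real.sqrt_pos.2 hh
        have e : h * (1 / √h) ^ 2 / 2 - 1 / √h * (n * √h) = 1 / 2 - n := by
          rw [div_pow, Real.sq_sqrt hh.le]; field_simp
        rw [e] at this
        refine (mul_le_mul_right this _).trans (le_of_eq ?_)
        rw [← mul_assoc, ← ENNReal.ofReal_mul (by positivity), ← ENNReal.ofReal_mul (by positivity),
          mul_assoc]
    _ = _ := by
        rw [ENNReal.tsum_mul_right, ENNReal.tsum_mul_left]; rfl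

lemma sq_le_a {h : ℝ} (hh : 0 < h) (S : ℝ≥0∞) :
    S ^ 2 ≤ ENNReal.ofReal h + ENNReal.ofReal ((h ^ 3)⁻¹) * S ^ 8 := by
  rcases eq_or_ne S ∞ with rfl | hS
  · have : ENNReal.ofReal ((h ^ 3)⁻¹) ≠ 0 := by simp; positivity
    simp [ENNReal.mul_top this]
  · lift S to ℝ≥0 using hS
    rw [← ENNReal.ofReal_coe_nnreal, ← ENNReal.ofReal_pow S.coe_nonneg, ← ENNReal.ofReal_pow S.coe_nonneg,
      ← ENNReal.ofReal_mul (by positivity), ← ENNReal.ofReal_add hh.le (by positivity)]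
    apply ENNReal.ofReal_le_ofReal
    rw [inv_mul_eq_div, ← sub_le_iff_le_add', le_div_iff₀ (by positivity)]
    rcases le_total ((S:ℝ) ^ 2) h with h1 | h1
    · have : ((S:ℝ) ^ 2 - h) * h ^ 3 ≤ 0 :=
        mul_nonpos_of_nonpos_of_nonneg (by linarith) (by positivity)
      exact this.trans (by positivity)
    · have : h ^ 3 ≤ ((S:ℝ) ^ 2) ^ 3 := by gcongr
      calc ((S:ℝ) ^ 2 - h) * h ^ 3 ≤ (S:ℝ) ^ 2 * ((S:ℝ) ^ 2) ^ 3 := by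
            gcongr; linarith
        _ = _ := by ring

lemma sq_le_b {h : ℝ} (hh : 0 < h) (S : ℝ≥0∞) :
    S ^ 2 ≤ ENNReal.ofReal (h⁻¹) + ENNReal.ofReal (h ^ 3) * S ^ 8 := by
  have := sq_le_a (h := h⁻¹) (by positivity) S
  simpa using this

noncomputable def K1 : ℝ := 1 + K0.toReal + 6

lemma bm_mom2 (hW : IsBrownianMotion P W) {s h : ℝ} (h0 : 0 ≤ s) (hh : 0 < h)
    {Y : Ω → ℝ≥0∞} (hY : Measurable[Fil W s] Y) :
    ∫⁻ ω, Y ω * bmS W s h ω ^ 2 ∂P ≤ ENNReal.ofReal (K1 * h) * ∫⁻ ω, Y ω ∂P := by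
  have hSm : Measurable (bmS W s h) := (bmS_meas h0 hh.le le_rfl).mono (Fil_le hW _) le_rfl
  have hYm : Measurable Y := hY.mono (Fil_le hW _) le_rfl
  calc ∫⁻ ω, Y ω * bmS W s h ω ^ 2 ∂P
      ≤ ∫⁻ ω, ENNReal.ofReal h * Y ω + ENNReal.ofReal ((h ^ 3)⁻¹) * (Y ω * bmS W s h ω ^ 8) ∂P := by
        refine lintegral_mono fun ω => (mul_le_mul_right (sq_le_a hh _) _).trans (le_of_eq ?_)
        ring
    _ = ENNReal.ofReal h * ∫⁻ ω, Y ω ∂P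
          + ENNReal.ofReal ((h ^ 3)⁻¹) * ∫⁻ ω, (Y ω * bmS W s h ω ^ 8) ∂P := by
        rw [lintegral_add_left (hYm.const_mul _), lintegral_const_mul _ hYm,
          lintegral_const_mul _ (show Measurable fun ω => Y ω * bmS W s h ω ^ 8 from
            hYm.mul (hSm.pow_const 8))]
    _ ≤ ENNReal.ofReal h * ∫⁻ ω, Y ω ∂P
          + ENNReal.ofReal ((h ^ 3)⁻¹) * (ENNReal.ofReal (h ^ 4) * K0 * ∫⁻ ω, Y ω ∂P) := by
        gcongr; exact bm_mom8 hW h0 hh hY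
    _ = ENNReal.ofReal (h + h * K0.toReal) * ∫⁻ ω, Y ω ∂P := by
        have e : K0 = ENNReal.ofReal K0.toReal := (ENNReal.ofReal_toReal K0_ne_top).symm
        rw [ENNReal.ofReal_add hh.le (by positivity), add_mul]
        congr 1
        rw [← mul_assoc]; congr 1
        nth_rw 1 [e]
        rw [← ENNReal.ofReal_mul (by positivity), ← ENNReal.ofReal_mul (by positivity)]
        congr 1; field_simp
    _ ≤ _ := by
        gcongr
        unfold K1; linarith

lemma bm_bad (hW : IsBrownianMotion P W) {s : ℝ} (h0 : 0 ≤ s) {N : ℕ} (hN : 0 < N)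
    {Y : Ω → ℝ≥0∞} (hY : Measurable[Fil W s] Y) :
    ∫⁻ ω in {ω | ENNReal.ofReal (4 * √(1 / (N:ℝ) * Real.log (1 / (1 / (N:ℝ))))) ≤
        bmS W s (1 / (N:ℝ)) ω}, Y ω ∂P
      ≤ ENNReal.ofReal (6 * (1 / (N:ℝ)) ^ 8) * ∫⁻ ω, Y ω ∂P := by
  set h : ℝ := 1 / (N:ℝ) with hh
  have hNr : (0:ℝ) < N := by exact_mod_cast hN
  have hpos : 0 < h := by positivity
  rcases Nat.lt_or_ge 1 N with h1 | h1
  · have hN1 : (1:ℝ) < N := by exact_mod_cast h1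
    have hlog : 0 < Real.log (1 / h) := by
      rw [hh, one_div_one_div]; exact Real.log_pos hN1
    set A : ℝ := 4 * √(h * Real.log (1 / h)) with hA
    have hApos : 0 < A := by positivity
    have hA2 : A ^ 2 = 16 * (h * Real.log (1 / h)) := by
      rw [hA, mul_pow, Real.sq_sqrt (by positivity)]; norm_num
    have := bm_tail hW h0 hpos.le hY (l := A / h) (by positivity) (A - h / A)
    refine (lintegral_mono_set ?_).trans (this.trans ?_)
    · intro ω hω
      have hω' : ENNReal.ofReal A ≤ bmS W s h ω := hω
      refine lt_of_lt_of_le ?_ hω'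
      rw [ENNReal.ofReal_lt_ofReal_iff hApos]
      have : 0 < h / A := by positivity
      linarith
    · refine mul_le_mul_left (ENNReal.ofReal_le_ofReal ?_) _
      have e : h * (A / h) ^ 2 / 2 - A / h * (A - h / A) = 1 - A ^ 2 / (2 * h) := by
        field_simp; ring
      have e2 : A ^ 2 / (2 * h) = 8 * Real.log (1 / h) := by
        rw [hA2]; field_simp; norm_num
      rw [e, e2, Real.exp_sub]
      have e3 : Real.exp (8 * Real.log (1 / h)) = (1 / h) ^ 8 := by
        have := Real.exp_nat_mul (Real.log (1 / h)) 8
        rw [Real.exp_log (by positivity)] at this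
        exact_mod_cast this
      rw [e3]
      have := Real.exp_one_lt_d9
      have e4 : 2 * (Real.exp 1 / (1 / h) ^ 8) = 2 * Real.exp 1 * h ^ 8 := by
        field_simp
      rw [e4]
      gcongr; linarith
  · obtain rfl : N = 1 := by omega
    have : h = 1 := by simp [hh]
    rw [this]
    refine (setLIntegral_le_lintegral _ _).trans ?_
    have h6 : (1:ℝ≥0∞) ≤ ENNReal.ofReal (6 * 1 ^ 8) := by
      rw [ENNReal.one_le_ofReal]; norm_num
    calc _ = 1 * ∫⁻ ω, Y ω ∂P := by rw [one_mul]
      _ ≤ _ := mul_le_mul_left h6 _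

/-- `S² 1_{S ≥ A}` -/
noncomputable def bmT (W : ℝ → Ω → ℝ) (s : ℝ) (N : ℕ) (ω : Ω) : ℝ≥0∞ :=
  {ω | ENNReal.ofReal (4 * √(1 / (N:ℝ) * Real.log (1 / (1 / (N:ℝ))))) ≤
        bmS W s (1 / (N:ℝ)) ω}.indicator (fun ω => bmS W s (1 / (N:ℝ)) ω ^ 2) ω

lemma bmT_meas (hW : IsBrownianMotion P W) {s : ℝ} (h0 : 0 ≤ s) (N : ℕ) :
    Measurable (bmT W s N) := by
  have hSm : Measurable (bmS W s (1 / (N:ℝ))) :=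
    (bmS_meas h0 (by positivity) le_rfl).mono (Fil_le hW _) le_rfl
  exact (hSm.pow_const 2).indicator (measurableSet_le measurable_const hSm)

lemma bm_T (hW : IsBrownianMotion P W) {s : ℝ} (h0 : 0 ≤ s) {N : ℕ} (hN : 0 < N)
    {Y : Ω → ℝ≥0∞} (hY : Measurable[Fil W s] Y) :
    ∫⁻ ω, Y ω * bmT W s N ω ∂P
      ≤ ENNReal.ofReal (K1 * (1 / (N:ℝ)) ^ 7) * ∫⁻ ω, Y ω ∂P := by
  set h : ℝ := 1 / (N:ℝ) with hhd
  have hNr : (0:ℝ) < N := by exact_mod_cast hN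
  have hh : 0 < h := by positivity
  have hSm : Measurable (bmS W s h) := (bmS_meas h0 hh.le le_rfl).mono (Fil_le hW _) le_rfl
  have hYm : Measurable Y := hY.mono (Fil_le hW _) le_rfl
  set B : Set Ω := {ω | ENNReal.ofReal (4 * √(1 / (N:ℝ) * Real.log (1 / (1 / (N:ℝ))))) ≤
        bmS W s (1 / (N:ℝ)) ω} with hB
  have hBm : MeasurableSet B := measurableSet_le measurable_const hSm
  calc ∫⁻ ω, Y ω * bmT W s N ω ∂P
      ≤ ∫⁻ ω, ENNReal.ofReal (h⁻¹) * B.indicator Y ω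
          + ENNReal.ofReal (h ^ 3) * (Y ω * bmS W s h ω ^ 8) ∂P := by
        refine lintegral_mono fun ω => ?_
        unfold bmT
        by_cases hω : ω ∈ B
        · rw [Set.indicator_of_mem hω, Set.indicator_of_mem hω]
          refine (mul_le_mul_right (sq_le_b hh _) _).trans (le_of_eq ?_)
          ring
        · rw [Set.indicator_of_notMem hω, mul_zero]; exact zero_le
    _ = ENNReal.ofReal (h⁻¹) * ∫⁻ ω in B, Y ω ∂P
          + ENNReal.ofReal (h ^ 3) * ∫⁻ ω, (Y ω * bmS W s h ω ^ 8) ∂P := by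
        rw [lintegral_add_left ((hYm.indicator hBm).const_mul _),
          lintegral_const_mul _ (hYm.indicator hBm), lintegral_indicator hBm,
          lintegral_const_mul _ (show Measurable fun ω => Y ω * bmS W s h ω ^ 8 from
            hYm.mul (hSm.pow_const 8))]
    _ ≤ ENNReal.ofReal (h⁻¹) * (ENNReal.ofReal (6 * h ^ 8) * ∫⁻ ω, Y ω ∂P)
          + ENNReal.ofReal (h ^ 3) * (ENNReal.ofReal (h ^ 4) * K0 * ∫⁻ ω, Y ω ∂P) := by
        gcongr
        · exact bm_bad hW h0 hN hY
        · exact bm_mom8 hW h0 hh hY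
    _ = ENNReal.ofReal (6 * h ^ 7 + h ^ 7 * K0.toReal) * ∫⁻ ω, Y ω ∂P := by
        have e : K0 = ENNReal.ofReal K0.toReal := (ENNReal.ofReal_toReal K0_ne_top).symm
        rw [ENNReal.ofReal_add (by positivity) (by positivity), add_mul]
        congr 1
        · rw [← mul_assoc]; congr 1
          rw [← ENNReal.ofReal_mul (by positivity)]
          congr 1; field_simp
        rw [← mul_assoc]; congr 1
        nth_rw 1 [e]
        rw [← ENNReal.ofReal_mul (by positivity), ← ENNReal.ofReal_mul (by positivity)]
        congr 1; field_simp
    _ ≤ _ := by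
        gcongr
        have : 0 < h ^ 7 := by positivity
        unfold K1; linarith

end PB

section PC
open scoped ENNReal
variable {Ω : Type*} [mΩ : MeasurableSpace Ω] {P : Measure Ω} {W : ℝ → Ω → ℝ}

lemma tendsto_h2 (h : ℝ) : Filter.Tendsto (fun n : ℕ => h / 2 ^ n) Filter.atTop (nhds 0) := by
  have := (tendsto_pow_atTop_nhds_zero_of_lt_one (r := (1/2:ℝ)) (by norm_num) (by norm_num)).const_mul h
  simpa [div_eq_mul_inv] using this

lemma tendsto_of_close {x : ℕ → ℝ} {y h : ℝ} (hx : ∀ n, |x n - y| ≤ h / 2 ^ n) :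
    Filter.Tendsto x Filter.atTop (nhds y) := by
  rw [tendsto_iff_dist_tendsto_zero]
  exact squeeze_zero (fun _ => dist_nonneg) (fun n => by rw [Real.dist_eq]; exact hx n)
    (tendsto_h2 h)

lemma bmS_ge {s h t : ℝ} {ω : Ω} (hc : Continuous fun t => W t ω) (hh : 0 < h)
    (h1 : s ≤ t) (h2 : t ≤ s + h) : ENNReal.ofReal |W t ω - W s ω| ≤ bmS W s h ω := by
  set i : ℕ → ℕ := fun n => ⌊(t - s) / h * 2 ^ n⌋₊ with hi
  have hu0 : 0 ≤ (t - s) / h := div_nonneg (by linarith) hh.le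
  have hu1 : (t - s) / h ≤ 1 := by rw [div_le_one hh]; linarith
  have hle : ∀ n, i n ≤ 2 ^ n := by
    intro n
    apply Nat.floor_le_of_le
    push_cast
    have : (0:ℝ) < 2 ^ n := by positivity
    nlinarith
  have hcl : ∀ n, |(s + i n * (h / 2 ^ n)) - t| ≤ h / 2 ^ n := by
    intro n
    have a1 : (i n : ℝ) ≤ (t - s) / h * 2 ^ n := Nat.floor_le (by positivity)
    have a2 : (t - s) / h * 2 ^ n < i n + 1 := Nat.lt_floor_add_one _
    have e : (t - s) / h * 2 ^ n * (h / 2 ^ n) = t - s := by field_simp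
    have hp : 0 < h / 2 ^ n := by positivity
    rw [abs_le]
    constructor <;> nlinarith
  have ht := tendsto_of_close hcl
  have := (ENNReal.continuous_ofReal.comp
    ((hc.sub continuous_const).abs : Continuous fun t => |W t ω - W s ω|)).continuousAt.tendsto.comp ht
  refine le_of_tendsto' this fun n => ?_
  exact le_iSup_of_le n (le_iSup_of_le (i n) (le_iSup_of_le (hle n) le_rfl))

lemma bmS_lt {s h A : ℝ} {ω : Ω} (hc : Continuous fun t => W t ω) (hh : 0 ≤ h)
    (hA : ∀ r, s ≤ r → r ≤ s + h → |W r ω - W s ω| < A) : bmS W s h ω < ENNReal.ofReal A := by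
  have hc' : Continuous fun t => |W t ω - W s ω| := (hc.sub continuous_const).abs
  obtain ⟨x, hx, hm⟩ := (isCompact_Icc (a := s) (b := s + h)).exists_isMaxOn
    ⟨s, by simp [hh]⟩ hc'.continuousOn
  have hx' := hA x hx.1 hx.2
  refine lt_of_le_of_lt ?_ ((ENNReal.ofReal_lt_ofReal_iff (lt_of_le_of_lt (abs_nonneg _) hx')).2 hx')
  refine iSup_le fun n => iSup_le fun i => iSup_le fun hi => ENNReal.ofReal_le_ofReal ?_
  have := dy_le hh hi
  exact hm ⟨by have : 0 ≤ (i:ℝ) * (h / 2 ^ n) := by positivity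
               linarith, by linarith⟩

lemma stop_meas {s h : ℝ} (h0 : 0 ≤ s) (hh : 0 < h) (A : ℝ) :
    ∃ D : Ω → ℝ, Measurable[Fil W (s + h)] D ∧ ∀ ω, Continuous (fun t => W t ω) →
      {r : ℝ | s ≤ r ∧ A ≤ |W r ω - W s ω|}.Nonempty →
      D ω = W (min (s + h) (sInf {r : ℝ | s ≤ r ∧ A ≤ |W r ω - W s ω|})) ω - W s ω := by
  classical
  set p : ℕ → Ω → ℕ → Prop := fun n ω i => bmS W s (i * (h / 2 ^ n)) ω < ENNReal.ofReal A with hp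
  set j : ℕ → Ω → ℕ := fun n ω => Nat.findGreatest (p n ω) (2 ^ n) with hj
  have hjm : ∀ n, Measurable[Fil W (s + h)] (j n) := by
    intro n
    refine @measurable_findGreatest _ (Fil W (s+h)) _ _ _ fun k hk => ?_
    have := dy_le hh.le hk
    exact @measurableSet_lt _ _ _ _ _ (Fil W (s + h)) _ _ _ _ _
      (bmS_meas h0 (by positivity) (by linarith)) (@measurable_const _ _ _ (Fil W (s+h)) _)
  set g : ℕ → Ω → ℝ := fun n ω => W (s + (min (j n ω) (2 ^ n) : ℕ) * (h / 2 ^ n)) ω with hg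
  have hgm : ∀ n, Measurable[Fil W (s + h)] (g n) := by
    intro n
    refine meas_idx (m := Fil W (s + h))
      (f := fun k ω => W (s + (min k (2 ^ n) : ℕ) * (h / 2 ^ n)) ω) (fun k => ?_) (hjm n)
    have := dy_le hh.le (min_le_right k (2 ^ n))
    exact Fil_meas (add_nonneg h0 (by positivity)) (add_le_add le_rfl this)
  have hWs : Measurable[Fil W (s + h)] (W s) := Fil_meas h0 (by linarith)
  refine ⟨fun ω => Filter.limsup (fun n => g n ω) Filter.atTop - W s ω,
    (Measurable.limsup hgm).sub hWs, ?_⟩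
  intro ω hc hne
  refine congrArg (fun z => z - W s ω) ?_
  apply Filter.Tendsto.limsup_eq
  set τ := sInf {r : ℝ | s ≤ r ∧ A ≤ |W r ω - W s ω|} with hτ
  have hbdd : BddBelow {r : ℝ | s ≤ r ∧ A ≤ |W r ω - W s ω|} := ⟨s, fun r hr => hr.1⟩
  have hsτ : s ≤ τ := le_csInf hne fun r hr => hr.1
  refine (hc.continuousAt.tendsto (x := min (s + h) τ)).comp
    (tendsto_of_close (h := h) fun n => ?_)
  have hjle : j n ω ≤ 2 ^ n := Nat.findGreatest_le _
  rw [min_eq_left hjle]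
  have hdle := dy_le hh.le hjle
  have hpos : 0 < h / 2 ^ n := by positivity
  have hlow : s + j n ω * (h / 2 ^ n) ≤ τ := by
    rcases eq_or_ne (j n ω) 0 with h00 | h00
    · rw [h00]; simpa using hsτ
    · have hP : p n ω (j n ω) := Nat.findGreatest_of_ne_zero rfl h00
      have hjp : (0:ℝ) < j n ω := by exact_mod_cast Nat.pos_of_ne_zero h00
      refine le_csInf hne fun r hr => ?_
      by_contra hlt
      push Not at hlt
      have := bmS_ge hc (h := j n ω * (h / 2 ^ n)) (by positivity) hr.1 hlt.le
      have h3 := (ENNReal.ofReal_le_ofReal hr.2).trans this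
      exact absurd hP (not_lt.2 h3)
  have hup : min (s + h) τ ≤ s + j n ω * (h / 2 ^ n) + h / 2 ^ n := by
    rcases Nat.lt_or_ge (j n ω) (2 ^ n) with hlt | hge
    · have hnP : ¬ p n ω (j n ω + 1) := Nat.findGreatest_is_greatest (Nat.lt_succ_self _) hlt
      by_contra hcon
      push Not at hcon
      apply hnP
      refine bmS_lt hc (by positivity) fun r hr1 hr2 => ?_
      by_contra hA
      push Not at hA
      have : τ ≤ r := csInf_le hbdd ⟨hr1, hA⟩
      have h5 := lt_of_lt_of_le hcon (min_le_right _ _)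
      push_cast at hr2
      linarith
    · have e : j n ω = 2 ^ n := le_antisymm hjle hge
      refine (min_le_left _ _).trans ?_
      rw [e]; push_cast
      have : (2:ℝ) ^ n * (h / 2 ^ n) = h := by field_simp
      linarith
  have hmin : s + j n ω * (h / 2 ^ n) ≤ min (s + h) τ := le_min (by linarith) hlow
  rw [abs_le]
  constructor <;> linarith

/-- Almost surely the path leaves every bounded interval. -/
lemma exit_ae (hW : IsBrownianMotion P W) {s : ℝ} (h0 : 0 ≤ s) (A : ℝ) :
    ∀ᵐ ω ∂P, {r : ℝ | s ≤ r ∧ A ≤ |W r ω - W s ω|}.Nonempty := by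
  have := hW.isProb
  have key : ∀ n : ℕ, P {ω | ¬ {r : ℝ | s ≤ r ∧ A ≤ |W r ω - W s ω|}.Nonempty} ≤
      ENNReal.ofReal ((√(2 * Real.pi * ((n:ℝ) + 1)))⁻¹ * (2 * A)) := by
    intro n
    have hm : Measurable fun ω => W (s + (n + 1)) ω - W s ω := (hW.meas _).sub (hW.meas _)
    have hsub : {ω | ¬ {r : ℝ | s ≤ r ∧ A ≤ |W r ω - W s ω|}.Nonempty} ⊆
        (fun ω => W (s + (n + 1)) ω - W s ω) ⁻¹' (Set.Ioo (-A) A) := by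
      intro ω hω
      have hω' : ¬ {r : ℝ | s ≤ r ∧ A ≤ |W r ω - W s ω|}.Nonempty := hω
      have : ¬ A ≤ |W (s + (n + 1)) ω - W s ω| := fun hA =>
        hω' ⟨s + (n + 1), by have : (0:ℝ) ≤ n := Nat.cast_nonneg n
                             linarith, hA⟩
      exact abs_lt.1 (not_le.1 this)
    refine (measure_mono hsub).trans ?_
    rw [← Measure.map_apply hm measurableSet_Ioo, hW.incr s _ h0 (by linarith [Nat.cast_nonneg (α := ℝ) n]),
      add_sub_cancel_left]
    have hv : Real.toNNReal ((n:ℝ) + 1) ≠ 0 := by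
      simp only [ne_eq, Real.toNNReal_eq_zero, not_le]; positivity
    rw [gaussianReal_apply _ hv]
    have hpdf : ∀ x, gaussianPDF 0 (Real.toNNReal ((n:ℝ) + 1)) x ≤
        ENNReal.ofReal ((√(2 * Real.pi * ((n:ℝ) + 1)))⁻¹) := by
      intro x
      unfold gaussianPDF gaussianPDFReal
      apply ENNReal.ofReal_le_ofReal
      rw [Real.coe_toNNReal _ (by positivity)]
      refine mul_le_of_le_one_right (by positivity) ?_
      rw [Real.exp_le_one_iff]
      rw [neg_div]; exact neg_nonpos.2 (by positivity)
    refine (lintegral_mono hpdf).trans ?_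
    rw [lintegral_const, Measure.restrict_apply MeasurableSet.univ, Set.univ_inter, Real.volume_Ioo,
      ENNReal.ofReal_mul (by positivity)]
    gcongr
    linarith
  have hlim : Filter.Tendsto (fun n : ℕ => ENNReal.ofReal ((√(2 * Real.pi * ((n:ℝ) + 1)))⁻¹ * (2 * A)))
      Filter.atTop (nhds 0) := by
    have h1 : Filter.Tendsto (fun n : ℕ => (√(2 * Real.pi * ((n:ℝ) + 1)))) Filter.atTop Filter.atTop := by
      apply Real.tendsto_sqrt_atTop.comp
      apply Filter.Tendsto.const_mul_atTop (by positivity)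
      exact Filter.tendsto_atTop_add_const_right _ _ tendsto_natCast_atTop_atTop
    have h2 := ENNReal.tendsto_ofReal ((h1.inv_tendsto_atTop).mul_const (2 * A))
    simpa using h2
  exact le_antisymm (ge_of_tendsto' hlim key) zero_le

end PC

section PD
open scoped ENNReal
variable {Ω : Type*} [mΩ : MeasurableSpace Ω] {P : Measure Ω} {W : ℝ → Ω → ℝ}

noncomputable def emRec (h : ℝ) (b σ : ℝ → ℝ) (x₀ : ℝ) (D : ℕ → Ω → ℝ) : ℕ → Ω → ℝ
  | 0 => fun _ => x₀
  | k + 1 => fun ω => emRec h b σ x₀ D k ω + h * b (emRec h b σ x₀ D k ω) +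
      σ (emRec h b σ x₀ D k ω) * D k ω

def dW (W : ℝ → Ω → ℝ) (h : ℝ) (k : ℕ) (ω : Ω) : ℝ := W ((k + 1) * h) ω - W (k * h) ω

structure LipL (b σ : ℝ → ℝ) (L : ℝ) : Prop where
  one : 1 ≤ L
  b1 : ∀ x y, |b x - b y| ≤ L * |x - y|
  s1 : ∀ x y, |σ x - σ y| ≤ L * |x - y|
  b2 : ∀ x, |b x| ≤ L * (1 + |x|)
  s2 : ∀ x, |σ x| ≤ L * (1 + |x|)
  bm : Measurable b
  sm : Measurable σ

lemma emRec_meas {b σ : ℝ → ℝ} {L : ℝ} (hL : LipL b σ L) {h : ℝ} (hh : 0 ≤ h) (x₀ : ℝ)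
    {D : ℕ → Ω → ℝ} {N : ℕ} (hD : ∀ k < N, Measurable[Fil W ((k + 1) * h)] (D k)) (k : ℕ) (hk : k ≤ N) :
    Measurable[Fil W (k * h)] (emRec h b σ x₀ D k) := by
  induction k with
  | zero => exact @measurable_const _ _ _ (Fil W _) _
  | succ k ih =>
    have ih' : Measurable[Fil W ((k + 1) * h)] (emRec h b σ x₀ D k) :=
      (ih (by omega)).mono (Fil_mono (by nlinarith)) le_rfl
    have h3 := (ih'.add ((hL.bm.comp ih').const_mul h)).add
      ((hL.sm.comp ih').mul (hD k (by omega)))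
    have e : (((k + 1 : ℕ) : ℝ)) * h = (k + 1) * h := by push_cast; ring
    rw [e]
    exact h3

lemma dW_meas {h : ℝ} (hh : 0 ≤ h) (k : ℕ) : Measurable[Fil W ((k + 1) * h)] (dW W h k) := by
  have h1 : Measurable[Fil W ((k + 1) * h)] (W ((k + 1) * h)) := Fil_meas (by positivity) le_rfl
  have h2 : Measurable[Fil W ((k + 1) * h)] (W (k * h)) := Fil_meas (by positivity) (by nlinarith)
  exact h1.sub h2

lemma gron {u : ℕ → ℝ≥0∞} {c d h : ℝ} (hc : 0 ≤ c) (hd : 0 ≤ d) (hh : 0 ≤ h) {N : ℕ}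
    (hNh : N * h = 1) {a : ℝ} (ha : 0 ≤ a) (h0 : u 0 ≤ ENNReal.ofReal a)
    (hu : ∀ k < N, u (k + 1) ≤ ENNReal.ofReal (1 + c * h) * u k + ENNReal.ofReal d) :
    ∀ k ≤ N, u k ≤ ENNReal.ofReal (Real.exp c * (a + N * d)) := by
  have key : ∀ k ≤ N, u k ≤ ENNReal.ofReal ((1 + c * h) ^ k * (a + k * d)) := by
    intro k
    induction k with
    | zero => intro _; simpa using h0
    | succ k ih =>
      intro hk
      refine (hu k (by omega)).trans ?_
      refine (add_le_add (mul_le_mul_right (ih (by omega)) _) le_rfl).trans ?_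
      rw [← ENNReal.ofReal_mul (by positivity), ← ENNReal.ofReal_add (by positivity) hd]
      apply ENNReal.ofReal_le_ofReal
      have h1 : 1 ≤ (1 + c * h) ^ (k + 1) := one_le_pow₀ (by nlinarith [mul_nonneg hc hh])
      push_cast
      have : (1 + c * h) ^ (k + 1) * (a + (k + 1) * d)
        = (1 + c * h) * ((1 + c * h) ^ k * (a + k * d)) + (1 + c * h) ^ (k + 1) * d := by ring
      rw [this]
      nlinarith
  intro k hk
  refine (key k hk).trans (ENNReal.ofReal_le_ofReal ?_)
  have h1 : 1 ≤ 1 + c * h := by nlinarith [mul_nonneg hc hh]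
  have hkN : (k:ℝ) ≤ N := by exact_mod_cast hk
  have h2 : (1 + c * h) ^ k ≤ Real.exp c := by
    calc (1 + c * h) ^ k ≤ (1 + c * h) ^ N := pow_le_pow_right₀ h1 hk
      _ ≤ (Real.exp (c * h)) ^ N := by
          gcongr; linarith [Real.add_one_le_exp (c * h)]
      _ = Real.exp c := by
          rw [← Real.exp_nat_mul]; congr 1
          calc (N:ℝ) * (c * h) = c * (N * h) := by ring
            _ = c := by rw [hNh, mul_one]
  gcongr

lemma lin_sq {L x y : ℝ} (hL : 0 ≤ L) (hy : |y| ≤ L * (1 + |x|)) : y ^ 2 ≤ 2 * L ^ 2 * (1 + x ^ 2) := by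
  have h1 : y ^ 2 ≤ (L * (1 + |x|)) ^ 2 := by
    rw [← sq_abs y]; gcongr
  have h2 : (L * (1 + |x|)) ^ 2 = L ^ 2 * (1 + 2 * |x| + x ^ 2) := by
    rw [← sq_abs x]; ring
  have h3 : 2 * |x| ≤ 1 + x ^ 2 := by
    rw [← sq_abs x]; nlinarith [sq_nonneg (|x| - 1)]
  rw [h2] at h1
  nlinarith [sq_nonneg L]

lemma step_M {L h x bx sx : ℝ} (hL : 1 ≤ L) (hh : 0 ≤ h) (hh1 : h ≤ 1)
    (h1 : |bx| ≤ L * (1 + |x|)) (h2 : |sx| ≤ L * (1 + |x|)) :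
    1 + ((x + h * bx) ^ 2 + h * sx ^ 2) ≤ (1 + 8 * L ^ 2 * h) * (1 + x ^ 2) := by
  have a1 := lin_sq (by linarith) h1
  have a2 := lin_sq (by linarith) h2
  have hLL : 1 ≤ L ^ 2 := by nlinarith
  have hx : 0 ≤ x ^ 2 := sq_nonneg x
  have e1 : 2 * x * bx ≤ x ^ 2 + bx ^ 2 := by nlinarith [sq_nonneg (x - bx)]
  have e2 : h ^ 2 * bx ^ 2 ≤ h * bx ^ 2 := by
    have : h ^ 2 ≤ h := by nlinarith
    exact mul_le_mul_of_nonneg_right this (sq_nonneg _)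
  have e3 : 2 * x * bx + bx ^ 2 + sx ^ 2 ≤ 8 * L ^ 2 * (1 + x ^ 2) := by nlinarith
  have e4 := mul_le_mul_of_nonneg_left e3 hh
  nlinarith

lemma step_D {L h d bd sd : ℝ} (hL : 1 ≤ L) (hh : 0 ≤ h) (hh1 : h ≤ 1)
    (h1 : |bd| ≤ L * |d|) (h2 : |sd| ≤ L * |d|) :
    (d + h * bd) ^ 2 + h * sd ^ 2 ≤ (1 + 4 * L ^ 2 * h) * d ^ 2 := by
  have a1 : bd ^ 2 ≤ L ^ 2 * d ^ 2 := by
    rw [← sq_abs bd, ← sq_abs d, ← mul_pow]; gcongr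
  have a2 : sd ^ 2 ≤ L ^ 2 * d ^ 2 := by
    rw [← sq_abs sd, ← sq_abs d, ← mul_pow]; gcongr
  have hLL : 1 ≤ L ^ 2 := by nlinarith
  have hx : 0 ≤ d ^ 2 := sq_nonneg d
  have e1 : 2 * d * bd ≤ d ^ 2 + bd ^ 2 := by nlinarith [sq_nonneg (d - bd)]
  have e2 : h ^ 2 * bd ^ 2 ≤ h * bd ^ 2 := by
    have : h ^ 2 ≤ h := by nlinarith
    exact mul_le_mul_of_nonneg_right this (sq_nonneg _)
  have e3 : 2 * d * bd + bd ^ 2 + sd ^ 2 ≤ 4 * L ^ 2 * d ^ 2 := by nlinarith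
  have e4 := mul_le_mul_of_nonneg_left e3 hh
  nlinarith

lemma sig_bd {L x x' s : ℝ} (h : |s| ≤ L * (1 + |x'|)) (hL : 1 ≤ L) :
    s ^ 2 ≤ 3 * L ^ 2 * (1 + x ^ 2 + (x - x') ^ 2) := by
  have h1 : |s| ≤ L * (1 + |x| + |x - x'|) := by
    have : |x'| ≤ |x| + |x - x'| := by
      have := abs_sub x (x - x')
      simpa using this
    nlinarith
  have h2 : s ^ 2 ≤ (L * (1 + |x| + |x - x'|)) ^ 2 := by
    rw [← sq_abs s]; gcongr
  have h3 : (1 + |x| + |x - x'|) ^ 2 ≤ 3 * (1 + |x| ^ 2 + |x - x'| ^ 2) := by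
    nlinarith [sq_nonneg (1 - |x|), sq_nonneg (1 - |x - x'|), sq_nonneg (|x| - |x - x'|)]
  rw [sq_abs, sq_abs] at h3
  rw [mul_pow] at h2
  nlinarith [sq_nonneg L]

noncomputable def KM (L x₀ : ℝ) : ℝ := Real.exp (8 * L ^ 2) * (1 + x₀ ^ 2)

lemma M_bd (hW : IsBrownianMotion P W) {b σ : ℝ → ℝ} {L : ℝ} (hL : LipL b σ L) (x₀ : ℝ)
    {N : ℕ} (hN : 0 < N) (k : ℕ) (hk : k ≤ N) :
    ∫⁻ ω, ENNReal.ofReal (1 + emRec (1 / (N:ℝ)) b σ x₀ (dW W (1 / (N:ℝ))) k ω ^ 2) ∂P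
      ≤ ENNReal.ofReal (KM L x₀) := by
  have := hW.isProb
  set h : ℝ := 1 / (N:ℝ) with hhd
  have hNr : (0:ℝ) < N := by exact_mod_cast hN
  have hh : 0 < h := by positivity
  have hN1 : (1:ℝ) ≤ N := by exact_mod_cast hN
  have hh1 : h ≤ 1 := by rw [hhd, div_le_one hNr]; exact hN1
  have hNh : N * h = 1 := by rw [hhd]; field_simp
  have hgr := gron (u := fun k => ∫⁻ ω, ENNReal.ofReal (1 + emRec h b σ x₀ (dW W h) k ω ^ 2) ∂P)
    (c := 8 * L ^ 2) (d := 0) (h := h) (N := N) (a := 1 + x₀ ^ 2) (by positivity) le_rfl hh.le hNh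
    (by positivity) (by simp [emRec]) ?_ k hk
  · simpa [KM] using hgr
  intro k hk
  set X := emRec h b σ x₀ (dW W h) k with hX
  have hXm : Measurable[Fil W (k * h)] X :=
    emRec_meas hL hh.le x₀ (N := N) (fun k _ => dW_meas hh.le k) k hk.le
  have hXm' : Measurable X := hXm.mono (Fil_le hW _) le_rfl
  have hsq := lint_sq hW (s := k * h) (t := (k + 1) * h) (by positivity) (by nlinarith)
    (U := fun ω => X ω + h * b (X ω)) (V := fun ω => σ (X ω))
    (hXm.add ((hL.bm.comp hXm).const_mul h)) (hL.sm.comp hXm)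
  have eh : ((k:ℝ) + 1) * h - k * h = h := by ring
  rw [eh] at hsq
  rw [ENNReal.ofReal_zero, add_zero]
  calc ∫⁻ ω, ENNReal.ofReal (1 + emRec h b σ x₀ (dW W h) (k + 1) ω ^ 2) ∂P
      = ∫⁻ ω, 1 + ENNReal.ofReal ((X ω + h * b (X ω) + σ (X ω) *
          (W ((k + 1) * h) ω - W (k * h) ω)) ^ 2) ∂P := by
        congr 1; ext ω
        rw [ENNReal.ofReal_add zero_le_one (sq_nonneg _), ENNReal.ofReal_one]
        rfl
    _ = ∫⁻ ω, 1 + ENNReal.ofReal ((X ω + h * b (X ω)) ^ 2 + h * σ (X ω) ^ 2) ∂P := by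
        rw [lintegral_add_left measurable_const, hsq, ← lintegral_add_left measurable_const]
    _ ≤ ∫⁻ ω, ENNReal.ofReal (1 + 8 * L ^ 2 * h) * ENNReal.ofReal (1 + X ω ^ 2) ∂P := by
        refine lintegral_mono fun ω => ?_
        rw [← ENNReal.ofReal_one, ← ENNReal.ofReal_add zero_le_one (by positivity),
          ← ENNReal.ofReal_mul (by positivity)]
        exact ENNReal.ofReal_le_ofReal (step_M hL.one hh.le hh1 (hL.b2 _) (hL.s2 _))
    _ = _ := by
        rw [lintegral_const_mul]
        exact ENNReal.measurable_ofReal.comp ((hXm'.pow_const 2).const_add 1)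

noncomputable def KE (L x₀ : ℝ) : ℝ :=
  Real.exp (1 + 8 * L ^ 2 + 24 * K1 * L ^ 2) * (24 * K1 * L ^ 2 * KM L x₀)

lemma K1_pos : 0 < K1 := by unfold K1; positivity
lemma KM_pos (L x₀ : ℝ) : 0 < KM L x₀ := by unfold KM; positivity
lemma KE_nonneg (L x₀ : ℝ) : 0 ≤ KE L x₀ := by
  have := K1_pos; have := KM_pos L x₀
  unfold KE; positivity

lemma Y_int {b σ : ℝ → ℝ} (X D : Ω → ℝ) (hX : Measurable X) (c : ℝ) (hc : 0 ≤ c) :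
    ∫⁻ ω, ENNReal.ofReal (c * (1 + X ω ^ 2 + D ω ^ 2)) ∂P =
      ENNReal.ofReal c * (∫⁻ ω, ENNReal.ofReal (1 + X ω ^ 2) ∂P + ∫⁻ ω, ENNReal.ofReal (D ω ^ 2) ∂P) := by
  have hm : Measurable fun ω => ENNReal.ofReal (1 + X ω ^ 2) :=
    ENNReal.measurable_ofReal.comp ((hX.pow_const 2).const_add 1)
  rw [← lintegral_add_left hm, ← lintegral_const_mul' _ _ ENNReal.ofReal_ne_top]
  congr 1; ext ω
  rw [← ENNReal.ofReal_add (by positivity) (by positivity), ← ENNReal.ofReal_mul hc]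

lemma young_sq {h p q : ℝ} (hh : 0 < h) :
    (p + q) ^ 2 ≤ (1 + h) * p ^ 2 + (1 + h⁻¹) * q ^ 2 := by
  have h5 : 0 ≤ h⁻¹ * (h * p - q) ^ 2 := by positivity
  have h6 : h⁻¹ * (h * p - q) ^ 2 = h * p ^ 2 - 2 * p * q + h⁻¹ * q ^ 2 := by
    field_simp; ring
  have h7 : (p + q) ^ 2 = p ^ 2 + 2 * p * q + q ^ 2 := by ring
  rw [h6] at h5
  rw [h7]; linarith

set_option maxHeartbeats 2000000 in
lemma E_bd (hW : IsBrownianMotion P W) {b σ : ℝ → ℝ} {L : ℝ} (hL : LipL b σ L) (x₀ : ℝ)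
    {N : ℕ} (hN : 0 < N) {D : ℕ → Ω → ℝ}
    (hD : ∀ k < N, Measurable[Fil W ((k + 1) * (1 / (N:ℝ)))] (D k))
    (hT : ∀ k < N, ∀ᵐ ω ∂P, ENNReal.ofReal ((dW W (1 / (N:ℝ)) k ω - D k ω) ^ 2) ≤
      4 * bmT W (k * (1 / (N:ℝ))) N ω) (k : ℕ) (hk : k ≤ N) :
    ∫⁻ ω, ENNReal.ofReal ((emRec (1 / (N:ℝ)) b σ x₀ (dW W (1 / (N:ℝ))) k ω -
      emRec (1 / (N:ℝ)) b σ x₀ D k ω) ^ 2) ∂P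
      ≤ ENNReal.ofReal (KE L x₀ * (1 / (N:ℝ)) ^ 5) := by
  have := hW.isProb
  have hMb := fun k hk => M_bd hW hL x₀ hN k hk
  set h : ℝ := 1 / (N:ℝ) with hhd
  have hNr : (0:ℝ) < N := by exact_mod_cast hN
  have hh : 0 < h := by positivity
  have hN1 : (1:ℝ) ≤ N := by exact_mod_cast hN
  have hh1 : h ≤ 1 := by rw [hhd, div_le_one hNr]; exact hN1
  have hNh : N * h = 1 := by rw [hhd]; field_simp
  have hK1 := K1_pos
  have hKM := KM_pos L x₀
  have hgr := gron (u := fun k => ∫⁻ ω, ENNReal.ofReal ((emRec h b σ x₀ (dW W h) k ω -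
      emRec h b σ x₀ D k ω) ^ 2) ∂P)
    (c := 1 + 8 * L ^ 2 + 24 * K1 * L ^ 2) (d := 24 * K1 * L ^ 2 * KM L x₀ * h ^ 6)
    (h := h) (N := N) (a := 0) (by positivity) (by positivity) hh.le hNh
    le_rfl (by simp [emRec]) ?_ k hk
  · refine hgr.trans (le_of_eq ?_)
    congr 1
    unfold KE
    have : (N:ℝ) * (24 * K1 * L ^ 2 * KM L x₀ * h ^ 6) =
      24 * K1 * L ^ 2 * KM L x₀ * h ^ 5 * (N * h) := by ring
    rw [zero_add, this, hNh]; ring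
  intro k hk
  set X := emRec h b σ x₀ (dW W h) k with hX
  set X' := emRec h b σ x₀ D k with hX'
  have hXm : Measurable[Fil W (k * h)] X :=
    emRec_meas hL hh.le x₀ (N := N) (fun k _ => dW_meas hh.le k) k hk.le
  have hXm' : Measurable X := hXm.mono (Fil_le hW _) le_rfl
  have hX'm : Measurable[Fil W (k * h)] X' := emRec_meas hL hh.le x₀ (N := N) hD k hk.le
  have hsq := lint_sq hW (s := k * h) (t := (k + 1) * h) (by positivity) (by nlinarith)
    (U := fun ω => (X ω - X' ω) + h * (b (X ω) - b (X' ω))) (V := fun ω => σ (X ω) - σ (X' ω))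
    ((hXm.sub hX'm).add (((hL.bm.comp hXm).sub (hL.bm.comp hX'm)).const_mul h))
    ((hL.sm.comp hXm).sub (hL.sm.comp hX'm))
  have eh : ((k:ℝ) + 1) * h - k * h = h := by ring
  rw [eh] at hsq
  have hDm : Measurable[Fil W (k * h)] fun ω => X ω - X' ω := hXm.sub hX'm
  set E := ∫⁻ ω, ENNReal.ofReal ((X ω - X' ω) ^ 2) ∂P with hE
  set Y : Ω → ℝ≥0∞ := fun ω => ENNReal.ofReal (3 * L ^ 2 * (1 + X ω ^ 2 + (X ω - X' ω) ^ 2)) with hY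
  have hYm : Measurable[Fil W (k * h)] Y :=
    ENNReal.measurable_ofReal.comp ((((hXm.pow_const 2).const_add 1).add
      (hDm.pow_const 2)).const_mul _)
  have hYm' : Measurable Y := hYm.mono (Fil_le hW _) le_rfl
  have hTm := bmT_meas hW (s := k * h) (by positivity) N
  have hp : ∫⁻ ω, ENNReal.ofReal (((X ω - X' ω) + h * (b (X ω) - b (X' ω)) +
      (σ (X ω) - σ (X' ω)) * (W ((k + 1) * h) ω - W (k * h) ω)) ^ 2) ∂P
      ≤ ENNReal.ofReal (1 + 4 * L ^ 2 * h) * E := by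
    rw [hsq, hE, ← lintegral_const_mul' _ _ ENNReal.ofReal_ne_top]
    refine lintegral_mono fun ω => ?_
    rw [← ENNReal.ofReal_mul (by positivity)]
    exact ENNReal.ofReal_le_ofReal (step_D hL.one hh.le hh1 (hL.b1 _ _) (hL.s1 _ _))
  have hq : ∫⁻ ω, Y ω * bmT W (k * h) N ω ∂P ≤
      ENNReal.ofReal (K1 * h ^ 7) * (ENNReal.ofReal (3 * L ^ 2) * (ENNReal.ofReal (KM L x₀) + E)) := by
    refine (bm_T hW (by positivity) hN hYm).trans ?_
    rw [hY, Y_int (b := b) (σ := σ) X _ hXm' _ (by positivity)]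
    gcongr
    exact hMb k hk.le
  have hpm : Measurable fun ω => ENNReal.ofReal (1 + h) *
      ENNReal.ofReal (((X ω - X' ω) + h * (b (X ω) - b (X' ω)) +
      (σ (X ω) - σ (X' ω)) * (W ((k + 1) * h) ω - W (k * h) ω)) ^ 2) := by
    have a1 : Measurable X' := hX'm.mono (Fil_le hW _) le_rfl
    have a2 := hL.bm; have a3 := hL.sm
    have a4 := hW.meas ((k + 1) * h); have a5 := hW.meas (k * h)
    fun_prop
  calc ∫⁻ ω, ENNReal.ofReal ((emRec h b σ x₀ (dW W h) (k + 1) ω -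
      emRec h b σ x₀ D (k + 1) ω) ^ 2) ∂P
      ≤ ∫⁻ ω, ENNReal.ofReal (1 + h) *
        ENNReal.ofReal (((X ω - X' ω) + h * (b (X ω) - b (X' ω)) +
        (σ (X ω) - σ (X' ω)) * (W ((k + 1) * h) ω - W (k * h) ω)) ^ 2)
        + ENNReal.ofReal (1 + h⁻¹) * 4 * (Y ω * bmT W (k * h) N ω) ∂P := by
        refine lintegral_mono_ae ?_
        filter_upwards [hT k hk] with ω hω
        set p := (X ω - X' ω) + h * (b (X ω) - b (X' ω)) +
          (σ (X ω) - σ (X' ω)) * (W ((k + 1) * h) ω - W (k * h) ω) with hpdef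
        set R := dW W h k ω - D k ω with hR
        have e : emRec h b σ x₀ (dW W h) (k + 1) ω - emRec h b σ x₀ D (k + 1) ω
            = p + σ (X' ω) * R := by
          simp only [emRec, ← hX, ← hX', hpdef, hR, dW]; ring
        rw [e]
        have y1 : (p + σ (X' ω) * R) ^ 2 ≤ (1 + h) * p ^ 2 + (1 + h⁻¹) * (σ (X' ω) ^ 2 * R ^ 2) := by
          have := young_sq (p := p) (q := σ (X' ω) * R) hh
          rwa [mul_pow] at this
        refine (ENNReal.ofReal_le_ofReal y1).trans ?_
        rw [ENNReal.ofReal_add (by positivity) (by positivity), ENNReal.ofReal_mul (by positivity),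
          ENNReal.ofReal_mul (p := 1 + h⁻¹) (by positivity), ENNReal.ofReal_mul (sq_nonneg _)]
        refine add_le_add le_rfl ?_
        rw [mul_assoc]
        refine mul_le_mul_right ?_ _
        calc ENNReal.ofReal (σ (X' ω) ^ 2) * ENNReal.ofReal (R ^ 2)
            ≤ Y ω * (4 * bmT W (k * h) N ω) :=
              mul_le_mul' (ENNReal.ofReal_le_ofReal (sig_bd (hL.s2 _) hL.one)) hω
          _ = _ := by ring
    _ = ENNReal.ofReal (1 + h) * ∫⁻ ω,
        ENNReal.ofReal (((X ω - X' ω) + h * (b (X ω) - b (X' ω)) +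
        (σ (X ω) - σ (X' ω)) * (W ((k + 1) * h) ω - W (k * h) ω)) ^ 2) ∂P
        + ENNReal.ofReal (1 + h⁻¹) * 4 * ∫⁻ ω, (Y ω * bmT W (k * h) N ω) ∂P := by
        rw [lintegral_add_left hpm, lintegral_const_mul' _ _ ENNReal.ofReal_ne_top,
          lintegral_const_mul' _ _ (ENNReal.mul_ne_top ENNReal.ofReal_ne_top (by norm_num))]
    _ ≤ ENNReal.ofReal (1 + h) * (ENNReal.ofReal (1 + 4 * L ^ 2 * h) * E)
        + ENNReal.ofReal (1 + h⁻¹) * 4 * (ENNReal.ofReal (K1 * h ^ 7) *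
          (ENNReal.ofReal (3 * L ^ 2) * (ENNReal.ofReal (KM L x₀) + E))) := by
        gcongr
    _ = ENNReal.ofReal ((1 + h) * (1 + 4 * L ^ 2 * h) + (1 + h⁻¹) * 4 * (K1 * h ^ 7 * (3 * L ^ 2))) * E
        + ENNReal.ofReal ((1 + h⁻¹) * 4 * (K1 * h ^ 7 * (3 * L ^ 2 * KM L x₀))) := by
        rw [ENNReal.ofReal_add (p := (1 + h) * (1 + 4 * L ^ 2 * h)) (by positivity) (by positivity)]
        have e4 : (4:ℝ≥0∞) = ENNReal.ofReal 4 := by simp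
        have hi : 0 ≤ 1 + h⁻¹ := by positivity
        rw [ENNReal.ofReal_mul (by positivity : (0:ℝ) ≤ 1 + h),
          ENNReal.ofReal_mul (by positivity : (0:ℝ) ≤ (1 + h⁻¹) * 4),
          ENNReal.ofReal_mul (by positivity : (0:ℝ) ≤ (1 + h⁻¹) * 4),
          ENNReal.ofReal_mul hi, ENNReal.ofReal_mul (by positivity : (0:ℝ) ≤ K1 * h ^ 7),
          ENNReal.ofReal_mul (by positivity : (0:ℝ) ≤ K1 * h ^ 7),
          ENNReal.ofReal_mul (by positivity : (0:ℝ) ≤ 3 * L ^ 2), e4]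
        ring
    _ ≤ _ := by
        have hb : (1 + h⁻¹) * h ^ 7 ≤ 2 * h ^ 6 := by
          have : (1 + h⁻¹) * h ^ 7 = h ^ 6 * (1 + h) := by field_simp; ring
          rw [this]
          have : 0 < h ^ 6 := by positivity
          nlinarith
        have hb2 : h ^ 6 ≤ h := by
          calc h ^ 6 ≤ h ^ 1 := pow_le_pow_of_le_one hh.le hh1 (by norm_num)
            _ = h := pow_one h
        refine add_le_add (mul_le_mul_left (ENNReal.ofReal_le_ofReal ?_) _)
          (ENNReal.ofReal_le_ofReal ?_)
        · have c1 : (1 + h⁻¹) * 4 * (K1 * h ^ 7 * (3 * L ^ 2)) =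
            (12 * K1 * L ^ 2) * ((1 + h⁻¹) * h ^ 7) := by ring
          have c2 : (12 * K1 * L ^ 2) * ((1 + h⁻¹) * h ^ 7) ≤ (12 * K1 * L ^ 2) * (2 * h) := by
            refine mul_le_mul_of_nonneg_left ?_ (by positivity)
            linarith
          rw [c1]
          have c3 : L ^ 2 * h * h ≤ L ^ 2 * h := mul_le_of_le_one_right (by positivity) hh1
          nlinarith
        · have c1 : (1 + h⁻¹) * 4 * (K1 * h ^ 7 * (3 * L ^ 2 * KM L x₀)) =
            (12 * K1 * L ^ 2 * KM L x₀) * ((1 + h⁻¹) * h ^ 7) := by ring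
          have c2 : (12 * K1 * L ^ 2 * KM L x₀) * ((1 + h⁻¹) * h ^ 7) ≤
              (12 * K1 * L ^ 2 * KM L x₀) * (2 * h ^ 6) :=
            mul_le_mul_of_nonneg_left hb (by positivity)
          rw [c1]; linarith

noncomputable def KG (L x₀ : ℝ) : ℝ :=
  8 * L ^ 2 * KE L x₀ + 4 * L ^ 2 * K1 * KE L x₀ + 48 * L ^ 2 * K1 * (KM L x₀ + KE L x₀)

noncomputable def Gk (W : ℝ → Ω → ℝ) (N : ℕ) (L : ℝ) (X X' : Ω → ℝ) (k : ℕ) (ω : Ω) : ℝ≥0∞ :=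
  ENNReal.ofReal (8 * L ^ 2) * ENNReal.ofReal ((X ω - X' ω) ^ 2)
    + ENNReal.ofReal (4 * L ^ 2) * (ENNReal.ofReal ((X ω - X' ω) ^ 2) *
      bmS W (k * (1 / (N:ℝ))) (1 / (N:ℝ)) ω ^ 2)
    + 16 * (ENNReal.ofReal (3 * L ^ 2 * (1 + X ω ^ 2 + (X ω - X' ω) ^ 2)) *
      bmT W (k * (1 / (N:ℝ))) N ω)

lemma Gk_meas (hW : IsBrownianMotion P W) {N : ℕ} (hN : 0 < N) (L : ℝ) {X X' : Ω → ℝ}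
    (hX : Measurable X) (hX' : Measurable X') (k : ℕ) : Measurable (Gk W N L X X' k) := by
  have hSm : Measurable (bmS W (k * (1 / (N:ℝ))) (1 / (N:ℝ))) :=
    (bmS_meas (by positivity) (by positivity) le_rfl).mono (Fil_le hW _) le_rfl
  have hTm := bmT_meas hW (s := k * (1 / (N:ℝ))) (by positivity) N
  unfold Gk
  fun_prop

set_option maxHeartbeats 2000000 in
lemma G_bd (hW : IsBrownianMotion P W) {b σ : ℝ → ℝ} {L : ℝ} (hL : LipL b σ L) (x₀ : ℝ)
    {N : ℕ} (hN : 0 < N) {D : ℕ → Ω → ℝ}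
    (hD : ∀ k < N, Measurable[Fil W ((k + 1) * (1 / (N:ℝ)))] (D k))
    (hT : ∀ k < N, ∀ᵐ ω ∂P, ENNReal.ofReal ((dW W (1 / (N:ℝ)) k ω - D k ω) ^ 2) ≤
      4 * bmT W (k * (1 / (N:ℝ))) N ω) (k : ℕ) (hk : k < N) :
    ∫⁻ ω, Gk W N L (emRec (1 / (N:ℝ)) b σ x₀ (dW W (1 / (N:ℝ))) k)
      (emRec (1 / (N:ℝ)) b σ x₀ D k) k ω ∂P ≤ ENNReal.ofReal (KG L x₀ * (1 / (N:ℝ)) ^ 5) := by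
  have hMb := M_bd hW hL x₀ hN k hk.le
  have hEb := E_bd hW hL x₀ hN hD hT k hk.le
  unfold Gk
  set h : ℝ := 1 / (N:ℝ) with hhd
  have hNr : (0:ℝ) < N := by exact_mod_cast hN
  have hh : 0 < h := by positivity
  have hN1 : (1:ℝ) ≤ N := by exact_mod_cast hN
  have hh1 : h ≤ 1 := by rw [hhd, div_le_one hNr]; exact hN1
  have hK1 := K1_pos
  have hKM := KM_pos L x₀
  have hKE := KE_nonneg L x₀
  set X := emRec h b σ x₀ (dW W h) k with hX
  set X' := emRec h b σ x₀ D k with hX'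
  have hXm : Measurable[Fil W (k * h)] X :=
    emRec_meas hL hh.le x₀ (N := N) (fun k _ => dW_meas hh.le k) k hk.le
  have hXm' : Measurable X := hXm.mono (Fil_le hW _) le_rfl
  have hX'm : Measurable[Fil W (k * h)] X' := emRec_meas hL hh.le x₀ (N := N) hD k hk.le
  have hDm : Measurable[Fil W (k * h)] fun ω => X ω - X' ω := hXm.sub hX'm
  set Y : Ω → ℝ≥0∞ := fun ω => ENNReal.ofReal (3 * L ^ 2 * (1 + X ω ^ 2 + (X ω - X' ω) ^ 2)) with hY
  have hYm : Measurable[Fil W (k * h)] Y :=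
    ENNReal.measurable_ofReal.comp ((((hXm.pow_const 2).const_add 1).add
      (hDm.pow_const 2)).const_mul _)
  set Z : Ω → ℝ≥0∞ := fun ω => ENNReal.ofReal ((X ω - X' ω) ^ 2) with hZ
  have hZm : Measurable[Fil W (k * h)] Z := ENNReal.measurable_ofReal.comp (hDm.pow_const 2)
  have hZm' : Measurable Z := hZm.mono (Fil_le hW _) le_rfl
  have hSm : Measurable (bmS W (k * h) h) :=
    (bmS_meas (by positivity) hh.le le_rfl).mono (Fil_le hW _) le_rfl
  have h1 := bm_mom2 hW (s := k * h) (by positivity) hh hZm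
  have h2 := bm_T hW (s := k * h) (by positivity) hN hYm
  have m1 : Measurable fun ω => ENNReal.ofReal (8 * L ^ 2) * Z ω := hZm'.const_mul _
  have m2 : Measurable fun ω => ENNReal.ofReal (4 * L ^ 2) * (Z ω * bmS W (k * h) h ω ^ 2) :=
    (hZm'.mul (hSm.pow_const 2)).const_mul _
  change ∫⁻ ω, (ENNReal.ofReal (8 * L ^ 2) * Z ω +
    ENNReal.ofReal (4 * L ^ 2) * (Z ω * bmS W (k * h) h ω ^ 2)) +
    16 * (Y ω * bmT W (k * h) N ω) ∂P ≤ _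
  have m3 : Measurable fun ω => ENNReal.ofReal (8 * L ^ 2) * Z ω +
    ENNReal.ofReal (4 * L ^ 2) * (Z ω * bmS W (k * h) h ω ^ 2) := m1.add m2
  rw [lintegral_add_left m3, lintegral_add_left m1,
    lintegral_const_mul' _ _ ENNReal.ofReal_ne_top, lintegral_const_mul' _ _ ENNReal.ofReal_ne_top,
    lintegral_const_mul' _ _ (by norm_num)]
  have h3 : ∫⁻ ω, Y ω ∂P ≤ ENNReal.ofReal (3 * L ^ 2 * (KM L x₀ + KE L x₀ * h ^ 5)) := by
    rw [hY, Y_int (b := b) (σ := σ) X _ hXm' _ (by positivity),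
      ENNReal.ofReal_mul (by positivity : (0:ℝ) ≤ 3 * L ^ 2),
      ENNReal.ofReal_add hKM.le (by positivity)]
    gcongr
  calc _ ≤ ENNReal.ofReal (8 * L ^ 2) * ENNReal.ofReal (KE L x₀ * h ^ 5) +
      ENNReal.ofReal (4 * L ^ 2) * (ENNReal.ofReal (K1 * h) * ENNReal.ofReal (KE L x₀ * h ^ 5)) +
      ENNReal.ofReal 16 * (ENNReal.ofReal (K1 * h ^ 7) *
        ENNReal.ofReal (3 * L ^ 2 * (KM L x₀ + KE L x₀ * h ^ 5))) := by
        refine add_le_add (add_le_add ?_ ?_) ?_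
        · gcongr
        · refine mul_le_mul_right (h1.trans ?_) _
          gcongr
        · rw [show ENNReal.ofReal 16 = 16 by simp]
          refine mul_le_mul_right (h2.trans ?_) _
          gcongr
    _ = ENNReal.ofReal (8 * L ^ 2 * (KE L x₀ * h ^ 5) + 4 * L ^ 2 * (K1 * h * (KE L x₀ * h ^ 5))
        + 16 * (K1 * h ^ 7 * (3 * L ^ 2 * (KM L x₀ + KE L x₀ * h ^ 5)))) := by
        rw [← ENNReal.ofReal_mul (by positivity), ← ENNReal.ofReal_mul (by positivity),
          ← ENNReal.ofReal_mul (by positivity), ← ENNReal.ofReal_mul (by positivity),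
          ← ENNReal.ofReal_mul (by positivity), ← ENNReal.ofReal_add (by positivity) (by positivity),
          ← ENNReal.ofReal_add (by positivity) (by positivity)]
    _ ≤ _ := by
        apply ENNReal.ofReal_le_ofReal
        have hp : h ^ 5 ≤ 1 := pow_le_one₀ hh.le hh1
        have hp7 : h ^ 7 ≤ h ^ 5 := pow_le_pow_of_le_one hh.le hh1 (by norm_num)
        have c2 : 4 * L ^ 2 * (K1 * h * (KE L x₀ * h ^ 5)) ≤ 4 * L ^ 2 * K1 * KE L x₀ * h ^ 5 := by
          calc _ = 4 * L ^ 2 * K1 * KE L x₀ * h ^ 5 * h := by ring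
            _ ≤ _ := mul_le_of_le_one_right (by positivity) hh1
        have c3 : 16 * (K1 * h ^ 7 * (3 * L ^ 2 * (KM L x₀ + KE L x₀ * h ^ 5))) ≤
            48 * L ^ 2 * K1 * (KM L x₀ + KE L x₀) * h ^ 5 := by
          calc _ = 48 * L ^ 2 * K1 * (KM L x₀ + KE L x₀ * h ^ 5) * h ^ 7 := by ring
            _ ≤ 48 * L ^ 2 * K1 * (KM L x₀ + KE L x₀ * 1) * h ^ 5 := by gcongr
            _ = _ := by ring
        unfold KG
        linarith

end PD

section PE
open scoped ENNReal
variable {Ω : Type*} [mΩ : MeasurableSpace Ω] {P : Measure Ω} {W : ℝ → Ω → ℝ}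

noncomputable def Ah (N : ℕ) : ℝ := 4 * √(1 / (N:ℝ) * Real.log (1 / (1 / (N:ℝ))))

/-- good paths -/
structure GoodP (W : ℝ → Ω → ℝ) (N : ℕ) (ω : Ω) : Prop where
  cont : Continuous fun t => W t ω
  ne : ∀ k : ℕ, {r : ℝ | k * (1 / (N:ℝ)) ≤ r ∧ Ah N ≤ |W r ω - W (k * (1 / (N:ℝ))) ω|}.Nonempty

lemma good_ae (hW : IsBrownianMotion P W) (N : ℕ) : ∀ᵐ ω ∂P, GoodP W N ω := by
  have h1 : ∀ᵐ ω ∂P, ∀ k : ℕ, {r : ℝ | k * (1 / (N:ℝ)) ≤ r ∧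
      Ah N ≤ |W r ω - W (k * (1 / (N:ℝ))) ω|}.Nonempty :=
    ae_all_iff.2 fun k => exit_ae hW (by positivity) _
  filter_upwards [hW.cont, h1] with ω a b
  exact ⟨a, b⟩

lemma tau_ge {N : ℕ} {ω : Ω} (hg : GoodP W N ω) (k : ℕ) :
    k * (1 / (N:ℝ)) ≤ truncStop W (1 / (N:ℝ)) (Ah N) k ω :=
  le_csInf (hg.ne k) fun _ hr => hr.1

lemma trunc_incr {N : ℕ} {ω : Ω} (hg : GoodP W N ω) {k : ℕ} (hk : k < N) {t : ℝ}
    (h1 : k * (1 / (N:ℝ)) ≤ t) (h2 : t ≤ (k + 1) * (1 / (N:ℝ))) :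
    truncWiener W N t ω - truncWiener W N (k * (1 / (N:ℝ))) ω =
      W (min t (truncStop W (1 / (N:ℝ)) (Ah N) k ω)) ω - W (k * (1 / (N:ℝ))) ω := by
  have hτ := tau_ge hg k
  have hh : 0 ≤ 1 / (N:ℝ) := by positivity
  simp only [truncWiener, ← Finset.sum_sub_distrib]
  change ∑ j ∈ Finset.range N, (W (min (min (max t (j * (1 / (N:ℝ)))) ((j + 1) * (1 / (N:ℝ))))
    (truncStop W (1 / (N:ℝ)) (Ah N) j ω)) ω - W (j * (1 / (N:ℝ))) ω -
    (W (min (min (max (k * (1 / (N:ℝ))) (j * (1 / (N:ℝ)))) ((j + 1) * (1 / (N:ℝ))))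
    (truncStop W (1 / (N:ℝ)) (Ah N) j ω)) ω - W (j * (1 / (N:ℝ))) ω)) = _
  generalize 1 / (N:ℝ) = h at *
  rw [Finset.sum_eq_single k]
  · rw [max_eq_left h1, min_eq_left h2, max_self, min_eq_left (a := (k:ℝ) * h) (by nlinarith),
      min_eq_left hτ]
    ring
  · intro j _ hj
    have : min (max t (j * h)) ((j + 1) * h) = min (max (k * h) (j * h)) ((j + 1) * h) := by
      rcases lt_or_gt_of_ne hj with hlt | hgt
      · have hc : (j:ℝ) + 1 ≤ k := by exact_mod_cast hlt
        have h3 : ((j:ℝ) + 1) * h ≤ k * h := mul_le_mul_of_nonneg_right hc hh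
        rw [min_eq_right ((h3.trans h1).trans (le_max_left _ _)),
          min_eq_right (h3.trans (le_max_left _ _))]
      · have hc : (k:ℝ) + 1 ≤ j := by exact_mod_cast hgt
        have h3 : ((k:ℝ) + 1) * h ≤ j * h := mul_le_mul_of_nonneg_right hc hh
        rw [max_eq_right (h2.trans h3), max_eq_right ((h1.trans h2).trans h3)]
    rw [this, sub_self]
  · intro h; exact absurd (Finset.mem_range.2 hk) h

lemma R_bd {N : ℕ} (hN : 0 < N) {ω : Ω} (hg : GoodP W N ω) (k : ℕ) {t : ℝ}
    (h1 : k * (1 / (N:ℝ)) ≤ t) (h2 : t ≤ (k + 1) * (1 / (N:ℝ))) :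
    ENNReal.ofReal (((W t ω - W (k * (1 / (N:ℝ))) ω) -
      (W (min t (truncStop W (1 / (N:ℝ)) (Ah N) k ω)) ω - W (k * (1 / (N:ℝ))) ω)) ^ 2)
      ≤ 4 * bmT W (k * (1 / (N:ℝ))) N ω := by
  have hτ := tau_ge hg k
  have hNr : (0:ℝ) < N := by exact_mod_cast hN
  have hh : 0 < 1 / (N:ℝ) := by positivity
  have hS : ∀ r, k * (1 / (N:ℝ)) ≤ r → r ≤ (k + 1) * (1 / (N:ℝ)) →
      ENNReal.ofReal |W r ω - W (k * (1 / (N:ℝ))) ω| ≤ bmS W (k * (1 / (N:ℝ))) (1 / (N:ℝ)) ω :=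
    fun r a b => bmS_ge hg.cont hh a (by linarith)
  by_cases hA : ENNReal.ofReal (Ah N) ≤ bmS W (k * (1 / (N:ℝ))) (1 / (N:ℝ)) ω
  · have hT : bmT W (k * (1 / (N:ℝ))) N ω = bmS W (k * (1 / (N:ℝ))) (1 / (N:ℝ)) ω ^ 2 :=
      Set.indicator_of_mem (s := {ω | ENNReal.ofReal (Ah N) ≤ bmS W (k * (1 / (N:ℝ))) (1 / (N:ℝ)) ω})
        hA _
    rw [hT]
    have a1 := hS t h1 h2
    have a2 := hS (min t (truncStop W (1 / (N:ℝ)) (Ah N) k ω)) (le_min h1 hτ) ((min_le_left _ _).trans h2)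
    set u := W t ω - W (k * (1 / (N:ℝ))) ω
    set v := W (min t (truncStop W (1 / (N:ℝ)) (Ah N) k ω)) ω - W (k * (1 / (N:ℝ))) ω
    rw [← sq_abs, ENNReal.ofReal_pow (abs_nonneg _)]
    calc ENNReal.ofReal |u - v| ^ 2 ≤ (ENNReal.ofReal |u| + ENNReal.ofReal |v|) ^ 2 := by
          gcongr
          rw [← ENNReal.ofReal_add (abs_nonneg _) (abs_nonneg _)]
          exact ENNReal.ofReal_le_ofReal (abs_sub _ _)
      _ ≤ (bmS W (k * (1 / (N:ℝ))) (1 / (N:ℝ)) ω + bmS W (k * (1 / (N:ℝ))) (1 / (N:ℝ)) ω) ^ 2 := by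
          gcongr
      _ = _ := by ring
  · have h3 : (k + 1) * (1 / (N:ℝ)) ≤ truncStop W (1 / (N:ℝ)) (Ah N) k ω := by
      refine le_csInf (hg.ne k) fun r hr => ?_
      have hr' : k * (1 / (N:ℝ)) ≤ r ∧ Ah N ≤ |W r ω - W (k * (1 / (N:ℝ))) ω| := hr
      by_contra hlt
      push Not at hlt
      exact hA ((ENNReal.ofReal_le_ofReal hr'.2).trans (hS r hr'.1 hlt.le))
    rw [min_eq_left (h2.trans h3)]
    simp

lemma std_eq (N : ℕ) (b σ : ℝ → ℝ) (x₀ : ℝ) (k : ℕ) (ω : Ω) :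
    stdEMdisc W N b σ x₀ k ω = emRec (1 / (N:ℝ)) b σ x₀ (dW W (1 / (N:ℝ))) k ω := by
  induction k with
  | zero => rfl
  | succ k ih => simp only [stdEMdisc, emRec, ih, dW]

lemma mon_eq {N : ℕ} (b σ : ℝ → ℝ) (x₀ : ℝ) {ω : Ω} {D : ℕ → Ω → ℝ}
    (hD : ∀ k < N, D k ω = truncWiener W N ((k + 1) * (1 / N : ℝ)) ω - truncWiener W N (k * (1 / N : ℝ)) ω)
    (k : ℕ) (hk : k ≤ N) :
    monEMdisc W N b σ x₀ k ω = emRec (1 / (N:ℝ)) b σ x₀ D k ω := by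
  induction k with
  | zero => rfl
  | succ k ih => simp only [monEMdisc, emRec, ih (by omega), hD k (by omega)]

lemma four_sq (a b c d : ℝ) : (a + b + c + d) ^ 2 ≤ 4 * a ^ 2 + 4 * b ^ 2 + 4 * c ^ 2 + 4 * d ^ 2 := by
  nlinarith [sq_nonneg (a - b), sq_nonneg (a - c), sq_nonneg (a - d), sq_nonneg (b - c),
    sq_nonneg (b - d), sq_nonneg (c - d)]

lemma G_ge {b σ : ℝ → ℝ} {L : ℝ} (hL : LipL b σ L) {x x' u w r h : ℝ} {S T : ℝ≥0∞} (hh1 : h ≤ 1)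
    (hu0 : 0 ≤ u) (hu : u ≤ h)
    (hw : ENNReal.ofReal |w| ≤ S) (hr : ENNReal.ofReal ((w - r) ^ 2) ≤ 4 * T) :
    ENNReal.ofReal (|x + u * b x + σ x * w - (x' + u * b x' + σ x' * r)| ^ 2) ≤
    ENNReal.ofReal (8 * L ^ 2) * ENNReal.ofReal ((x - x') ^ 2)
    + ENNReal.ofReal (4 * L ^ 2) * (ENNReal.ofReal ((x - x') ^ 2) * S ^ 2)
    + 16 * (ENNReal.ofReal (3 * L ^ 2 * (1 + x ^ 2 + (x - x') ^ 2)) * T) := by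
  have hL1 := hL.one
  have hLL : 1 ≤ L ^ 2 := by nlinarith
  have b1 : (b x - b x') ^ 2 ≤ L ^ 2 * (x - x') ^ 2 := by
    rw [← sq_abs (b x - b x'), ← sq_abs (x - x'), ← mul_pow]
    exact pow_le_pow_left₀ (abs_nonneg _) (hL.b1 _ _) 2
  have s1 : (σ x - σ x') ^ 2 ≤ L ^ 2 * (x - x') ^ 2 := by
    rw [← sq_abs (σ x - σ x'), ← sq_abs (x - x'), ← mul_pow]
    exact pow_le_pow_left₀ (abs_nonneg _) (hL.s1 _ _) 2
  have u2 : u ^ 2 ≤ 1 := pow_le_one₀ hu0 (hu.trans hh1)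
  have e : x + u * b x + σ x * w - (x' + u * b x' + σ x' * r) =
    (x - x') + u * (b x - b x') + (σ x - σ x') * w + σ x' * (w - r) := by ring
  have i1 : 4 * (x - x') ^ 2 + 4 * (u * (b x - b x')) ^ 2 ≤ 8 * L ^ 2 * (x - x') ^ 2 := by
    have : (u * (b x - b x')) ^ 2 ≤ (b x - b x') ^ 2 := by
      rw [mul_pow]; exact mul_le_of_le_one_left (sq_nonneg _) u2
    have : (x - x') ^ 2 ≤ L ^ 2 * (x - x') ^ 2 := le_mul_of_one_le_left (sq_nonneg _) hLL
    linarith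
  have i2 : 4 * ((σ x - σ x') * w) ^ 2 ≤ 4 * L ^ 2 * ((x - x') ^ 2 * w ^ 2) := by
    rw [mul_pow]
    have := mul_le_mul_of_nonneg_right s1 (sq_nonneg w)
    linarith
  have i3 : 4 * (σ x' * (w - r)) ^ 2 ≤ 4 * ((3 * L ^ 2 * (1 + x ^ 2 + (x - x') ^ 2)) * (w - r) ^ 2) := by
    rw [mul_pow]
    have := mul_le_mul_of_nonneg_right (sig_bd (x := x) (hL.s2 x') hL1) (sq_nonneg (w - r))
    linarith
  have tot := (four_sq (x - x') (u * (b x - b x')) ((σ x - σ x') * w) (σ x' * (w - r))).trans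
    (add_le_add (add_le_add i1 i2) i3)
  rw [sq_abs, e]
  refine (ENNReal.ofReal_le_ofReal tot).trans ?_
  rw [ENNReal.ofReal_add (by positivity) (by positivity), ENNReal.ofReal_add (by positivity) (by positivity)]
  refine add_le_add (add_le_add ?_ ?_) ?_
  · rw [ENNReal.ofReal_mul (by positivity)]
  · rw [ENNReal.ofReal_mul (p := 4 * L ^ 2) (by positivity), ENNReal.ofReal_mul (sq_nonneg _), ← sq_abs w,
      ENNReal.ofReal_pow (abs_nonneg w)]
    gcongr
  · rw [ENNReal.ofReal_mul (p := 4) (by positivity), ENNReal.ofReal_mul (p := 3 * L ^ 2 * (1 + x ^ 2 + (x - x') ^ 2)) (by positivity)]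
    calc _ ≤ ENNReal.ofReal 4 * (ENNReal.ofReal (3 * L ^ 2 * (1 + x ^ 2 + (x - x') ^ 2)) * (4 * T)) := by
          gcongr
      _ = _ := by
          rw [show ENNReal.ofReal 4 = 4 by simp]; ring

lemma point_bd {b σ : ℝ → ℝ} {L : ℝ} (hL : LipL b σ L) (x₀ : ℝ)
    {N : ℕ} (hN : 0 < N) {D : ℕ → Ω → ℝ} {ω : Ω} (hg : GoodP W N ω)
    (hD : ∀ k < N, D k ω = truncWiener W N ((k + 1) * (1 / N : ℝ)) ω - truncWiener W N (k * (1 / N : ℝ)) ω)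
    {t : ℝ} (ht : t ∈ Set.Icc (0:ℝ) 1) :
    ENNReal.ofReal (|stdEM W N b σ x₀ t ω - monEM W N b σ x₀ t ω| ^ 2) ≤
      ∑ k ∈ Finset.range N, Gk W N L (emRec (1 / (N:ℝ)) b σ x₀ (dW W (1 / (N:ℝ))) k)
      (emRec (1 / (N:ℝ)) b σ x₀ D k) k ω := by
  by_cases h0 : t ≤ 0
  · simp [stdEM, monEM, h0]
  push Not at h0
  have hNr : (0:ℝ) < N := by exact_mod_cast hN
  have hN1 : (1:ℝ) ≤ N := by exact_mod_cast hN
  have hpos : 0 < t * N := mul_pos h0 hNr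
  set k : ℕ := ⌈t * N⌉₊ - 1 with hk
  have hc1 : 1 ≤ ⌈t * N⌉₊ := Nat.one_le_ceil_iff.2 hpos
  have hc2 : ⌈t * N⌉₊ ≤ N := Nat.ceil_le.2 (by nlinarith [ht.2])
  have hkN : k < N := by omega
  have hkc : (⌈t * N⌉₊ : ℝ) = k + 1 := by
    have : ⌈t * N⌉₊ = k + 1 := by omega
    rw [this]; push_cast; ring
  have l1 : t * N ≤ k + 1 := by rw [← hkc]; exact Nat.le_ceil _
  have l2 : (k:ℝ) < t * N := by
    have := Nat.ceil_lt_add_one hpos.le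
    rw [hkc] at this; linarith
  have h1 : k * (1 / (N:ℝ)) ≤ t := by
    rw [mul_one_div, div_le_iff₀ hNr]; exact l2.le
  have h2 : t ≤ (k + 1) * (1 / (N:ℝ)) := by
    rw [mul_one_div, le_div_iff₀ hNr]; exact l1
  have hR := R_bd hN hg k h1 h2
  rw [← trunc_incr hg hkN h1 h2] at hR
  have hw := bmS_ge hg.cont (h := 1 / (N:ℝ)) (by positivity) h1 (by linarith)
  refine le_trans ?_ (Finset.single_le_sum (f := fun k => Gk W N L
    (emRec (1 / (N:ℝ)) b σ x₀ (dW W (1 / (N:ℝ))) k) (emRec (1 / (N:ℝ)) b σ x₀ D k) k ω)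
    (fun _ _ => bot_le) (Finset.mem_range.2 hkN))
  simp only [stdEM, monEM, not_le.2 h0, if_false, ← hk, std_eq, mon_eq b σ x₀ hD k hkN.le]
  exact G_ge hL (h := 1 / (N:ℝ)) (by rw [div_le_one hNr]; exact hN1) (by linarith) (by linarith) hw hR

lemma sup_bd {f : ℝ → ℝ} {c : ℝ≥0∞}
    (h : ∀ t ∈ Set.Icc (0:ℝ) 1, ENNReal.ofReal (f t) ≤ c) :
    ENNReal.ofReal (⨆ s ∈ Set.Icc (0:ℝ) 1, f s) ≤ c := by
  by_cases hc : c = ⊤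
  · rw [hc]; exact le_top
  rw [ENNReal.ofReal_le_iff_le_toReal hc]
  refine Real.iSup_le (fun t => Real.iSup_le (fun ht => ?_) ENNReal.toReal_nonneg) ENNReal.toReal_nonneg
  exact (ENNReal.ofReal_le_iff_le_toReal hc).1 (h t ht)

lemma lipL_of {b σ : ℝ → ℝ} {C₀ C₁ : ℝ≥0} (hb : LipschitzWith C₀ b) (hσ : LipschitzWith C₁ σ) :
    LipL b σ (1 + C₀ + C₁ + |b 0| + |σ 0|) := by
  have c0 : (0:ℝ) ≤ C₀ := C₀.2
  have c1 : (0:ℝ) ≤ C₁ := C₁.2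
  have a0 := abs_nonneg (b 0)
  have a1 := abs_nonneg (σ 0)
  have p : ∀ x y, |b x - b y| ≤ C₀ * |x - y| := fun x y => by
    simpa [Real.dist_eq] using hb.dist_le_mul x y
  have q : ∀ x y, |σ x - σ y| ≤ C₁ * |x - y| := fun x y => by
    simpa [Real.dist_eq] using hσ.dist_le_mul x y
  refine ⟨by linarith, fun x y => (p x y).trans ?_, fun x y => (q x y).trans ?_, fun x => ?_, fun x => ?_,
    hb.continuous.measurable, hσ.continuous.measurable⟩
  · exact mul_le_mul_of_nonneg_right (by linarith) (abs_nonneg _)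
  · exact mul_le_mul_of_nonneg_right (by linarith) (abs_nonneg _)
  · have h1 := p x 0
    have h2 := abs_sub_abs_le_abs_sub (b x) (b 0)
    rw [sub_zero] at h1
    nlinarith [abs_nonneg x, mul_nonneg c1 (abs_nonneg x), mul_nonneg a0 (abs_nonneg x),
      mul_nonneg a1 (abs_nonneg x)]
  · have h1 := q x 0
    have h2 := abs_sub_abs_le_abs_sub (σ x) (σ 0)
    rw [sub_zero] at h1
    nlinarith [abs_nonneg x, mul_nonneg c0 (abs_nonneg x), mul_nonneg a0 (abs_nonneg x),
      mul_nonneg a1 (abs_nonneg x)]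

lemma KG_nonneg (L x₀ : ℝ) : 0 ≤ KG L x₀ := by
  have := K1_pos; have := KM_pos L x₀; have := KE_nonneg L x₀
  unfold KG; positivity

lemma main_bd (hW : IsBrownianMotion P W) {b σ : ℝ → ℝ} {L : ℝ} (hL : LipL b σ L) (x₀ : ℝ)
    {N : ℕ} (hN : 0 < N) :
    ∫⁻ ω, ENNReal.ofReal
          (⨆ s ∈ Set.Icc (0 : ℝ) 1, |stdEM W N b σ x₀ s ω - monEM W N b σ x₀ s ω| ^ 2) ∂P
        ≤ ENNReal.ofReal ((KG L x₀ + 1) * (1 / (N : ℝ)) ^ 3) := by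
  have hNr : (0:ℝ) < N := by exact_mod_cast hN
  have hN1 : (1:ℝ) ≤ N := by exact_mod_cast hN
  have hh : 0 < 1 / (N:ℝ) := by positivity
  have hh1 : 1 / (N:ℝ) ≤ 1 := by rw [div_le_one hNr]; exact hN1
  have hKG := KG_nonneg L x₀
  choose D hDm hDe using fun k : ℕ =>
    stop_meas (W := W) (s := k * (1 / (N:ℝ))) (h := 1 / (N:ℝ)) (by positivity) hh (Ah N)
  have hDm' : ∀ k < N, Measurable[Fil W ((k + 1) * (1 / (N:ℝ)))] (D k) := by
    intro k _
    have e : ((k:ℝ) + 1) * (1 / (N:ℝ)) = k * (1 / (N:ℝ)) + 1 / (N:ℝ) := by ring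
    rw [e]; exact hDm k
  have hDe' : ∀ ω, GoodP W N ω → ∀ k : ℕ, D k ω =
      W (min ((k + 1) * (1 / (N:ℝ))) (truncStop W (1 / (N:ℝ)) (Ah N) k ω)) ω - W (k * (1 / (N:ℝ))) ω := by
    intro ω hg k
    have e : ((k:ℝ) + 1) * (1 / (N:ℝ)) = k * (1 / (N:ℝ)) + 1 / (N:ℝ) := by ring
    rw [e]; exact hDe k ω hg.cont (hg.ne k)
  have hT : ∀ k < N, ∀ᵐ ω ∂P, ENNReal.ofReal ((dW W (1 / (N:ℝ)) k ω - D k ω) ^ 2) ≤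
      4 * bmT W (k * (1 / (N:ℝ))) N ω := by
    intro k _
    filter_upwards [good_ae hW N] with ω hg
    rw [hDe' ω hg k]
    exact R_bd hN hg k (by nlinarith) le_rfl
  have hae : ∀ᵐ ω ∂P, ENNReal.ofReal
      (⨆ s ∈ Set.Icc (0 : ℝ) 1, |stdEM W N b σ x₀ s ω - monEM W N b σ x₀ s ω| ^ 2) ≤
      ∑ k ∈ Finset.range N, Gk W N L (emRec (1 / (N:ℝ)) b σ x₀ (dW W (1 / (N:ℝ))) k)
      (emRec (1 / (N:ℝ)) b σ x₀ D k) k ω := by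
    filter_upwards [good_ae hW N] with ω hg
    refine sup_bd fun t ht => point_bd hL x₀ hN hg (fun k hk => ?_) ht
    rw [hDe' ω hg k, trunc_incr hg hk (by nlinarith) le_rfl]
  refine (lintegral_mono_ae hae).trans ?_
  rw [lintegral_finset_sum]
  · refine (Finset.sum_le_sum fun k hk => G_bd hW hL x₀ hN hDm' hT k (Finset.mem_range.1 hk)).trans ?_
    rw [Finset.sum_const, Finset.card_range, nsmul_eq_mul, ← ENNReal.ofReal_natCast,
      ← ENNReal.ofReal_mul hNr.le]
    apply ENNReal.ofReal_le_ofReal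
    have e : (N:ℝ) * (KG L x₀ * (1 / (N:ℝ)) ^ 5) = KG L x₀ * (1 / (N:ℝ)) ^ 4 := by
      field_simp
    rw [e]
    have : (1 / (N:ℝ)) ^ 4 ≤ (1 / (N:ℝ)) ^ 3 := pow_le_pow_of_le_one hh.le hh1 (by norm_num)
    have h3 : 0 < (1 / (N:ℝ)) ^ 3 := by positivity
    nlinarith [mul_le_mul_of_nonneg_left this hKG]
  · intro k hk
    have hk' := Finset.mem_range.1 hk
    exact Gk_meas hW hN L
      ((emRec_meas hL hh.le x₀ (N := N) (fun k _ => dW_meas hh.le k) k hk'.le).mono (Fil_le hW _) le_rfl)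
      ((emRec_meas hL hh.le x₀ (N := N) hDm' k hk'.le).mono (Fil_le hW _) le_rfl) k

end PE

/-- **The monotone Euler–Maruyama scheme is `L²`-close to the standard Euler–Maruyama
scheme.** For Lipschitz `b : ℝ → ℝ` and `σ : ℝ → [0,∞)` and `x₀ ∈ ℝ`, there is a
constant `C > 0` such that for every `N ∈ ℕ`, with `h = 1/N`,
`E[sup_{0 ≤ s ≤ 1} |X̃^h_s − X^h_s|²] ≤ C h³`. -/
theorem monotone_em_close_to_standard_em
    {Ω : Type*} [MeasurableSpace Ω] (P : Measure Ω) (W : ℝ → Ω → ℝ)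
    (hW : IsBrownianMotion P W)
    (b σ : ℝ → ℝ) (C₀ C₁ : ℝ≥0) (hb : LipschitzWith C₀ b) (hσ : LipschitzWith C₁ σ)
    (hσ0 : ∀ x, 0 ≤ σ x) (x₀ : ℝ) :
    ∃ C : ℝ, 0 < C ∧ ∀ N : ℕ, 0 < N →
      ∫⁻ ω, ENNReal.ofReal
          (⨆ s ∈ Set.Icc (0 : ℝ) 1, |stdEM W N b σ x₀ s ω - monEM W N b σ x₀ s ω| ^ 2) ∂P
        ≤ ENNReal.ofReal (C * (1 / (N : ℝ)) ^ 3) := by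
  exact ⟨KG (1 + C₀ + C₁ + |b 0| + |σ 0|) x₀ + 1,
    by linarith [KG_nonneg (1 + C₀ + C₁ + |b 0| + |σ 0|) x₀],
    fun N hN => main_bd hW (lipL_of hb hσ) x₀ hN⟩
end

section
/- The joint law of coupled monotone Euler–Maruyama schemes is the Knothe–Rosenblatt rearrangement: Let b, b̄ : ℝ → ℝ and σ, σ̄ : ℝ → [0,∞) be Lipschitz functions and x₀ ∈ ℝ. Fix N ∈ ℕ and h = 1/N, and let X^h and X̄^h be the monotone Euler–Maruyama schemes with coefficients (b,σ) and (b̄,σ̄) respectively, both started at x₀ and driven by the same Brownian motion W (hence with the same truncated increments). Let μ^h := Law(X^h_0, X^h_h, …, X^h_1) and ν^h := Law(X̄^h_0, X̄^h_h, …, X̄^h_1), viewed as probability measures on ℝ^{N+1}. Then the joint law of ((X^h_{kh})_{k=0,…,N}, (X̄^h_{kh})_{k=0,…,N}) equals the Knothe–Rosenblatt rearrangement π^{KR}_{μ^h, ν^h}. -/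
open MeasureTheory ProbabilityTheory
open scoped NNReal

noncomputable section

/-- The cumulative distribution function of a measure on `ℝ`: `F_ρ(a) = ρ(−∞, a]`. -/
def cdfAt (ρ : Measure ℝ) (a : ℝ) : ℝ := (ρ (Set.Iic a)).toReal

/-- The left-continuous inverse (quantile function) of the CDF of `ρ`:
`F_ρ^{-1}(y) = inf {u : F_ρ(u) ≥ y}`. -/
def quantile (ρ : Measure ℝ) (y : ℝ) : ℝ := sInf {u : ℝ | y ≤ cdfAt ρ u}

/-- The map sending `x ∈ ℝⁿ` to (its first `k` coordinates, its `(k+1)`-th coordinate). -/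
def splitMap {n : ℕ} (k : ℕ) (hk : k < n) : (Fin n → ℝ) → (Fin k → ℝ) × ℝ :=
  fun x => (fun i => x ⟨i.1, i.2.trans hk⟩, x ⟨k, hk⟩)

/-- The conditional distribution `μ_{x₁,…,x_k}` of the `(k+1)`-th coordinate given the
first `k` coordinates, under a finite measure `μ` on `ℝⁿ`. -/
def condDist {n : ℕ} (μ : Measure (Fin n → ℝ)) [IsFiniteMeasure μ] (k : ℕ) (hk : k < n)
    (x : Fin k → ℝ) : Measure ℝ :=
  haveI := μ.isFiniteMeasure_map (splitMap k hk)
  (μ.map (splitMap k hk)).condKernel x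

/-- The recursively defined Knothe–Rosenblatt transform:
`X_k = F_{μ_{X₁,…,X_{k−1}}}^{-1}(u_k)`. -/
def krVal {n : ℕ} (μ : Measure (Fin n → ℝ)) [IsFiniteMeasure μ] (u : Fin n → ℝ) :
    (k : ℕ) → k < n → ℝ
  | k, hk =>
      quantile (condDist μ k hk (fun i : Fin k => krVal μ u i.1 (i.2.trans hk))) (u ⟨k, hk⟩)
  termination_by k _ => k
  decreasing_by exact i.2

/-- The Knothe–Rosenblatt (Monge) map applied to a vector of uniforms. -/
def krX {n : ℕ} (μ : Measure (Fin n → ℝ)) [IsFiniteMeasure μ] (u : Fin n → ℝ) : Fin n → ℝ :=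
  fun k => krVal μ u k.1 k.2

/-- The uniform measure on the cube `[0,1]ⁿ` (law of `n` i.i.d. uniforms `U₁,…,Uₙ`). -/
def uniformCube (n : ℕ) : Measure (Fin n → ℝ) :=
  Measure.pi fun _ => volume.restrict (Set.Icc (0 : ℝ) 1)

/-- The Knothe–Rosenblatt rearrangement `π^{KR}_{μ,ν}`: the joint law of
`(X₁,…,Xₙ,Y₁,…,Yₙ)` where `X_k = F_{μ_{X₁,…,X_{k−1}}}^{-1}(U_k)` and
`Y_k = F_{ν_{Y₁,…,Y_{k−1}}}^{-1}(U_k)` for i.i.d. uniforms `U₁,…,Uₙ` on `[0,1]`. -/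
def KR {n : ℕ} (μ ν : Measure (Fin n → ℝ)) [IsFiniteMeasure μ] [IsFiniteMeasure ν] :
    Measure ((Fin n → ℝ) × (Fin n → ℝ)) :=
  (uniformCube n).map fun u => (krX μ u, krX ν u)

lemma aux_quantile_le_iff (ρ : Measure ℝ) [IsProbabilityMeasure ρ] {y : ℝ} (hy : y ∈ Set.Ioo (0:ℝ) 1)
    (a : ℝ) : quantile ρ y ≤ a ↔ y ≤ cdfAt ρ a := by
  have hc : ∀ a, cdfAt ρ a = cdf ρ a := fun a => by
    rw [cdf_eq_real]; rfl
  have hne : {u : ℝ | y ≤ cdfAt ρ u}.Nonempty := by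
    have := (tendsto_cdf_atTop ρ).eventually (eventually_ge_nhds hy.2)
    obtain ⟨u, hu⟩ := this.exists
    exact ⟨u, by simpa [hc] using hu⟩
  have hbdd : BddBelow {u : ℝ | y ≤ cdfAt ρ u} := by
    have := (tendsto_cdf_atBot ρ).eventually (eventually_lt_nhds hy.1)
    obtain ⟨l, hl⟩ := this.exists
    refine ⟨l, fun u hu => ?_⟩
    by_contra! h
    have h1 := monotone_cdf ρ h.le
    have h2 : y ≤ cdf ρ u := by simpa [hc] using hu
    linarith
  constructor
  · intro h
    rw [hc]
    have hr : Filter.Tendsto (cdf ρ) (nhdsWithin a (Set.Ioi a)) (nhds (cdf ρ a)) :=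
      ((cdf ρ).right_continuous a).mono Set.Ioi_subset_Ici_self
    refine ge_of_tendsto hr ?_
    filter_upwards [self_mem_nhdsWithin] with t ht
    obtain ⟨u, hu, hut⟩ := exists_lt_of_csInf_lt hne (lt_of_le_of_lt h ht)
    have h2 : y ≤ cdf ρ u := by simpa [hc] using hu
    exact h2.trans (monotone_cdf ρ hut.le)
  · intro h
    exact csInf_le hbdd h

lemma aux_quantile_affine (ρ : Measure ℝ) [IsProbabilityMeasure ρ] {y : ℝ}
    (hy : y ∈ Set.Ioo (0:ℝ) 1) (a s : ℝ) (hs : 0 ≤ s) :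
    quantile (ρ.map (fun e => a + s * e)) y = a + s * quantile ρ y := by
  have hm : Measurable (fun e : ℝ => a + s * e) := by fun_prop
  have : IsProbabilityMeasure (ρ.map (fun e => a + s * e)) :=
    Measure.isProbabilityMeasure_map hm.aemeasurable
  refine eq_of_forall_ge_iff fun t => ?_
  rw [aux_quantile_le_iff _ hy]
  unfold cdfAt
  rw [Measure.map_apply hm measurableSet_Iic]
  rcases hs.eq_or_lt with rfl | hs
  · by_cases h : a ≤ t
    · have : (fun e : ℝ => a + 0 * e) ⁻¹' Set.Iic t = Set.univ := by ext; simp [h]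
      rw [this]; simp [h, hy.2.le]
    · have : (fun e : ℝ => a + 0 * e) ⁻¹' Set.Iic t = ∅ := by ext; simpa using h
      rw [this]; simp [h, hy.1]
  · have : (fun e : ℝ => a + s * e) ⁻¹' Set.Iic t = Set.Iic ((t - a) / s) := by
      ext e; simp only [Set.mem_preimage, Set.mem_Iic]; rw [le_div_iff₀ hs]
      constructor <;> intro h <;> linarith
    rw [this]
    change y ≤ cdfAt ρ _ ↔ _
    rw [← aux_quantile_le_iff _ hy, le_div_iff₀ hs]
    constructor <;> intro h <;> linarith

/-- measurable version of the quantile function -/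
def auxQ (ρ : Measure ℝ) (y : ℝ) : ℝ := by
  classical
  exact if y ∈ Set.Ioo (0:ℝ) 1 then quantile ρ y else 0

lemma auxQ_of_mem (ρ : Measure ℝ) {y : ℝ} (hy : y ∈ Set.Ioo (0:ℝ) 1) :
    auxQ ρ y = quantile ρ y := by
  simp only [auxQ, if_pos hy]

lemma auxQ_measurable (ρ : Measure ℝ) [IsProbabilityMeasure ρ] : Measurable (auxQ ρ) := by
  classical
  refine measurable_of_Iic fun a => ?_
  have : auxQ ρ ⁻¹' Set.Iic a =
      (Set.Ioo 0 1 ∩ Set.Iic (cdfAt ρ a)) ∪ ((Set.Ioo 0 1)ᶜ ∩ {_y : ℝ | 0 ≤ a}) := by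
    ext y
    by_cases hy : y ∈ Set.Ioo (0:ℝ) 1
    · simp only [Set.mem_preimage, auxQ_of_mem ρ hy, Set.mem_Iic, aux_quantile_le_iff ρ hy]
      simp [hy.1, hy.2]
    · simp only [Set.mem_preimage, auxQ, Set.mem_Iic, Set.mem_union, Set.mem_inter_iff,
        Set.mem_compl_iff, hy]
      simp
  rw [this]
  exact (measurableSet_Ioo.inter measurableSet_Iic).union (measurableSet_Ioo.compl.inter (by simp))

instance aux_unif_prob : IsProbabilityMeasure (volume.restrict (Set.Icc (0:ℝ) 1)) :=
  ⟨by simp⟩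

lemma aux_unif_ae : ∀ᵐ y ∂(volume.restrict (Set.Icc (0:ℝ) 1)), y ∈ Set.Ioo (0:ℝ) 1 := by
  rw [← restrict_Ioo_eq_restrict_Icc]
  exact ae_restrict_mem measurableSet_Ioo

lemma auxQ_map (ρ : Measure ℝ) [IsProbabilityMeasure ρ] :
    (volume.restrict (Set.Icc (0:ℝ) 1)).map (auxQ ρ) = ρ := by
  have := Measure.isProbabilityMeasure_map (μ := volume.restrict (Set.Icc (0:ℝ) 1))
    (auxQ_measurable ρ).aemeasurable
  refine Measure.ext_of_Iic _ _ fun a => ?_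
  rw [Measure.map_apply (auxQ_measurable ρ) measurableSet_Iic]
  have h1 : (volume.restrict (Set.Icc (0:ℝ) 1)) (auxQ ρ ⁻¹' Set.Iic a)
      = (volume.restrict (Set.Icc (0:ℝ) 1)) (Set.Iic (cdfAt ρ a)) := by
    refine measure_congr ?_
    filter_upwards [aux_unif_ae] with y hy
    refine propext ?_
    change auxQ ρ y ≤ a ↔ y ≤ cdfAt ρ a
    rw [auxQ_of_mem ρ hy, aux_quantile_le_iff ρ hy]
  have h0 : 0 ≤ cdfAt ρ a := ENNReal.toReal_nonneg
  have h2 : cdfAt ρ a ≤ 1 := measureReal_le_one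
  rw [h1, Measure.restrict_apply measurableSet_Iic]
  have : Set.Iic (cdfAt ρ a) ∩ Set.Icc 0 1 = Set.Icc 0 (cdfAt ρ a) := by
    ext y; simp only [Set.mem_inter_iff, Set.mem_Iic, Set.mem_Icc]
    constructor
    · rintro ⟨h, h', _⟩; exact ⟨h', h⟩
    · rintro ⟨h, h'⟩; exact ⟨h', h, h'.trans h2⟩
  rw [this, Real.volume_Icc, sub_zero, cdfAt, ENNReal.ofReal_toReal (measure_ne_top _ _)]

/-- conditional law of a triangular system -/
lemma aux_condDist_ae {n : ℕ} (ρ : Fin n → Measure ℝ) [∀ i, IsProbabilityMeasure (ρ i)]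
    (a s : (k : ℕ) → (Fin k → ℝ) → ℝ) (ha : ∀ k, Measurable (a k)) (hsm : ∀ k, Measurable (s k))
    (G : (Fin n → ℝ) → Fin n → ℝ) (hGm : Measurable G)
    (hG : ∀ v k (hk : k < n), G v ⟨k, hk⟩ = a k (fun i => G v ⟨i, i.2.trans hk⟩)
      + s k (fun i => G v ⟨i, i.2.trans hk⟩) * v ⟨k, hk⟩)
    (μ : Measure (Fin n → ℝ)) [IsFiniteMeasure μ] (hμ : μ = (Measure.pi ρ).map G)
    (k : ℕ) (hk : k < n) :
    ∀ᵐ x ∂((Measure.pi ρ).map (fun v (i : Fin k) => G v ⟨i, i.2.trans hk⟩)),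
      condDist μ k hk x = (ρ ⟨k, hk⟩).map (fun e => a k x + s k x * e) := by
  set A : (Fin n → ℝ) → (Fin k → ℝ) := fun v (i : Fin k) => G v ⟨i, i.2.trans hk⟩ with hA
  have hAm : Measurable A := by
    refine measurable_pi_lambda _ fun i => (measurable_pi_apply _).comp hGm
  have hloc : ∀ v w : Fin n → ℝ, ∀ m (hm : m < n), (∀ i : Fin n, i.1 ≤ m → v i = w i) →
      G v ⟨m, hm⟩ = G w ⟨m, hm⟩ := by
    intro v w m
    induction m using Nat.strong_induction_on with
    | _ m ih =>
      intro hm h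
      rw [hG v, hG w]
      have : (fun i : Fin m => G v ⟨i, i.2.trans hm⟩) = fun i : Fin m => G w ⟨i, i.2.trans hm⟩ := by
        funext i
        exact ih i i.2 _ (fun j hj => h j (hj.trans i.2.le))
      rw [this, h ⟨m, hm⟩ le_rfl]
  have hind : IndepFun A (fun v => v ⟨k, hk⟩) (Measure.pi ρ) := by
    have h0 : iIndepFun (fun (i : Fin n) (v : Fin n → ℝ) => v i) (Measure.pi ρ) :=
      iIndepFun_pi (X := fun _ x => x) (fun i => aemeasurable_id)
    have h1 := h0.indepFun_finset (Finset.univ.filter (fun i : Fin n => i.1 < k)) {⟨k, hk⟩}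
      (by simp) (fun i => measurable_pi_apply i)
    let B : ((Finset.univ.filter (fun i : Fin n => i.1 < k)) → ℝ) → (Fin n → ℝ) :=
      fun w i => if h : i.1 < k then w ⟨i, by simpa using h⟩ else 0
    have hB : Measurable B := by
      refine measurable_pi_lambda _ fun i => ?_
      by_cases h : i.1 < k
      · simp only [B, h, dite_true]; exact measurable_pi_apply _
      · simp only [B, h, dite_false]; exact measurable_const
    have h2 := h1.comp (hAm.comp hB) (measurable_pi_apply (⟨⟨k, hk⟩, by simp⟩ : ({⟨k, hk⟩} : Finset (Fin n))))
    have h3 : A = (A ∘ B) ∘ (fun (v : Fin n → ℝ)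
        (i : (Finset.univ.filter (fun i : Fin n => i.1 < k))) => v i) := by
      funext v i
      refine hloc _ _ _ _ fun j hj => ?_
      have : j.1 < k := lt_of_le_of_lt hj i.2
      simp [B, this]
    rw [h3]
    exact h2
  have hprod := (indepFun_iff_map_prod_eq_prod_map_map hAm.aemeasurable
    (measurable_pi_apply _).aemeasurable).1 hind
  have hev : (Measure.pi ρ).map (fun v => v ⟨k, hk⟩) = ρ ⟨k, hk⟩ :=
    (measurePreserving_eval ρ ⟨k, hk⟩).map_eq
  rw [hev] at hprod
  set α := (Measure.pi ρ).map A
  have : IsProbabilityMeasure α := Measure.isProbabilityMeasure_map hAm.aemeasurable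
  let ψ : (Fin k → ℝ) × ℝ → ℝ := fun p => a k p.1 + s k p.1 * p.2
  have hψ : Measurable ψ := by
    have := ha k; have := hsm k
    fun_prop
  let κ : Kernel (Fin k → ℝ) ℝ := (Kernel.id ×ₖ Kernel.const _ (ρ ⟨k, hk⟩)).map ψ
  have hκ : ∀ x, κ x = (ρ ⟨k, hk⟩).map (fun e => a k x + s k x * e) := by
    intro x
    simp only [κ]
    rw [Kernel.map_apply _ hψ, Kernel.prod_apply, Kernel.id_apply, Kernel.const_apply,
      Measure.dirac_prod, Measure.map_map hψ (by fun_prop)]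
    rfl
  have : IsMarkovKernel κ := Kernel.IsMarkovKernel.map _ hψ
  have hsplit : Measurable (splitMap (n := n) k hk) := by
    unfold splitMap
    refine Measurable.prodMk (measurable_pi_lambda _ fun i => measurable_pi_apply _) (measurable_pi_apply _)
  have hmap : μ.map (splitMap k hk) = α ⊗ₘ κ := by
    have hT : Measurable (fun p : (Fin k → ℝ) × ℝ => (p.1, ψ p)) := measurable_fst.prodMk hψ
    have e1 : μ.map (splitMap k hk) = (α.prod (ρ ⟨k, hk⟩)).map (fun p => (p.1, ψ p)) := by
      rw [hμ, Measure.map_map hsplit hGm, ← hprod, Measure.map_map hT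
        (hAm.prodMk (measurable_pi_apply _))]
      congr 1
      funext v
      simp only [Function.comp, splitMap, ψ, A]
      rw [hG v k hk]
    rw [e1]
    ext S hS
    rw [Measure.map_apply hT hS, Measure.prod_apply (hT hS), Measure.compProd_apply hS]
    refine lintegral_congr fun x => ?_
    rw [hκ, Measure.map_apply (by fun_prop) (measurable_prodMk_left hS)]
    rfl
  have := μ.isFiniteMeasure_map (splitMap (n := n) k hk)
  have hfst : (μ.map (splitMap k hk)).fst = α := by
    rw [hmap, Measure.fst_compProd]
  have := eq_condKernel_of_measure_eq_compProd (ρ := μ.map (splitMap k hk)) κ (by rw [hfst, hmap])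
  rw [hfst] at this
  filter_upwards [this] with x hx
  rw [← hκ, hx]
  rfl

lemma aux_krX_ae {n : ℕ} (ρ : Fin n → Measure ℝ) [∀ i, IsProbabilityMeasure (ρ i)]
    (a s : (k : ℕ) → (Fin k → ℝ) → ℝ) (ha : ∀ k, Measurable (a k)) (hsm : ∀ k, Measurable (s k))
    (hs : ∀ k x, 0 ≤ s k x)
    (G : (Fin n → ℝ) → Fin n → ℝ) (hGm : Measurable G)
    (hG : ∀ v k (hk : k < n), G v ⟨k, hk⟩ = a k (fun i => G v ⟨i, i.2.trans hk⟩)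
      + s k (fun i => G v ⟨i, i.2.trans hk⟩) * v ⟨k, hk⟩)
    (μ : Measure (Fin n → ℝ)) [IsFiniteMeasure μ] (hμ : μ = (Measure.pi ρ).map G) :
    ∀ᵐ u ∂(uniformCube n), krX μ u = G (fun i => auxQ (ρ i) (u i)) := by
  have hQm : Measurable (fun (u : Fin n → ℝ) i => auxQ (ρ i) (u i)) :=
    measurable_pi_lambda _ fun i => (auxQ_measurable _).comp (measurable_pi_apply i)
  have hpi : Measure.pi ρ = (uniformCube n).map (fun u i => auxQ (ρ i) (u i)) := by
    unfold uniformCube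
    have : ∀ i, SigmaFinite ((volume.restrict (Set.Icc (0:ℝ) 1)).map (auxQ (ρ i))) := fun i => by
      rw [auxQ_map]; infer_instance
    rw [Measure.pi_map_pi (f := fun i => auxQ (ρ i)) (fun i => (auxQ_measurable _).aemeasurable)]
    simp only [auxQ_map]
  have h1 : ∀ᵐ u ∂(uniformCube n), ∀ i : Fin n, u i ∈ Set.Ioo (0:ℝ) 1 := by
    rw [ae_all_iff]
    intro i
    have := (measurePreserving_eval (fun _ : Fin n => volume.restrict (Set.Icc (0:ℝ) 1)) i)
    exact this.quasiMeasurePreserving.ae aux_unif_ae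
  have h2 : ∀ᵐ u ∂(uniformCube n), ∀ i : Fin n,
      condDist μ i.1 i.2 (fun j => G (fun i => auxQ (ρ i) (u i)) ⟨j, j.2.trans i.2⟩)
      = (ρ i).map (fun e => a i (fun j => G (fun i => auxQ (ρ i) (u i)) ⟨j, j.2.trans i.2⟩)
        + s i (fun j => G (fun i => auxQ (ρ i) (u i)) ⟨j, j.2.trans i.2⟩) * e) := by
    rw [ae_all_iff]
    intro i
    have h := aux_condDist_ae ρ a s ha hsm G hGm hG μ hμ i.1 i.2
    have hAm : Measurable (fun v (j : Fin i.1) => G v ⟨j, j.2.trans i.2⟩) :=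
      measurable_pi_lambda _ fun j => (measurable_pi_apply _).comp hGm
    rw [hpi, Measure.map_map hAm hQm] at h
    exact ae_of_ae_map (hAm.comp hQm).aemeasurable h
  filter_upwards [h1, h2] with u hu hc
  have key : ∀ k (hk : k < n), krVal μ u k hk = G (fun i => auxQ (ρ i) (u i)) ⟨k, hk⟩ := by
    intro k
    induction k using Nat.strong_induction_on with
    | _ k ih =>
      intro hk
      rw [krVal]
      have : (fun i : Fin k => krVal μ u i.1 (i.2.trans hk)) =
          fun i : Fin k => G (fun i => auxQ (ρ i) (u i)) ⟨i, i.2.trans hk⟩ := by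
        funext i; exact ih i i.2 _
      rw [this, hc ⟨k, hk⟩, aux_quantile_affine _ (hu _) _ _ (hs _ _), hG _ k hk,
        auxQ_of_mem _ (hu _)]
  funext i
  exact key i.1 i.2

/-- abstract recursion -/
def auxRec (c : ℝ) (b σ : ℝ → ℝ) (x₀ : ℝ) (e : ℕ → ℝ) : ℕ → ℝ
  | 0 => x₀
  | k + 1 => (auxRec c b σ x₀ e k + c * b (auxRec c b σ x₀ e k))
      + σ (auxRec c b σ x₀ e k) * e (k + 1)

def auxExt {n : ℕ} (v : Fin n → ℝ) (k : ℕ) : ℝ := if h : k < n then v ⟨k, h⟩ else 0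

def auxG (n : ℕ) (c : ℝ) (b σ : ℝ → ℝ) (x₀ : ℝ) (v : Fin n → ℝ) : Fin n → ℝ :=
  fun k => auxRec c b σ x₀ (auxExt v) k

def auxa (c : ℝ) (b : ℝ → ℝ) (x₀ : ℝ) : (k : ℕ) → (Fin k → ℝ) → ℝ
  | 0 => fun _ => x₀
  | k + 1 => fun x => x (Fin.last k) + c * b (x (Fin.last k))

def auxs (σ : ℝ → ℝ) : (k : ℕ) → (Fin k → ℝ) → ℝ
  | 0 => fun _ => 0
  | k + 1 => fun x => σ (x (Fin.last k))

lemma auxG_measurable (n : ℕ) (c : ℝ) (b σ : ℝ → ℝ) (hb : Measurable b) (hσ : Measurable σ) (x₀ : ℝ) :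
    Measurable (auxG n c b σ x₀) := by
  refine measurable_pi_lambda _ fun k => ?_
  have hE : ∀ k, Measurable (fun v : Fin n → ℝ => auxExt v k) := by
    intro k
    unfold auxExt
    by_cases h : k < n
    · simp only [h, dite_true]; exact measurable_pi_apply _
    · simp only [h, dite_false]; exact measurable_const
  have : ∀ k, Measurable (fun v : Fin n → ℝ => auxRec c b σ x₀ (auxExt v) k) := by
    intro k
    induction k with
    | zero => exact measurable_const
    | succ k ih =>
      exact (ih.add ((hb.comp ih).const_mul c)).add ((hσ.comp ih).mul (hE (k+1)))
  exact this k

lemma auxG_krX (n : ℕ) (c : ℝ) (b σ : ℝ → ℝ) (hb : Measurable b) (hσ : Measurable σ)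
    (hσ0 : ∀ x, 0 ≤ σ x) (x₀ : ℝ)
    (ρ : Fin n → Measure ℝ) [∀ i, IsProbabilityMeasure (ρ i)]
    (μ : Measure (Fin n → ℝ)) [IsFiniteMeasure μ]
    (hμ : μ = (Measure.pi ρ).map (auxG n c b σ x₀)) :
    ∀ᵐ u ∂(uniformCube n), krX μ u = auxG n c b σ x₀ (fun i => auxQ (ρ i) (u i)) := by
  refine aux_krX_ae ρ (auxa c b x₀) (auxs σ) ?_ ?_ ?_ _ (auxG_measurable n c b σ hb hσ x₀) ?_ μ hμ
  · rintro (_ | k)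
    · exact measurable_const
    · exact (measurable_pi_apply _).add ((hb.comp (measurable_pi_apply _)).const_mul c)
  · rintro (_ | k)
    · exact measurable_const
    · exact hσ.comp (measurable_pi_apply _)
  · rintro (_ | k) x
    · exact le_rfl
    · exact hσ0 _
  · rintro v (_ | k) hk
    · simp [auxG, auxa, auxs, auxRec]
    · simp [auxG, auxa, auxs, auxRec, auxExt, hk]

lemma aux_pi_map {n : ℕ} (ρ : Fin n → Measure ℝ) [∀ i, IsProbabilityMeasure (ρ i)] :
    Measure.pi ρ = (uniformCube n).map (fun u i => auxQ (ρ i) (u i)) := by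
  unfold uniformCube
  have : ∀ i, SigmaFinite ((volume.restrict (Set.Icc (0:ℝ) 1)).map (auxQ (ρ i))) := fun i => by
    rw [auxQ_map]; infer_instance
  rw [Measure.pi_map_pi (f := fun i => auxQ (ρ i)) (fun i => (auxQ_measurable _).aemeasurable)]
  simp only [auxQ_map]

lemma auxRec_eq {Ω : Type*} (W : ℝ → Ω → ℝ) (N : ℕ) (b σ : ℝ → ℝ) (x₀ : ℝ) (ω : Ω) (Z : ℕ → Ω → ℝ)
    (hZ : ∀ k < N, truncWiener W N ((k + 1) * (1 / N : ℝ)) ω - truncWiener W N (k * (1 / N : ℝ)) ω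
        = Z (k + 1) ω) :
    (fun k : Fin (N + 1) => monEMdisc W N b σ x₀ k ω)
      = auxG (N + 1) (1 / N) b σ x₀ (fun k => Z k ω) := by
  have : ∀ k, k < N + 1 → monEMdisc W N b σ x₀ k ω
      = auxRec (1 / N) b σ x₀ (auxExt (fun k : Fin (N + 1) => Z k ω)) k := by
    intro k
    induction k with
    | zero => intro _; rfl
    | succ k ih =>
      intro hk
      rw [monEMdisc, auxRec]
      beta_reduce
      rw [ih (by omega), hZ k (by omega)]
      simp [auxExt, hk]
  funext k
  exact this k k.2

lemma aux_final
    {Ω : Type*} [MeasurableSpace Ω] (P : Measure Ω) [IsProbabilityMeasure P] (W : ℝ → Ω → ℝ)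
    (b bbar σ σbar : ℝ → ℝ)
    (hb : Measurable b) (hbbar : Measurable bbar)
    (hσ : Measurable σ) (hσbar : Measurable σbar)
    (hσ0 : ∀ x, 0 ≤ σ x) (hσbar0 : ∀ x, 0 ≤ σbar x)
    (x₀ : ℝ) (N : ℕ)
    (μh νh : Measure (Fin (N + 1) → ℝ))
    [IsProbabilityMeasure μh] [IsProbabilityMeasure νh]
    (hμh : μh = P.map fun ω => fun k : Fin (N + 1) => monEMdisc W N b σ x₀ k ω)
    (hνh : νh = P.map fun ω => fun k : Fin (N + 1) => monEMdisc W N bbar σbar x₀ k ω)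
    (Z : ℕ → Ω → ℝ) (hZm : ∀ k, Measurable (Z k)) (hZi : iIndepFun Z P)
    (hZ : ∀ᵐ ω ∂P, ∀ k < N,
      truncWiener W N ((k + 1) * (1 / N : ℝ)) ω - truncWiener W N (k * (1 / N : ℝ)) ω
        = Z (k + 1) ω) :
    P.map (fun ω =>
        ((fun k : Fin (N + 1) => monEMdisc W N b σ x₀ k ω),
         (fun k : Fin (N + 1) => monEMdisc W N bbar σbar x₀ k ω)))
      = KR μh νh := by
  have hVm : Measurable (fun ω => fun k : Fin (N + 1) => Z k ω) :=
    measurable_pi_lambda _ fun k => hZm k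
  set ρ : Fin (N + 1) → Measure ℝ := fun k => P.map (Z k) with hρ
  have : ∀ i, IsProbabilityMeasure (ρ i) := fun i =>
    Measure.isProbabilityMeasure_map (hZm i).aemeasurable
  have hpi : P.map (fun ω => fun k : Fin (N + 1) => Z k ω) = Measure.pi ρ := by
    have h1 : iIndepFun (fun k : Fin (N + 1) => Z k) P :=
      hZi.precomp (g := fun k : Fin (N + 1) => (k : ℕ)) Fin.val_injective
    exact h1.map_fun_eq_pi_map (fun k => (hZm k).aemeasurable)
  have hGm := auxG_measurable (N + 1) (1 / N) b σ hb hσ x₀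
  have hGm' := auxG_measurable (N + 1) (1 / N) bbar σbar hbbar hσbar x₀
  have e1 : μh = (Measure.pi ρ).map (auxG (N + 1) (1 / N) b σ x₀) := by
    rw [hμh, ← hpi, Measure.map_map hGm hVm]
    refine Measure.map_congr ?_
    filter_upwards [hZ] with ω hω
    exact auxRec_eq W N b σ x₀ ω Z hω
  have e2 : νh = (Measure.pi ρ).map (auxG (N + 1) (1 / N) bbar σbar x₀) := by
    rw [hνh, ← hpi, Measure.map_map hGm' hVm]
    refine Measure.map_congr ?_
    filter_upwards [hZ] with ω hω
    exact auxRec_eq W N bbar σbar x₀ ω Z hω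
  have k1 := auxG_krX (N + 1) (1 / N) b σ hb hσ hσ0 x₀ ρ μh e1
  have k2 := auxG_krX (N + 1) (1 / N) bbar σbar hbbar hσbar hσbar0 x₀ ρ νh e2
  have hQm : Measurable (fun (u : Fin (N + 1) → ℝ) i => auxQ (ρ i) (u i)) :=
    measurable_pi_lambda _ fun i => (auxQ_measurable _).comp (measurable_pi_apply i)
  have hKR : KR μh νh = (uniformCube (N + 1)).map
      ((fun v => (auxG (N + 1) (1 / N) b σ x₀ v, auxG (N + 1) (1 / N) bbar σbar x₀ v)) ∘
        (fun u i => auxQ (ρ i) (u i))) := by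
    unfold KR
    refine Measure.map_congr ?_
    filter_upwards [k1, k2] with u h1 h2
    simp only [Function.comp, h1, h2]
  rw [hKR, ← Measure.map_map (hGm.prodMk hGm') hQm, ← aux_pi_map, ← hpi,
    Measure.map_map (hGm.prodMk hGm') hVm]
  refine Measure.map_congr ?_
  filter_upwards [hZ] with ω hω
  simp only [Function.comp]
  rw [auxRec_eq W N b σ x₀ ω Z hω, auxRec_eq W N bbar σbar x₀ ω Z hω]

lemma aux_indep_sup {Ω : Type*} {mΩ : MeasurableSpace Ω} (P : Measure Ω) [IsProbabilityMeasure P]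
    (A B C : MeasurableSpace Ω) (hA : A ≤ mΩ) (hB : B ≤ mΩ) (hC : C ≤ mΩ)
    (h1 : Indep A (B ⊔ C) P) (h2 : Indep B C P) : Indep (A ⊔ B) C P := by
  let π : Set (Set Ω) := {s | ∃ a b, MeasurableSet[A] a ∧ MeasurableSet[B] b ∧ s = a ∩ b}
  have hπ : IsPiSystem π := by
    rintro _ ⟨a, b, ha, hb, rfl⟩ _ ⟨a', b', ha', hb', rfl⟩ _
    exact ⟨a ∩ a', b ∩ b', ha.inter ha', hb.inter hb', by ext; simp; tauto⟩
  have hgen : A ⊔ B = MeasurableSpace.generateFrom π := by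
    apply le_antisymm
    · refine sup_le ?_ ?_
      · intro a ha
        exact MeasurableSpace.measurableSet_generateFrom ⟨a, Set.univ, ha, MeasurableSet.univ, by simp⟩
      · intro b hb
        exact MeasurableSpace.measurableSet_generateFrom ⟨Set.univ, b, MeasurableSet.univ, hb, by simp⟩
    · refine MeasurableSpace.generateFrom_le ?_
      rintro _ ⟨a, b, ha, hb, rfl⟩
      exact MeasurableSet.inter ((le_sup_left : A ≤ A ⊔ B) _ ha) ((le_sup_right : B ≤ A ⊔ B) _ hb)
  refine IndepSets.indep (p1 := π) (p2 := {s | MeasurableSet[C] s}) (sup_le hA hB) hC hπ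
    (@MeasurableSpace.isPiSystem_measurableSet Ω C) hgen
    (@MeasurableSpace.generateFrom_measurableSet Ω C).symm ?_
  rw [IndepSets_iff]
  rintro _ c ⟨a, b, ha, hb, rfl⟩ hc
  rw [Indep_iff] at h1 h2
  have hb' : MeasurableSet[B ⊔ C] b := (le_sup_left : B ≤ B ⊔ C) _ hb
  have hc' : MeasurableSet[B ⊔ C] c := (le_sup_right : C ≤ B ⊔ C) _ hc
  rw [Set.inter_assoc, h1 a (b ∩ c) ha (hb'.inter hc'), h2 b c hb hc, h1 a b ha hb', mul_assoc]

lemma aux_iIndep_seq {Ω : Type*} {mΩ : MeasurableSpace Ω} (P : Measure Ω) [IsProbabilityMeasure P]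
    (m : ℕ → MeasurableSpace Ω)
    (h : ∀ k, Indep (m k) (⨆ j, ⨆ (_ : j < k), m j) P) : iIndep m P := by
  rw [iIndep_iff]
  intro S
  induction S using Finset.induction_on_max with
  | empty => intro f _; simp
  | insert a S ha ih =>
    intro f hf
    have hnot : a ∉ S := fun h => lt_irrefl _ (ha a h)
    rw [Finset.prod_insert hnot, Finset.set_biInter_insert,
      ← ih (fun i hi => hf i (Finset.mem_insert_of_mem hi))]
    have := h a
    rw [Indep_iff] at this
    refine this _ _ (hf a (Finset.mem_insert_self _ _)) ?_
    refine Finset.measurableSet_biInter _ fun i hi => ?_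
    exact (le_iSup₂ (f := fun j (_ : j < a) => m j) i (ha i hi)) _
      (hf i (Finset.mem_insert_of_mem hi))

/-- past -/
@[reducible] def auxF {Ω : Type*} (W : ℝ → Ω → ℝ) (s : ℝ) : MeasurableSpace Ω :=
  ⨆ r ∈ Set.Icc (0 : ℝ) s, MeasurableSpace.comap (W r) inferInstance

/-- increments after `s` up to `t` -/
@[reducible] def auxI {Ω : Type*} (W : ℝ → Ω → ℝ) (s t : ℝ) : MeasurableSpace Ω :=
  ⨆ r : Set.Icc s t, MeasurableSpace.comap (fun ω => W r ω - W s ω) inferInstance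

lemma auxF_meas {Ω : Type*} (W : ℝ → Ω → ℝ) {r s : ℝ} (hr : 0 ≤ r) (hrs : r ≤ s) :
    Measurable[auxF W s] (W r) := by
  rw [measurable_iff_comap_le]
  exact le_iSup₂ (f := fun r (_ : r ∈ Set.Icc (0:ℝ) s) =>
    MeasurableSpace.comap (W r) inferInstance) r ⟨hr, hrs⟩

lemma auxI_meas {Ω : Type*} (W : ℝ → Ω → ℝ) {r s t : ℝ} (hr : s ≤ r) (hrs : r ≤ t) :
    Measurable[auxI W s t] (fun ω => W r ω - W s ω) := by
  rw [measurable_iff_comap_le]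
  exact le_iSup (f := fun r : Set.Icc s t =>
    MeasurableSpace.comap (fun ω => W r ω - W s ω) inferInstance) ⟨r, hr, hrs⟩

lemma auxF_mono {Ω : Type*} (W : ℝ → Ω → ℝ) {s t : ℝ} (hst : s ≤ t) : auxF W s ≤ auxF W t := by
  refine iSup₂_le fun r hr => ?_
  rw [← measurable_iff_comap_le]
  exact auxF_meas W hr.1 (hr.2.trans hst)

lemma auxI_le_auxF {Ω : Type*} (W : ℝ → Ω → ℝ) {s t : ℝ} (hs : 0 ≤ s) (hst : s ≤ t) :
    auxI W s t ≤ auxF W t := by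
  refine iSup_le fun r => ?_
  rw [← measurable_iff_comap_le]
  exact (auxF_meas W (hs.trans r.2.1) r.2.2).sub (auxF_meas W hs hst)

lemma auxF_le {Ω : Type*} [mΩ : MeasurableSpace Ω] (W : ℝ → Ω → ℝ) (hW : ∀ t, Measurable (W t)) (s : ℝ) :
    auxF W s ≤ mΩ :=
  iSup₂_le fun r _ => (measurable_iff_comap_le).1 (hW r)

lemma aux_indep_incr {Ω : Type*} [mΩ : MeasurableSpace Ω] (P : Measure Ω) (W : ℝ → Ω → ℝ)
    (hW : IsBrownianMotion P W) {s t : ℝ} (hs : 0 ≤ s) :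
    Indep (auxI W s t) (auxF W s) P := by
  have := hW.isProb
  have hmeas := hW.meas
  have hindep := hW.indep
  have hFle := auxF_le W hW.meas
  -- finite version
  have fin : ∀ S : Finset ℝ, (∀ r ∈ S, s ≤ r) →
      Indep (⨆ r ∈ S, MeasurableSpace.comap (fun ω => W r ω - W s ω) inferInstance) (auxF W s) P := by
    intro S
    induction S using Finset.induction_on_max with
    | empty => intro _; simpa using indep_bot_left _
    | insert a S ha ih =>
      intro hS
      have ih := ih fun r hr => hS r (Finset.mem_insert_of_mem hr)
      have hsa : s ≤ a := hS a (Finset.mem_insert_self _ _)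
      set B : MeasurableSpace Ω :=
        ⨆ r ∈ S, MeasurableSpace.comap (fun ω => W r ω - W s ω) inferInstance with hB
      have hBm : ∀ r ∈ S, Measurable[B] (fun ω => W r ω - W s ω) := fun r hr => by
        rw [measurable_iff_comap_le]
        exact le_iSup₂ (f := fun r (_ : r ∈ S) =>
          MeasurableSpace.comap (fun ω => W r ω - W s ω) inferInstance) r hr
      -- previous point
      obtain ⟨p, hsp, hpa, hp, hBp⟩ : ∃ p, s ≤ p ∧ p ≤ a ∧ Measurable[B] (fun ω => W p ω - W s ω) ∧
          ∀ r ∈ S, r ≤ p := by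
        rcases S.eq_empty_or_nonempty with rfl | hne
        · refine ⟨s, le_rfl, hsa, ?_, by simp⟩
          simp only [sub_self]; exact measurable_const
        · refine ⟨S.max' hne, hS _ (Finset.mem_insert_of_mem (S.max'_mem hne)),
            (ha _ (S.max'_mem hne)).le, hBm _ (S.max'_mem hne), fun r hr => S.le_max' r hr⟩
      have hBF : B ≤ auxF W p := by
        refine iSup₂_le fun r hr => ?_
        rw [← measurable_iff_comap_le]
        have h0 := hS r (Finset.mem_insert_of_mem hr)
        exact (auxF_meas W (hs.trans h0) (hBp r hr)).sub (auxF_meas W hs hsp)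
      let A : MeasurableSpace Ω := MeasurableSpace.comap (fun ω => W a ω - W p ω) inferInstance
      have hA : A ≤ mΩ := measurable_iff_comap_le.1 ((hmeas a).sub (hmeas p))
      have hAF : Indep A (B ⊔ auxF W s) P :=
        indep_of_indep_of_le_right (hindep p a (hs.trans hsp) hpa)
          (sup_le hBF (auxF_mono W hsp))
      have h3 := aux_indep_sup P A B (auxF W s) hA (hBF.trans (hFle p))
        (hFle s) hAF ih
      refine indep_of_indep_of_le_left h3 ?_
      refine iSup₂_le fun r hr => ?_
      rw [← measurable_iff_comap_le]
      rcases Finset.mem_insert.1 hr with rfl | hr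
      · have e : (fun ω => W r ω - W s ω) = fun ω => (W r ω - W p ω) + (W p ω - W s ω) := by
          funext ω; ring
        rw [e]
        refine Measurable.add ?_ (hp.mono le_sup_right le_rfl)
        exact (comap_measurable (m := inferInstance) _).mono (le_sup_left : A ≤ A ⊔ B) le_rfl
      · exact (hBm r hr).mono le_sup_right le_rfl
  let m : Finset (Set.Icc s t) → MeasurableSpace Ω := fun S =>
    ⨆ r ∈ S, MeasurableSpace.comap (fun ω => W r.1 ω - W s ω) inferInstance
  have hm : auxI W s t = ⨆ S, m S := by
    unfold auxI m
    rw [iSup_eq_iSup_finset]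
  have hle : ∀ r, MeasurableSpace.comap (fun ω => W r ω - W s ω) inferInstance ≤ mΩ := fun r =>
    measurable_iff_comap_le.1 ((hW.meas r).sub (hW.meas s))
  rw [hm]
  refine indep_iSup_of_directed_le ?_ ?_ (hFle s) ?_
  · intro S
    refine indep_of_indep_of_le_left (fin (S.image Subtype.val) ?_) ?_
    · intro r hr
      obtain ⟨r', _, rfl⟩ := Finset.mem_image.1 hr
      exact r'.2.1
    · refine iSup₂_le fun r hr => ?_
      exact le_iSup₂ (f := fun (r : ℝ) (_ : r ∈ S.image Subtype.val) =>
          MeasurableSpace.comap (fun ω => W r ω - W s ω) inferInstance) r.1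
          (Finset.mem_image_of_mem _ hr)
  · exact fun S => iSup₂_le fun r _ => hle r
  · refine Monotone.directed_le fun S T hST => ?_
    exact biSup_mono fun r hr => hST hr

lemma aux_dense_ge (y : ℝ → ℝ) (hy : Continuous y) {s q c : ℝ} (hsq : s < q)
    (h : ∀ d : ℚ, s < d → (d : ℝ) < q → c ≤ y d) : ∀ r ∈ Set.Icc s q, c ≤ y r := by
  intro r hr
  by_contra! hlt
  have hopen : IsOpen {x | y x < c} := isOpen_lt hy continuous_const
  have hcl : r ∈ closure (Set.Ioo s q) := by rw [closure_Ioo hsq.ne]; exact hr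
  obtain ⟨z, hz1, hz2⟩ := mem_closure_iff.1 hcl _ hopen hlt
  obtain ⟨d, hd⟩ := (Rat.denseRange_cast (𝕜 := ℝ)).exists_mem_open (hopen.inter isOpen_Ioo) ⟨z, hz1, hz2⟩
  exact absurd (h d hd.2.1 hd.2.2) (not_le.2 hd.1)

/-- exit through the upper barrier -/
def auxUp (s T A : ℝ) (y : ℝ → ℝ) : Prop :=
  ∃ q : ℚ, (s < q ∧ (q : ℝ) ≤ T) ∧
    (∀ j : ℕ, ∃ d : ℚ, (s < d ∧ (d : ℝ) < q) ∧ A - 1 / ((j : ℝ) + 1) < y d) ∧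
    (∃ j : ℕ, ∀ d : ℚ, (s < d ∧ (d : ℝ) < q) → -A + 1 / ((j : ℝ) + 1) < y d)

lemma aux_exit_props (y : ℝ → ℝ) (hy : Continuous y) {s A : ℝ} (hA : 0 < A) (hys : y s = 0)
    (hne : {r : ℝ | s ≤ r ∧ A ≤ |y r|}.Nonempty) :
    s < sInf {r : ℝ | s ≤ r ∧ A ≤ |y r|} ∧ |y (sInf {r : ℝ | s ≤ r ∧ A ≤ |y r|})| = A ∧
    ∀ r, s ≤ r → r < sInf {r : ℝ | s ≤ r ∧ A ≤ |y r|} → |y r| < A := by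
  set E := {r : ℝ | s ≤ r ∧ A ≤ |y r|} with hE
  have hbdd : BddBelow E := ⟨s, fun r hr => hr.1⟩
  have hclosed : IsClosed E := by
    have : E = Set.Ici s ∩ {r | A ≤ |y r|} := by ext; rfl
    rw [this]
    exact isClosed_Ici.inter (isClosed_le continuous_const hy.abs)
  have hmem : sInf E ∈ E := hclosed.csInf_mem hne hbdd
  have hlt : ∀ r, s ≤ r → r < sInf E → |y r| < A := by
    intro r hr hrlt
    by_contra! h
    exact absurd (csInf_le hbdd ⟨hr, h⟩) (not_le.2 hrlt)
  have hs : s < sInf E := by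
    rcases hmem.1.eq_or_lt with h | h
    · have := hmem.2
      rw [← h, hys, abs_zero] at this
      linarith
    · exact h
  refine ⟨hs, le_antisymm ?_ hmem.2, hlt⟩
  have h1 : sInf E ∈ closure (Set.Ioo s (sInf E)) := by
    rw [closure_Ioo hs.ne]; exact ⟨hs.le, le_rfl⟩
  have h2 : Set.Ioo s (sInf E) ⊆ {r | |y r| ≤ A} := fun r hr => (hlt r hr.1.le hr.2).le
  exact (closure_minimal h2 (isClosed_le hy.abs continuous_const)) h1

lemma aux_up_val (y : ℝ → ℝ) (hy : Continuous y) {s T A : ℝ} (hA : 0 < A) (hys : y s = 0)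
    (hne : {r : ℝ | s ≤ r ∧ A ≤ |y r|}.Nonempty) (hU : auxUp s T A y) :
    y (min T (sInf {r : ℝ | s ≤ r ∧ A ≤ |y r|})) = A := by
  obtain ⟨hs, habs, hlt⟩ := aux_exit_props y hy hA hys hne
  set τ := sInf {r : ℝ | s ≤ r ∧ A ≤ |y r|} with hτ
  obtain ⟨q, ⟨hsq, hqT⟩, h1, j, h2⟩ := hU
  have hlow : ∀ r ∈ Set.Icc s q, -A + 1 / ((j : ℝ) + 1) ≤ y r :=
    aux_dense_ge y hy hsq fun d hd hd' => (h2 d ⟨hd, hd'⟩).le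
  obtain ⟨z, hz, hzmax⟩ := isCompact_Icc.exists_isMaxOn (Set.nonempty_Icc.2 hsq.le) hy.continuousOn
  have hzA : A ≤ y z := by
    have : Filter.Tendsto (fun j : ℕ => A - 1 / ((j : ℝ) + 1)) Filter.atTop (nhds (A - 0)) :=
      tendsto_const_nhds.sub tendsto_one_div_add_atTop_nhds_zero_nat
    rw [sub_zero] at this
    refine le_of_tendsto' this fun j => ?_
    obtain ⟨d, hd, hd'⟩ := h1 j
    exact hd'.le.trans (hzmax ⟨hd.1.le, hd.2.le⟩)
  have hτz : τ ≤ z := by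
    by_contra! h
    have := (abs_lt.1 (hlt z hz.1 h)).2
    linarith
  rw [min_eq_right (hτz.trans (hz.2.trans hqT))]
  have h3 := hlow τ ⟨hs.le, hτz.trans hz.2⟩
  have h4 : (0:ℝ) < 1 / ((j : ℝ) + 1) := by positivity
  rcases abs_eq hA.le |>.1 habs with h | h
  · exact h
  · linarith

lemma aux_up_of (y : ℝ → ℝ) (hy : Continuous y) {s T A : ℝ} (hA : 0 < A) (hys : y s = 0)
    (hne : {r : ℝ | s ≤ r ∧ A ≤ |y r|}.Nonempty)
    (hT : sInf {r : ℝ | s ≤ r ∧ A ≤ |y r|} < T)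
    (hv : y (sInf {r : ℝ | s ≤ r ∧ A ≤ |y r|}) = A) : auxUp s T A y := by
  obtain ⟨hs, habs, hlt⟩ := aux_exit_props y hy hA hys hne
  set τ := sInf {r : ℝ | s ≤ r ∧ A ≤ |y r|} with hτ
  have hnb : ∀ᶠ r in nhds τ, -A < y r := hy.continuousAt.eventually (lt_mem_nhds (by rw [hv]; linarith))
  obtain ⟨u, hu, hu'⟩ := (mem_nhdsGE_iff_exists_Ico_subset' (s := {r | -A < y r}) hT).1 (mem_nhdsWithin_of_mem_nhds hnb)
  obtain ⟨q, hq1, hq2⟩ := exists_rat_btwn (lt_min hu hT)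
  have hsq : s < q := hs.trans hq1
  have hall : ∀ r ∈ Set.Icc s (q:ℝ), -A < y r := by
    intro r hr
    rcases lt_or_ge r τ with h | h
    · exact (abs_lt.1 (hlt r hr.1 h)).1
    · exact hu' ⟨h, lt_of_le_of_lt hr.2 (hq2.trans_le (min_le_left _ _))⟩
  refine ⟨q, ⟨hsq, (hq2.trans_le (min_le_right _ _)).le⟩, ?_, ?_⟩
  · intro j
    by_contra! hcon
    have := aux_dense_ge (fun r => - y r) hy.neg (c := -(A - 1 / ((j : ℝ) + 1))) hsq
      (fun d hd hd' => by have := hcon d ⟨hd, hd'⟩; linarith) τ ⟨hs.le, hq1.le⟩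
    have h4 : (0:ℝ) < 1 / ((j : ℝ) + 1) := by positivity
    linarith
  · obtain ⟨z, hz, hzmin⟩ := isCompact_Icc.exists_isMinOn (Set.nonempty_Icc.2 hsq.le) hy.continuousOn
    obtain ⟨j, hj⟩ := exists_nat_one_div_lt (show (0:ℝ) < y z + A by linarith [hall z hz])
    refine ⟨j, fun d hd => ?_⟩
    have : y z ≤ y d := hzmin ⟨hd.1.le, hd.2.le⟩
    linarith

lemma aux_path (y : ℝ → ℝ) (hy : Continuous y) {s T A : ℝ} (hA : 0 < A) (hys : y s = 0)
    (hne : {r : ℝ | s ≤ r ∧ A ≤ |y r|}.Nonempty) [Decidable (auxUp s T A y)]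
    [Decidable (auxUp s T A (fun r => - y r))] :
    y (min T (sInf {r : ℝ | s ≤ r ∧ A ≤ |y r|})) =
      if auxUp s T A y then A else if auxUp s T A (fun r => - y r) then -A else y T := by
  have hset : {r : ℝ | s ≤ r ∧ A ≤ |y r|} = {r : ℝ | s ≤ r ∧ A ≤ |(fun r => - y r) r|} := by
    simp only [abs_neg]
  split_ifs with h1 h2
  · exact aux_up_val y hy hA hys hne h1
  · have := aux_up_val (fun r => - y r) hy.neg (T := T) hA (by simpa using hys) (by rwa [← hset]) h2
    rw [← hset] at this
    linarith
  · have : T ≤ sInf {r : ℝ | s ≤ r ∧ A ≤ |y r|} := by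
      by_contra! h
      obtain ⟨hs, habs, hlt⟩ := aux_exit_props y hy hA hys hne
      rcases abs_eq hA.le |>.1 habs with h3 | h3
      · exact h1 (aux_up_of y hy hA hys hne h h3)
      · refine h2 (aux_up_of (fun r => - y r) hy.neg hA (by simpa using hys) (by rwa [← hset]) ?_ ?_)
        · rw [← hset]; exact h
        · rw [← hset, h3, neg_neg]
    rw [min_eq_left this]

lemma auxUp_meas {Ω : Type*} (m : MeasurableSpace Ω) (Y : ℝ → Ω → ℝ) {s T A : ℝ}
    (hY : ∀ r, s ≤ r → r ≤ T → Measurable[m] (Y r)) :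
    MeasurableSet[m] {ω | auxUp s T A (fun r => Y r ω)} := by
  unfold auxUp
  rw [Set.ofPred_exists]
  refine MeasurableSet.iUnion fun q => ?_
  by_cases hq : s < q ∧ (q : ℝ) ≤ T
  · simp only [hq, true_and, and_self]
    rw [Set.ofPred_and]
    refine MeasurableSet.inter ?_ ?_
    · rw [Set.ofPred_forall]
      refine MeasurableSet.iInter fun j => ?_
      rw [Set.ofPred_exists]
      refine MeasurableSet.iUnion fun d => ?_
      by_cases hd : s < d ∧ (d : ℝ) < q
      · simp only [hd, true_and, and_self]
        exact measurableSet_lt measurable_const (hY d hd.1.le (hd.2.le.trans hq.2))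
      · simp only [hd, false_and]; simp
    · rw [Set.ofPred_exists]
      refine MeasurableSet.iUnion fun j => ?_
      rw [Set.ofPred_forall]
      refine MeasurableSet.iInter fun d => ?_
      by_cases hd : s < d ∧ (d : ℝ) < q
      · simp only [hd, and_self, true_imp_iff]
        exact measurableSet_lt measurable_const (hY d hd.1.le (hd.2.le.trans hq.2))
      · simp only [hd, false_imp_iff]; simp
  · simp only [hq, false_and]; simp

lemma aux_gauss_bound (A : ℝ) (v : NNReal) (hv : v ≠ 0) :
    gaussianReal 0 v (Set.Ioo (-A) A) ≤ ENNReal.ofReal ((√(2 * Real.pi * v))⁻¹) * ENNReal.ofReal (2 * A) := by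
  rw [gaussianReal_apply _ hv]
  calc ∫⁻ x in Set.Ioo (-A) A, gaussianPDF 0 v x
      ≤ ∫⁻ x in Set.Ioo (-A) A, ENNReal.ofReal ((√(2 * Real.pi * v))⁻¹) := by
        refine lintegral_mono fun x => ?_
        unfold gaussianPDF
        refine ENNReal.ofReal_le_ofReal ?_
        unfold gaussianPDFReal
        refine mul_le_of_le_one_right (by positivity) ?_
        rw [Real.exp_le_one_iff]
        have : 0 ≤ (x - 0) ^ 2 / (2 * (v:ℝ)) := by positivity
        rw [neg_div]; linarith
    _ = _ := by
        rw [setLIntegral_const, Real.volume_Ioo]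
        congr 2; ring

lemma aux_exit_ae {Ω : Type*} [mΩ : MeasurableSpace Ω] (P : Measure Ω) (W : ℝ → Ω → ℝ)
    (hW : IsBrownianMotion P W) {s : ℝ} (hs : 0 ≤ s) (A : ℝ) :
    ∀ᵐ ω ∂P, {r : ℝ | s ≤ r ∧ A ≤ |W r ω - W s ω|}.Nonempty := by
  have hle : ∀ n : ℕ, P {ω | ¬ {r : ℝ | s ≤ r ∧ A ≤ |W r ω - W s ω|}.Nonempty} ≤
      ENNReal.ofReal ((√(2 * Real.pi * ((n:ℝ) + 1)))⁻¹) * ENNReal.ofReal (2 * A) := by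
    intro n
    have hm : Measurable (fun ω => W (s + (n + 1)) ω - W s ω) := (hW.meas _).sub (hW.meas _)
    have h1 := aux_gauss_bound A (Real.toNNReal ((n:ℝ)+1)) (by
      rw [Ne, Real.toNNReal_eq_zero]; push Not; positivity)
    have h2 := hW.incr s (s + (n+1)) hs (by linarith [(Nat.cast_nonneg n : (0:ℝ) ≤ n)])
    rw [add_sub_cancel_left] at h2
    rw [← h2, Measure.map_apply hm measurableSet_Ioo, Real.coe_toNNReal _ (by positivity)] at h1
    refine le_trans (measure_mono ?_) h1
    intro ω hω
    have : ¬ A ≤ |W (s + (n+1)) ω - W s ω| := fun h =>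
      hω ⟨s + (n+1), by linarith [(Nat.cast_nonneg n : (0:ℝ) ≤ n)], h⟩
    exact abs_lt.1 (not_le.1 this)
  have hlim : Filter.Tendsto (fun n : ℕ => ENNReal.ofReal ((√(2 * Real.pi * ((n:ℝ) + 1)))⁻¹) * ENNReal.ofReal (2 * A))
      Filter.atTop (nhds 0) := by
    have : Filter.Tendsto (fun n : ℕ => ENNReal.ofReal ((√(2 * Real.pi * ((n:ℝ) + 1)))⁻¹)) Filter.atTop (nhds 0) := by
      rw [← ENNReal.ofReal_zero]
      refine ENNReal.tendsto_ofReal ?_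
      refine Filter.Tendsto.inv_tendsto_atTop ?_
      refine Real.tendsto_sqrt_atTop.comp ?_
      refine Filter.Tendsto.const_mul_atTop (by positivity) ?_
      exact Filter.tendsto_atTop_add_const_right _ _ tendsto_natCast_atTop_atTop
    have h := ENNReal.Tendsto.mul_const this (b := ENNReal.ofReal (2 * A)) (Or.inr ENNReal.ofReal_ne_top)
    rwa [zero_mul] at h
  exact le_antisymm (ge_of_tendsto' hlim hle) zero_le

lemma aux_incr_version {Ω : Type*} [mΩ : MeasurableSpace Ω] (P : Measure Ω) (W : ℝ → Ω → ℝ)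
    (hW : IsBrownianMotion P W) {s T A : ℝ} (hs : 0 ≤ s) (hsT : s < T) (hA : 0 ≤ A) :
    ∃ Z : Ω → ℝ, Measurable[auxI W s T] Z ∧ ∀ᵐ ω ∂P,
      W (min T (sInf {r : ℝ | s ≤ r ∧ A ≤ |W r ω - W s ω|})) ω
      - W (min s (sInf {r : ℝ | s ≤ r ∧ A ≤ |W r ω - W s ω|})) ω = Z ω := by
  classical
  rcases hA.eq_or_lt with rfl | hA
  · refine ⟨fun _ => 0, measurable_const, Filter.Eventually.of_forall fun ω => ?_⟩
    have : {r : ℝ | s ≤ r ∧ 0 ≤ |W r ω - W s ω|} = Set.Ici s := by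
      ext r; simp
    rw [this, csInf_Ici, min_eq_right hsT.le, min_self, sub_self]
  · let Y : ℝ → Ω → ℝ := fun r ω => W r ω - W s ω
    refine ⟨fun ω => if auxUp s T A (fun r => Y r ω) then A else
      if auxUp s T A (fun r => - Y r ω) then -A else Y T ω, ?_, ?_⟩
    · refine Measurable.ite (auxUp_meas _ Y fun r h h' => auxI_meas W h h') measurable_const ?_
      refine Measurable.ite (auxUp_meas _ (fun r ω => - Y r ω)
        fun r h h' => (auxI_meas W h h').neg) measurable_const ?_
      exact auxI_meas W hsT.le le_rfl
    · filter_upwards [hW.cont, aux_exit_ae P W hW hs A] with ω hc hne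
      have hyc : Continuous (fun r => Y r ω) := hc.sub continuous_const
      have hy0 : (fun r => Y r ω) s = 0 := sub_self _
      have := aux_path (fun r => Y r ω) hyc (T := T) hA hy0 hne
      rw [← this]
      have h2 := (aux_exit_props (fun r => Y r ω) hyc hA hy0 hne).1
      have h3 : min s (sInf {r : ℝ | s ≤ r ∧ A ≤ |W r ω - W s ω|}) = s := min_eq_left h2.le
      rw [h3]

lemma aux_trunc_incr {Ω : Type*} (W : ℝ → Ω → ℝ) (N : ℕ) (k : ℕ) (hk : k < N) (ω : Ω) :
    truncWiener W N ((k + 1) * (1 / N : ℝ)) ω - truncWiener W N (k * (1 / N : ℝ)) ω =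
      W (min ((k + 1) * (1 / N : ℝ)) (truncStop W (1 / N)
        (4 * Real.sqrt ((1 / N : ℝ) * Real.log (1 / (1 / N : ℝ)))) k ω)) ω -
      W (min (k * (1 / N : ℝ)) (truncStop W (1 / N)
        (4 * Real.sqrt ((1 / N : ℝ) * Real.log (1 / (1 / N : ℝ)))) k ω)) ω := by
  have hN : (0:ℝ) < N := by exact_mod_cast (Nat.zero_le k).trans_lt hk
  have hh : (0:ℝ) < 1 / N := by positivity
  simp only [truncWiener]
  generalize (1 / (N:ℝ)) = h at *
  rw [← Finset.sum_sub_distrib, Finset.sum_eq_single k]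
  · have e1 : min (max (((k:ℝ) + 1) * h) (k * h)) ((k + 1) * h) = (k + 1) * h := by
      rw [max_eq_left (by nlinarith), min_self]
    have e2 : min (max ((k:ℝ) * h) (k * h)) ((k + 1) * h) = k * h := by
      rw [max_self, min_eq_left (by nlinarith)]
    rw [e1, e2]; ring
  · intro j _ hj
    have : min (max (((k:ℝ) + 1) * h) (j * h)) ((j + 1) * h)
        = min (max ((k:ℝ) * h) (j * h)) ((j + 1) * h) := by
      rcases lt_or_gt_of_ne hj with hlt | hlt
      · have : (j:ℝ) + 1 ≤ k := by exact_mod_cast hlt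
        have a1 : ((j:ℝ) + 1) * h ≤ k * h := by nlinarith
        rw [max_eq_left (by nlinarith), max_eq_left (by nlinarith), min_eq_right (by nlinarith),
          min_eq_right a1]
      · have : (k:ℝ) + 1 ≤ j := by exact_mod_cast hlt
        have a1 : ((k:ℝ) + 1) * h ≤ j * h := by nlinarith
        rw [max_eq_right a1, max_eq_right (by nlinarith)]
    rw [this, sub_self]
  · intro h; exact absurd (Finset.mem_range.2 hk) h

lemma aux_exists_Z {Ω : Type*} [mΩ : MeasurableSpace Ω] (P : Measure Ω) (W : ℝ → Ω → ℝ)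
    (hW : IsBrownianMotion P W) (N : ℕ) (hN : 0 < N) :
    ∃ Z : ℕ → Ω → ℝ, (∀ k, Measurable (Z k)) ∧ iIndepFun Z P ∧ ∀ᵐ ω ∂P, ∀ k < N,
      truncWiener W N ((k + 1) * (1 / N : ℝ)) ω - truncWiener W N (k * (1 / N : ℝ)) ω
        = Z (k + 1) ω := by
  have := hW.isProb
  have hN : (0:ℝ) < N := by exact_mod_cast hN
  have hh : (0:ℝ) < 1 / N := by positivity
  have hk0 : ∀ k : ℕ, (0:ℝ) ≤ k * (1 / N : ℝ) := fun k => by positivity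
  have hk1 : ∀ k : ℕ, (k:ℝ) * (1 / N : ℝ) < (k + 1) * (1 / N : ℝ) := fun k => by nlinarith
  choose Y hYm hY using fun k : ℕ => aux_incr_version P W hW (hk0 k) (hk1 k)
    (A := 4 * Real.sqrt ((1 / N : ℝ) * Real.log (1 / (1 / N : ℝ)))) (by positivity)
  let m : ℕ → MeasurableSpace Ω
    | 0 => ⊥
    | k + 1 => auxI W (k * (1 / N : ℝ)) ((k + 1) * (1 / N : ℝ))
  let Z : ℕ → Ω → ℝ
    | 0 => fun _ => 0
    | k + 1 => Y k
  have hmF : ∀ j k : ℕ, j < k + 1 → m j ≤ auxF W (k * (1 / N : ℝ)) := by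
    rintro (_ | j) k hjk
    · exact bot_le
    · refine (auxI_le_auxF W (hk0 j) (hk1 j).le).trans (auxF_mono W ?_)
      have : (j:ℝ) + 1 ≤ k := by exact_mod_cast Nat.lt_of_succ_lt_succ hjk
      nlinarith
  have hZm : ∀ k, Measurable[m k] (Z k) := by
    rintro (_ | k)
    · exact measurable_const
    · exact hYm k
  have hmle : ∀ k, m k ≤ mΩ := fun k => (hmF k k (Nat.lt_succ_self k)).trans (auxF_le W hW.meas _)
  refine ⟨Z, fun k => (hZm k).mono (hmle k) le_rfl, ?_, ?_⟩
  · have hi : iIndep m P := by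
      refine aux_iIndep_seq P m ?_
      rintro (_ | k)
      · exact indep_bot_left _
      · exact indep_of_indep_of_le_right (aux_indep_incr P W hW (hk0 k))
          (iSup₂_le fun j hj => hmF j k hj)
    rw [iIndepFun_iff_iIndep]
    rw [iIndep_iff] at hi ⊢
    intro S f hf
    exact hi S fun i hi' => (measurable_iff_comap_le.1 (hZm i)) _ (hf i hi')
  · have := ae_all_iff.2 hY
    filter_upwards [this] with ω hω k hk
    rw [aux_trunc_incr W N k hk]
    exact hω k

/-- **The joint law of coupled monotone Euler–Maruyama schemes is the
Knothe–Rosenblatt rearrangement.** If `X^h` and `X̄^h` are the monotone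
Euler–Maruyama schemes with Lipschitz coefficients `(b, σ)` and `(b̄, σ̄)`
(`σ, σ̄ ≥ 0`), both started at `x₀` and driven by the same Brownian motion `W`, and
`μ^h, ν^h` are the laws of `(X^h_{kh})_{k=0,…,N}` and `(X̄^h_{kh})_{k=0,…,N}` on
`ℝ^{N+1}`, then `Law((X^h_{kh})ₖ, (X̄^h_{kh})ₖ) = π^{KR}_{μ^h, ν^h}`. -/
theorem joint_law_monotone_em_eq_kr
    {Ω : Type*} [MeasurableSpace Ω] (P : Measure Ω) (W : ℝ → Ω → ℝ)
    (hW : IsBrownianMotion P W)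
    (b bbar σ σbar : ℝ → ℝ) (Cb Cbbar Cσ Cσbar : ℝ≥0)
    (hb : LipschitzWith Cb b) (hbbar : LipschitzWith Cbbar bbar)
    (hσ : LipschitzWith Cσ σ) (hσbar : LipschitzWith Cσbar σbar)
    (hσ0 : ∀ x, 0 ≤ σ x) (hσbar0 : ∀ x, 0 ≤ σbar x)
    (x₀ : ℝ) (N : ℕ) (hN : 0 < N)
    (μh νh : Measure (Fin (N + 1) → ℝ))
    [IsProbabilityMeasure μh] [IsProbabilityMeasure νh]
    (hμh : μh = P.map fun ω => fun k : Fin (N + 1) => monEMdisc W N b σ x₀ k ω)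
    (hνh : νh = P.map fun ω => fun k : Fin (N + 1) => monEMdisc W N bbar σbar x₀ k ω) :
    P.map (fun ω =>
        ((fun k : Fin (N + 1) => monEMdisc W N b σ x₀ k ω),
         (fun k : Fin (N + 1) => monEMdisc W N bbar σbar x₀ k ω)))
      = KR μh νh := by
  have := hW.isProb
  obtain ⟨Z, hZm, hZi, hZ⟩ := aux_exists_Z P W hW N hN
  exact aux_final P W b bbar σ σbar hb.continuous.measurable hbbar.continuous.measurable
    hσ.continuous.measurable hσbar.continuous.measurable hσ0 hσbar0 x₀ N μh νh hμh hνh Z hZm hZi hZ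

end
end

section
/- Lipschitz estimate for the Zvonkin transformation: Let b : ℝ → ℝ be bounded and measurable, and let σ : ℝ → (0,∞) be bounded, Lipschitz with constant K^σ, and uniformly positive with σ₀ := inf_{y∈ℝ} σ(y) > 0. Fix x₀ ∈ ℝ and define T′(x) := exp(−2 ∫_{x₀}^x b(y)/σ(y)² dy) and T(x) := ∫_{x₀}^x T′(z) dz for x ∈ ℝ. Then for all x₁, x₂ ∈ ℝ, |σ(x₂)T′(x₂) − σ(x₁)T′(x₁)| ≤ (K^σ + 2‖b‖_∞/σ₀) |T(x₂) − T(x₁)|. Equivalently, the map (σT′)∘T^{-1} is Lipschitz on the range of T. -/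
open MeasureTheory
open scoped NNReal

theorem aux_exp (u v : ℝ) (h : |u| ≤ v) : |Real.exp u - 1| ≤ v * Real.exp v := by
  obtain ⟨h1, h2⟩ := abs_le.mp h
  have hv : 0 ≤ v := (abs_nonneg u).trans h
  have hA : Real.exp v - 1 ≤ v * Real.exp v := by
    have := Real.add_one_le_exp (-v)
    have h3 : Real.exp (-v) * Real.exp v = 1 := by rw [← Real.exp_add]; simp
    nlinarith [Real.exp_pos v]
  have hB : Real.exp u ≤ Real.exp v := Real.exp_le_exp.mpr h2
  have hC := Real.add_one_le_exp u
  have hD : v ≤ v * Real.exp v := by nlinarith [Real.add_one_le_exp v]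
  rw [abs_le]; constructor <;> linarith

/-- **Lipschitz estimate for the Zvonkin transformation.**
For `b` bounded measurable with `|b| ≤ M_b`, and `σ` bounded, `K^σ`-Lipschitz and
bounded below by `σ₀ > 0`, the Zvonkin transformation
`T(x) = ∫_{x₀}^x exp(−2∫_{x₀}^z b/σ² dy) dz` with derivative `T′` satisfies
`|σ(x₂)T′(x₂) − σ(x₁)T′(x₁)| ≤ (K^σ + 2 M_b/σ₀)|T(x₂) − T(x₁)|` for all `x₁, x₂`;
equivalently, `(σT′) ∘ T⁻¹` is Lipschitz on the range of `T`. -/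
theorem zvonkin_lipschitz_estimate
    (b : ℝ → ℝ) (hbmeas : Measurable b) (Mb : ℝ) (hb : ∀ x, |b x| ≤ Mb)
    (σ : ℝ → ℝ) (Kσ : ℝ≥0) (hσlip : LipschitzWith Kσ σ)
    (Mσ : ℝ) (hσbd : ∀ x, σ x ≤ Mσ)
    (σ₀ : ℝ) (hσ₀ : 0 < σ₀) (hσpos : ∀ x, σ₀ ≤ σ x)
    (x₀ : ℝ) (T' T : ℝ → ℝ)
    (hT' : T' = fun x => Real.exp (-2 * ∫ y in x₀..x, b y / σ y ^ 2))
    (hT : T = fun x => ∫ z in x₀..x, T' z) :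
    ∀ x₁ x₂ : ℝ,
      |σ x₂ * T' x₂ - σ x₁ * T' x₁| ≤ (Kσ + 2 * Mb / σ₀) * |T x₂ - T x₁| := by
  have hMb : 0 ≤ Mb := (abs_nonneg _).trans (hb 0)
  have hσp : ∀ x, 0 < σ x := fun x => hσ₀.trans_le (hσpos x)
  have hmeas : Measurable (fun y => b y / σ y ^ 2) :=
    hbmeas.div (hσlip.continuous.measurable.pow_const 2)
  have hbd : ∀ y m, 0 < m → m ≤ σ y → ‖b y / σ y ^ 2‖ ≤ Mb / m ^ 2 := by
    intro y m hm hy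
    rw [Real.norm_eq_abs, abs_div, abs_of_pos (pow_pos (hσp y) 2)]
    have := hb y
    gcongr
  have hint : ∀ u v : ℝ, IntervalIntegrable (fun y => b y / σ y ^ 2) volume u v := by
    intro u v
    refine (intervalIntegrable_const (c := Mb / σ₀ ^ 2)).mono_fun
      hmeas.aestronglyMeasurable (Filter.Eventually.of_forall fun y => ?_)
    exact (hbd y σ₀ hσ₀ (hσpos y)).trans (le_abs_self _)
  have hT'c : Continuous T' := by
    rw [hT']
    exact Real.continuous_exp.comp
      (continuous_const.mul (intervalIntegral.continuous_primitive hint x₀))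
  have hT'pos : ∀ x, 0 < T' x := fun x => by rw [hT']; exact Real.exp_pos _
  have hTd : ∀ x, HasDerivAt T (T' x) x := fun x => by
    rw [hT]
    exact intervalIntegral.integral_hasDerivAt_right (hT'c.intervalIntegrable _ _)
      (hT'c.stronglyMeasurableAtFilter _ _) hT'c.continuousAt
  set C : ℝ := Kσ + 2 * Mb / σ₀ with hC
  set f : ℝ → ℝ := fun x => σ x * T' x with hf
  have hfc : Continuous f := hσlip.continuous.mul hT'c
  -- local estimate
  have hloc : ∀ x z, x < z → |f z - f x| ≤ (z - x) * (Kσ * T' z + σ x * T' x *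
      (2 * Mb / (max σ₀ (σ x - Kσ * (z - x))) ^ 2 *
        Real.exp (2 * Mb / (max σ₀ (σ x - Kσ * (z - x))) ^ 2 * (z - x)))) := by
    intro x z hxz
    set m := max σ₀ (σ x - Kσ * (z - x)) with hm
    have hmpos : 0 < m := hσ₀.trans_le (le_max_left _ _)
    have hI : ‖∫ y in x..z, b y / σ y ^ 2‖ ≤ Mb / m ^ 2 * |z - x| := by
      refine intervalIntegral.norm_integral_le_of_norm_le_const fun y hy => ?_
      rw [Set.uIoc_of_le hxz.le] at hy
      refine hbd y m hmpos (max_le (hσpos y) ?_)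
      have h1 := hσlip.dist_le_mul x y
      rw [Real.dist_eq, Real.dist_eq] at h1
      have h2 : |x - y| ≤ z - x := by rw [abs_le]; constructor <;> linarith [hy.1, hy.2]
      have h3 := mul_le_mul_of_nonneg_left h2 Kσ.coe_nonneg
      linarith [le_abs_self (σ x - σ y)]
    have hsplit : T' z = T' x * Real.exp (-2 * ∫ y in x..z, b y / σ y ^ 2) := by
      rw [hT']
      simp only
      rw [← Real.exp_add, ← mul_add,
        intervalIntegral.integral_add_adjacent_intervals (hint _ _) (hint _ _)]
    have hE := aux_exp (-2 * ∫ y in x..z, b y / σ y ^ 2) (2 * Mb / m ^ 2 * (z - x)) (by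
      rw [abs_mul, abs_neg, abs_two]
      rw [Real.norm_eq_abs, abs_of_pos (sub_pos.mpr hxz)] at hI
      calc _ ≤ 2 * (Mb / m ^ 2 * (z - x)) := by gcongr
        _ = _ := by ring)
    have hK : |σ z - σ x| ≤ Kσ * (z - x) := by
      have h1 := hσlip.dist_le_mul z x
      rwa [Real.dist_eq, Real.dist_eq, abs_of_pos (sub_pos.mpr hxz)] at h1
    have hdec : f z - f x = (σ z - σ x) * T' z +
        σ x * T' x * (Real.exp (-2 * ∫ y in x..z, b y / σ y ^ 2) - 1) := by
      simp only [hf]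
      linear_combination σ x * hsplit
    rw [hdec]
    refine (abs_add_le _ _).trans ?_
    rw [abs_mul, abs_mul, abs_of_pos (hT'pos z), abs_of_pos (mul_pos (hσp x) (hT'pos x))]
    have e1 := mul_le_mul_of_nonneg_right hK (hT'pos z).le
    have e2 := mul_le_mul_of_nonneg_left hE (mul_pos (hσp x) (hT'pos x)).le
    refine (add_le_add e1 e2).trans (le_of_eq ?_)
    ring
  have hslope : ∀ x r, C * T' x < r →
      ∀ᶠ z in nhdsWithin x (Set.Ioi x), |f z - f x| < (z - x) * r := by
    intro x r hr
    have hcont : Continuous (fun z => Kσ * T' z + σ x * T' x *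
      (2 * Mb / (max σ₀ (σ x - Kσ * (z - x))) ^ 2 *
        Real.exp (2 * Mb / (max σ₀ (σ x - Kσ * (z - x))) ^ 2 * (z - x)))) := by
      have hv : Continuous (fun z => 2 * Mb / (max σ₀ (σ x - Kσ * (z - x))) ^ 2) := by
        refine Continuous.div continuous_const (by fun_prop) fun z => ?_
        exact (pow_pos (hσ₀.trans_le (le_max_left _ _)) 2).ne'
      fun_prop
    have hlim := hcont.tendsto x
    have hlt : (Kσ * T' x + σ x * T' x *
      (2 * Mb / (max σ₀ (σ x - Kσ * (x - x))) ^ 2 *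
        Real.exp (2 * Mb / (max σ₀ (σ x - Kσ * (x - x))) ^ 2 * (x - x)))) < r := by
      refine lt_of_le_of_lt ?_ hr
      rw [sub_self, mul_zero, sub_zero, max_eq_right (hσpos x), mul_zero, Real.exp_zero]
      have h1 : 2 * Mb / σ x ≤ 2 * Mb / σ₀ := by
        have := hσpos x
        gcongr
      have h2 := mul_le_mul_of_nonneg_right h1 (hT'pos x).le
      have h3 : σ x * T' x * (2 * Mb / σ x ^ 2 * 1) = 2 * Mb / σ x * T' x := by
        have := (hσp x).ne'
        field_simp
      rw [h3, hC, add_mul]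
      linarith
    have hev := (hlim.eventually (gt_mem_nhds hlt)).filter_mono
      (nhdsWithin_le_nhds (s := Set.Ioi x))
    filter_upwards [hev, self_mem_nhdsWithin] with z hz hxz
    exact (hloc x z hxz).trans_lt (mul_lt_mul_of_pos_left hz (sub_pos.mpr hxz))
  have key : ∀ (g : ℝ → ℝ), Continuous g → (∀ x z, g z - g x ≤ |f z - f x|) →
      ∀ a c : ℝ, a ≤ c → g c - g a ≤ C * (T c - T a) := by
    intro g hg hgf a c hac
    have hBd : ∀ x, HasDerivAt (fun x => g a + C * (T x - T a)) (C * T' x) x := fun x =>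
      (((hTd x).sub_const (T a)).const_mul C).const_add (g a)
    have := image_le_of_liminf_slope_right_le_deriv_boundary (f := g) (a := a) (b := c)
      (B := fun x => g a + C * (T x - T a)) (B' := fun x => C * T' x)
      hg.continuousOn (by simp) (fun x _ => (hBd x).continuousAt.continuousWithinAt)
      (fun x _ => (hBd x).hasDerivWithinAt) (fun x _ r hr => by
        refine Filter.Eventually.frequently ?_
        filter_upwards [hslope x r hr, self_mem_nhdsWithin] with z hz hxz
        rw [slope_def_field, div_lt_iff₀ (sub_pos.mpr hxz)]
        linarith [hgf x z]) (Set.right_mem_Icc.mpr hac)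
    linarith
  have main : ∀ a c : ℝ, a ≤ c → |f c - f a| ≤ C * (T c - T a) := by
    intro a c hac
    refine abs_le'.mpr ⟨key f hfc (fun _ _ => le_abs_self _) a c hac, ?_⟩
    have := key (fun x => - f x) hfc.neg (fun x z => by
      rw [abs_sub_comm]; exact (by ring : -f z - -f x = f x - f z).le.trans (le_abs_self _)) a c hac
    linarith
  have hC0 : 0 ≤ C := by positivity
  intro x₁ x₂
  change |f x₂ - f x₁| ≤ _
  rcases le_total x₁ x₂ with h | h
  · exact (main _ _ h).trans (mul_le_mul_of_nonneg_left (le_abs_self _) hC0)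
  · rw [abs_sub_comm, abs_sub_comm (T x₂)]
    exact (main _ _ h).trans (mul_le_mul_of_nonneg_left (le_abs_self _) hC0)
end

section
/- Rigidity of bi-causal couplings in the motivating example: Let n ∈ ℕ, let U and V be random variables uniformly distributed on {−1, 1}, let μ be the law on ℝ² of (U/n, U) and ν the law on ℝ² of (0, V). Then every bi-causal coupling π between μ and ν equals the product coupling μ ⊗ ν, and consequently ∫_{ℝ²×ℝ²} |x₂ − y₂|² dπ(x,y) = 2, where x = (x₁,x₂) and y = (y₁,y₂) denote the canonical coordinates. -/
open MeasureTheory ProbabilityTheory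

theorem aux_pm {Ω : Type*} [MeasurableSpace Ω] (P : Measure Ω) [IsProbabilityMeasure P]
    (U : Ω → ℝ) (hU : Measurable U)
    (hU1 : P {ω | U ω = 1} = 1 / 2) (hU2 : P {ω | U ω = -1} = 1 / 2) :
    (∀ᵐ ω ∂P, U ω = 1 ∨ U ω = -1) ∧ ∫ ω, U ω ∂P = 0 := by
  have m1 : MeasurableSet {ω | U ω = 1} := hU (measurableSet_singleton 1)
  have m2 : MeasurableSet {ω | U ω = -1} := hU (measurableSet_singleton (-1))
  have hae : ∀ᵐ ω ∂P, U ω = 1 ∨ U ω = -1 := by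
    have h : P ({ω | U ω = 1} ∪ {ω | U ω = -1}) = 1 := by
      rw [measure_union _ m2, hU1, hU2, ENNReal.add_halves]
      rw [Set.disjoint_left]
      intro ω h1 h2
      simp only [Set.mem_ofPred_eq] at h1 h2
      linarith
    exact (prob_compl_eq_zero_iff (m1.union m2)).2 h
  refine ⟨hae, ?_⟩
  have : U =ᵐ[P] fun ω => ({ω | U ω = 1}.indicator (fun _ => (1:ℝ)) ω)
      - ({ω | U ω = -1}.indicator (fun _ => (1:ℝ)) ω) := by
    filter_upwards [hae] with ω h
    rcases h with h | h <;> simp [Set.indicator, h] <;> norm_num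
  rw [integral_congr_ae this, integral_sub
    ((integrable_const _).indicator m1) ((integrable_const _).indicator m2),
    integral_indicator_const _ m1, integral_indicator_const _ m2]
  simp [Measure.real, hU1, hU2]

theorem aux_const {X : Type*} {mX : MeasurableSpace X} (π : Measure X) [IsProbabilityMeasure π]
    (y : X → ℝ) (hy : Measurable y) (hy0 : ∀ᵐ p ∂π, y p = 0) (f : X → ℝ) :
    π[f | MeasurableSpace.comap y inferInstance] =ᵐ[π] fun _ => ∫ p, f p ∂π := by
  have hm : Measurable[MeasurableSpace.comap y inferInstance]
      (π[f | MeasurableSpace.comap y inferInstance]) := stronglyMeasurable_condExp.measurable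
  obtain ⟨h, -, hh⟩ := hm.exists_eq_measurable_comp
  have e : π[f | MeasurableSpace.comap y inferInstance] =ᵐ[π] fun _ => h 0 := by
    filter_upwards [hy0] with p hp
    rw [hh, Function.comp, hp]
  have i := integral_condExp (μ := π) (f := f) hy.comap_le
  rw [integral_congr_ae e] at i
  simp at i
  rw [← i]
  exact e



/-- **Rigidity of bi-causal couplings in the motivating example.**
Let `U, V` be uniform on `{−1, 1}`, let `μ = Law(U/n, U)` and `ν = Law(0, V)` on `ℝ²`.
Then every bi-causal coupling `π` of `μ` and `ν` (i.e. any coupling such that, under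
`π`, `σ(y₁)` is conditionally independent of `σ(x₁,x₂)` given `σ(x₁)` and `σ(x₁)` is
conditionally independent of `σ(y₁,y₂)` given `σ(y₁)`) equals the product coupling
`μ ⊗ ν`, and consequently `∫ |x₂ − y₂|² dπ = 2`. -/
theorem bicausal_rigidity_motivating_example
    {Ω : Type*} [MeasurableSpace Ω] (P : Measure Ω) [IsProbabilityMeasure P]
    (n : ℕ) (hn : 0 < n)
    (U V : Ω → ℝ) (hU : Measurable U) (hV : Measurable V)
    (hU1 : P {ω | U ω = 1} = 1 / 2) (hU2 : P {ω | U ω = -1} = 1 / 2)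
    (hV1 : P {ω | V ω = 1} = 1 / 2) (hV2 : P {ω | V ω = -1} = 1 / 2)
    (μ ν : Measure (ℝ × ℝ))
    (hμ : μ = P.map fun ω => (U ω / n, U ω))
    (hν : ν = P.map fun ω => ((0 : ℝ), V ω))
    (π : Measure ((ℝ × ℝ) × (ℝ × ℝ))) [IsProbabilityMeasure π]
    (hπfst : π.fst = μ) (hπsnd : π.snd = ν)
    (hbc₁ : CondIndep
      (MeasurableSpace.comap (fun p : (ℝ × ℝ) × (ℝ × ℝ) => p.1.1) inferInstance)
      (MeasurableSpace.comap (fun p : (ℝ × ℝ) × (ℝ × ℝ) => p.2.1) inferInstance)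
      (MeasurableSpace.comap (Prod.fst : (ℝ × ℝ) × (ℝ × ℝ) → ℝ × ℝ) inferInstance)
      (measurable_fst.fst.comap_le) π)
    (hbc₂ : CondIndep
      (MeasurableSpace.comap (fun p : (ℝ × ℝ) × (ℝ × ℝ) => p.2.1) inferInstance)
      (MeasurableSpace.comap (fun p : (ℝ × ℝ) × (ℝ × ℝ) => p.1.1) inferInstance)
      (MeasurableSpace.comap (Prod.snd : (ℝ × ℝ) × (ℝ × ℝ) → ℝ × ℝ) inferInstance)
      (measurable_snd.fst.comap_le) π) :
    π = μ.prod ν ∧ ∫ p, |p.1.2 - p.2.2| ^ 2 ∂π = 2 := by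

  obtain ⟨aU, iU⟩ := aux_pm P U hU hU1 hU2
  obtain ⟨aV, iV⟩ := aux_pm P V hV hV1 hV2
  have n0 : (n : ℝ) ≠ 0 := by positivity
  have mU : Measurable fun ω => (U ω / n, U ω) := by fun_prop
  have mV : Measurable fun ω => ((0 : ℝ), V ω) := by fun_prop
  have : IsProbabilityMeasure μ := hμ ▸ Measure.isProbabilityMeasure_map mU.aemeasurable
  have : IsProbabilityMeasure ν := hν ▸ Measure.isProbabilityMeasure_map mV.aemeasurable
  have mpf : MeasurePreserving Prod.fst π μ := ⟨measurable_fst, hπfst⟩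
  have mps : MeasurePreserving Prod.snd π ν := ⟨measurable_snd, hπsnd⟩
  have ax : ∀ᵐ x ∂μ, x.2 = (n : ℝ) * x.1 ∧ (x.2 = 1 ∨ x.2 = -1) := by
    have ms : MeasurableSet {x : ℝ × ℝ | x.2 = (n : ℝ) * x.1 ∧ (x.2 = 1 ∨ x.2 = -1)} :=
      (measurableSet_eq_fun measurable_snd (measurable_fst.const_mul _)).inter
        ((measurableSet_eq_fun measurable_snd measurable_const).union
          (measurableSet_eq_fun measurable_snd measurable_const))
    rw [hμ, ae_map_iff mU.aemeasurable ms]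
    filter_upwards [aU] with ω h
    exact ⟨by field_simp, h⟩
  have ay : ∀ᵐ y ∂ν, y.1 = 0 ∧ (y.2 = 1 ∨ y.2 = -1) := by
    rw [hν, ae_map_iff mV.aemeasurable (by measurability)]
    filter_upwards [aV] with ω h
    exact ⟨rfl, h⟩
  have bx := mpf.quasiMeasurePreserving.ae ax
  have bys := mps.quasiMeasurePreserving.ae ay
  have hy0 : ∀ᵐ p ∂π, (fun p : (ℝ × ℝ) × (ℝ × ℝ) => p.2.1) p = 0 := bys.mono fun p h => h.1
  have my : Measurable (fun p : (ℝ × ℝ) × (ℝ × ℝ) => p.2.1) := by fun_prop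
  have mx : Measurable (fun p : (ℝ × ℝ) × (ℝ × ℝ) => p.1.1) := by fun_prop
  rw [condIndep_iff _ _ _ _ mx.comap_le measurable_snd.comap_le] at hbc₂
  have key : ∀ A B, MeasurableSet A → MeasurableSet B →
      π.real (((fun p : (ℝ × ℝ) × (ℝ × ℝ) => p.1.1) ⁻¹' A) ∩ (Prod.snd ⁻¹' B))
      = π.real ((fun p : (ℝ × ℝ) × (ℝ × ℝ) => p.1.1) ⁻¹' A) * π.real (Prod.snd ⁻¹' B) := by
    intro A B hA hB
    have h := hbc₂ _ _ ⟨A, hA, rfl⟩ ⟨B, hB, rfl⟩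
    have h1 := (aux_const π _ my hy0 _).symm.trans
      (h.trans ((aux_const π _ my hy0 _).mul (aux_const π _ my hy0 _)))
    obtain ⟨p, hp⟩ := h1.exists
    have sA := mx hA
    have sB : MeasurableSet ((Prod.snd : (ℝ × ℝ) × (ℝ × ℝ) → ℝ × ℝ) ⁻¹' B) := measurable_snd hB
    simp only [Pi.mul_apply] at hp
    rw [integral_indicator_const _ (sA.inter sB), integral_indicator_const _ sA,
      integral_indicator_const _ sB] at hp
    simpa using hp
  have hprod : π = μ.prod ν := by
    symm
    apply Measure.prod_eq
    intro S T hS hT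
    set A : Set ℝ := (fun t : ℝ => (t, (n : ℝ) * t)) ⁻¹' S with hA
    have mA : MeasurableSet A := (by fun_prop : Measurable fun t : ℝ => (t, (n:ℝ) * t)) hS
    have e : (Prod.fst ⁻¹' S : Set ((ℝ × ℝ) × (ℝ × ℝ))) =ᵐ[π]
        ((fun p : (ℝ × ℝ) × (ℝ × ℝ) => p.1.1) ⁻¹' A) := by
      rw [Filter.eventuallyEq_set]
      filter_upwards [bx] with p hp
      simp only [hA, Set.mem_preimage]
      rw [← hp.1]
    have k := key A T mA hT
    have e2 : (Prod.fst ⁻¹' S ∩ Prod.snd ⁻¹' T : Set ((ℝ × ℝ) × (ℝ × ℝ))) =ᵐ[π]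
        (((fun p : (ℝ × ℝ) × (ℝ × ℝ) => p.1.1) ⁻¹' A) ∩ Prod.snd ⁻¹' T : Set _) :=
      e.inter (Filter.EventuallyEq.refl _ _)
    rw [← measureReal_congr e, ← measureReal_congr e2] at k
    rw [← mpf.measure_preimage hS.nullMeasurableSet, ← mps.measure_preimage hT.nullMeasurableSet,
      Set.prod_eq]
    simp only [Measure.real, ← ENNReal.toReal_mul] at k
    exact (ENNReal.toReal_eq_toReal_iff' (by finiteness) (by finiteness)).1 k
  refine ⟨hprod, ?_⟩
  have e : (fun p : (ℝ × ℝ) × (ℝ × ℝ) => |p.1.2 - p.2.2| ^ 2) =ᵐ[π]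
      fun p => 2 - 2 * (p.1.2 * p.2.2) := by
    filter_upwards [bx, bys] with p h1 h2
    rw [sq_abs]
    rcases h1.2 with h | h <;> rcases h2.2 with h' | h' <;> rw [h, h'] <;> norm_num
  have hint : Integrable (fun p : (ℝ × ℝ) × (ℝ × ℝ) => p.1.2 * p.2.2) π := by
    refine Integrable.of_bound (by fun_prop) 1 ?_
    filter_upwards [bx, bys] with p h1 h2
    rcases h1.2 with h | h <;> rcases h2.2 with h' | h' <;> rw [h, h'] <;> norm_num
  have hz : ∫ p : (ℝ × ℝ) × (ℝ × ℝ), p.1.2 * p.2.2 ∂π = 0 := by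
    rw [hprod, integral_prod_mul (fun x : ℝ × ℝ => x.2) (fun y : ℝ × ℝ => y.2)]
    have : ∫ x : ℝ × ℝ, x.2 ∂μ = 0 := by
      rw [hμ, integral_map mU.aemeasurable (by fun_prop)]
      exact iU
    rw [this, zero_mul]
  rw [integral_congr_ae e, integral_sub (integrable_const _) (hint.const_mul 2),
    integral_const_mul, hz]
  simp
end
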